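/- arXiv:2010.10256 — 2 statements merged into one kernel-verified Lean document; each statement's English description precedes it below -/
import Mathlib

section
/- For all positive integers x and y with x³ ≠ y², one has |x³ − y²| > 10⁻¹⁰·(log x)^(1/10000). -/
open Polynomial in
/-- The operator `r z d/dz + o` on polynomials in `z`; it corresponds to `Z d/dZ` acting on
`Z ^ o * P (Z ^ r)`. -/
noncomputable def twistedEuler (r o : ℕ) (P : ℂ[X]) : ℂ[X] :=
  C (r : ℂ) * (X * derivative P) + C (o : ℂ) * P

open Polynomial in
theorem coeff_X_mul_derivative (P : ℂ[X]) (l : ℕ) :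
    (X * derivative P).coeff l = l * P.coeff l := by
  cases l with
  | zero => simp
  | succ l => rw [coeff_X_mul, coeff_derivative]; push_cast; ring

open Polynomial in
theorem coeff_iterate_twistedEuler (r o a : ℕ) (P : ℂ[X]) (l : ℕ) :
    ((twistedEuler r o)^[a] P).coeff l = ((r * l + o : ℕ) : ℂ) ^ a * P.coeff l := by
  induction a with
  | zero => simp
  | succ a ih =>
    rw [Function.iterate_succ_apply', twistedEuler, coeff_add, coeff_C_mul, coeff_C_mul,
      coeff_X_mul_derivative, ih]
    push_cast; ring

open Polynomial in
theorem natDegree_iterate_twistedEuler_le (r o a : ℕ) (P : ℂ[X]) :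
    ((twistedEuler r o)^[a] P).natDegree ≤ P.natDegree := by
  rw [natDegree_le_iff_coeff_eq_zero]
  intro l hl
  rw [coeff_iterate_twistedEuler, coeff_eq_zero_of_natDegree_lt hl, mul_zero]

open Polynomial in
theorem X_mul_derivative_X_pow_mul_comp (r o : ℕ) (P : ℂ[X]) :
    X * derivative (X ^ o * P.comp (X ^ r)) = X ^ o * (twistedEuler r o P).comp (X ^ r) := by
  have h1 : ∀ n : ℕ, (X : ℂ[X]) * derivative (X ^ n) = C (n : ℂ) * X ^ n := by
    intro n
    ext l
    rw [coeff_X_mul_derivative, coeff_C_mul, coeff_X_pow]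
    split_ifs with h <;> simp [h]
  rw [derivative_mul, derivative_comp, twistedEuler, add_comp, mul_comp, mul_comp, mul_comp, X_comp,
    C_comp, C_comp]
  linear_combination (P.comp (X ^ r)) * h1 o + X ^ o * (derivative P).comp (X ^ r) * h1 r

open Polynomial in
theorem iterate_X_mul_derivative (r o a : ℕ) (P : ℂ[X]) :
    (fun f : ℂ[X] => X * derivative f)^[a] (X ^ o * P.comp (X ^ r)) =
      X ^ o * ((twistedEuler r o)^[a] P).comp (X ^ r) := by
  induction a with
  | zero => simp
  | succ a ih =>
    rw [Function.iterate_succ_apply', Function.iterate_succ_apply', ih]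
    exact X_mul_derivative_X_pow_mul_comp r o _

open Polynomial in
theorem X_sub_C_pow_dvd_iterate_X_mul_derivative (c : ℂ) (T a : ℕ) (f : ℂ[X])
    (hf : (X - C c) ^ T ∣ f) :
    (X - C c) ^ (T - a) ∣ (fun f : ℂ[X] => X * derivative f)^[a] f := by
  induction a with
  | zero => simpa using hf
  | succ a ih =>
    rw [Function.iterate_succ_apply']
    refine Dvd.dvd.mul_left ?_ _
    exact pow_sub_one_dvd_derivative_of_pow_dvd ih

open Polynomial in
theorem iterate_X_mul_derivative_sum {ι : Type*} (s : Finset ι) (a : ℕ) (f : ι → ℂ[X]) :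
    (fun f : ℂ[X] => X * derivative f)^[a] (∑ i ∈ s, f i) =
      ∑ i ∈ s, (fun f : ℂ[X] => X * derivative f)^[a] (f i) := by
  induction a with
  | zero => simp
  | succ a ih =>
    simp only [Function.iterate_succ_apply', ih, derivative_sum, Finset.mul_sum]

open Polynomial in
/-- The Wronskian of the functions `Z ^ o b * P b (Z ^ r)` with respect to `Z d/dZ`, up to a power
of `Z` and in the variable `z = Z ^ r`. -/
noncomputable def eulerWronskian {n : ℕ} (r : ℕ) (o : Fin n → ℕ) (P : Fin n → ℂ[X]) : ℂ[X] :=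
  (Matrix.of fun a b : Fin n => (twistedEuler r (o b))^[a] (P b)).det

open Polynomial in
theorem X_sub_C_pow_dvd_of_comp_X_pow (r : ℕ) (hr : 0 < r) (c : ℂ) (hc : c ≠ 0) (M : ℕ) (V : ℂ[X])
    (h : (X - C c) ^ M ∣ V.comp (X ^ r)) : (X - C (c ^ r)) ^ M ∣ V := by
  by_cases hV : V = 0
  · simp [hV]
  by_contra hM
  obtain ⟨V₁, hV₁, hev⟩ := exists_eq_pow_rootMultiplicity_mul_and_not_dvd V hV (c ^ r)
  set e := rootMultiplicity (c ^ r) V with he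
  have heM : e < M := by
    by_contra hle
    exact hM ((pow_dvd_pow _ (not_lt.mp hle)).trans ⟨V₁, hV₁⟩)
  rw [dvd_iff_isRoot, IsRoot] at hev
  have hfac : (X : ℂ[X]) ^ r - C (c ^ r) =
      (X - C c) * ∑ i ∈ Finset.range r, X ^ i * C c ^ (r - 1 - i) := by
    rw [C_pow, mul_comm, (Commute.all _ _).geom_sum₂_mul]
  rw [hV₁, mul_comp, pow_comp, sub_comp, X_comp, C_comp, hfac, mul_pow, mul_assoc,
    ← Nat.sub_add_cancel heM.le, pow_add, mul_comm ((X - C c) ^ (M - e))] at h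
  have h2 := (mul_dvd_mul_iff_left (pow_ne_zero e (X_sub_C_ne_zero c))).mp h
  have h3 : (X - C c) ∣ (∑ i ∈ Finset.range r, X ^ i * C c ^ (r - 1 - i)) ^ e * V₁.comp (X ^ r) :=
    (dvd_pow_self _ (by omega)).trans h2
  rw [dvd_iff_isRoot, IsRoot, eval_mul, eval_pow, eval_comp, eval_pow, eval_X] at h3
  rcases mul_eq_zero.mp h3 with h4 | h4
  · have h6 := eq_zero_of_pow_eq_zero h4
    rw [eval_finsetSum] at h6
    have : ∀ i ∈ Finset.range r, eval c (X ^ i * C c ^ (r - 1 - i) : ℂ[X]) = c ^ (r - 1) := by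
      intro i hi
      rw [Finset.mem_range] at hi
      rw [eval_mul, eval_pow, eval_pow, eval_X, eval_C, ← pow_add]
      congr 1; omega
    rw [Finset.sum_congr rfl this, Finset.sum_const, Finset.card_range, nsmul_eq_mul] at h6
    rcases mul_eq_zero.mp h6 with h7 | h7
    · exact hr.ne' (by exact_mod_cast h7)
    · exact pow_ne_zero _ hc h7
  · exact hev h4

open Polynomial in
theorem X_sub_one_pow_dvd_eulerWronskian {n : ℕ} (hn : 0 < n) (r : ℕ) (hr : 0 < r) (o : Fin n → ℕ)
    (P : Fin n → ℂ[X]) (T : ℕ) (h : (X - C 1) ^ T ∣ ∑ b, X ^ o b * (P b).comp (X ^ r)) :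
    (X - C 1) ^ (T - (n - 1)) ∣ eulerWronskian r o P := by
  have key : (X - C 1) ^ (T - (n - 1)) ∣ (eulerWronskian r o P).comp (X ^ r) := by
    set N : Matrix (Fin n) (Fin n) ℂ[X] := Matrix.of fun a b : Fin n =>
      X ^ o b * ((twistedEuler r (o b))^[a] (P b)).comp (X ^ r) with hN
    have hdet : N.det = (∏ b, X ^ o b) * (eulerWronskian r o P).comp (X ^ r) := by
      rw [hN, eulerWronskian, Matrix.det_mul_row (fun b => (X : ℂ[X]) ^ o b)
        (fun a b => ((twistedEuler r (o b))^[a] (P b)).comp (X ^ r))]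
      congr 1
      have := RingHom.map_det (compRingHom ((X : ℂ[X]) ^ r))
        (Matrix.of fun a b : Fin n => (twistedEuler r (o b))^[a] (P b))
      rw [coe_compRingHom_apply] at this
      rw [this]
      rfl
    have hrow : ∀ a : Fin n, (X - C 1) ^ (T - (n - 1)) ∣ (N.mulVec 1) a := by
      intro a
      have : (N.mulVec 1) a = ∑ b, (fun f : ℂ[X] => X * derivative f)^[a]
          (X ^ o b * (P b).comp (X ^ r)) := by
        simp only [Matrix.mulVec, dotProduct, Pi.one_apply, mul_one, hN, Matrix.of_apply,
          iterate_X_mul_derivative]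
      rw [this, ← iterate_X_mul_derivative_sum]
      refine (pow_dvd_pow _ ?_).trans (X_sub_C_pow_dvd_iterate_X_mul_derivative 1 T a _ h)
      omega
    have hdvd : (X - C 1) ^ (T - (n - 1)) ∣ N.det := by
      have h1 : (N.adjugate.mulVec (N.mulVec 1)) ⟨0, hn⟩ = N.det := by
        rw [Matrix.mulVec_mulVec, Matrix.adjugate_mul, Matrix.smul_mulVec, Matrix.one_mulVec]
        simp
      rw [← h1, Matrix.mulVec, dotProduct]
      exact Finset.dvd_sum fun b _ => (hrow b).mul_left _
    rw [hdet, Finset.prod_pow_eq_pow_sum] at hdvd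
    refine IsCoprime.dvd_of_dvd_mul_left ?_ hdvd
    apply IsCoprime.pow
    have := isCoprime_X_sub_C_of_isUnit_sub (a := (1 : ℂ)) (b := 0) (by simp)
    simpa using this
  have := X_sub_C_pow_dvd_of_comp_X_pow r hr 1 one_ne_zero _ _ key
  simpa using this

open Polynomial in
theorem coeff_prod_sum_of_natDegree_le {ι : Type*} (s : Finset ι) (f : ι → ℂ[X]) (d : ι → ℕ)
    (h : ∀ i ∈ s, (f i).natDegree ≤ d i) :
    (∏ i ∈ s, f i).coeff (∑ i ∈ s, d i) = ∏ i ∈ s, (f i).coeff (d i) := by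
  classical
  induction s using Finset.induction_on with
  | empty => simp
  | insert i s hi ih =>
    rw [Finset.prod_insert hi, Finset.sum_insert hi, Finset.prod_insert hi,
      coeff_mul_add_eq_of_natDegree_le (h i (Finset.mem_insert_self _ _)),
      ih fun j hj => h j (Finset.mem_insert_of_mem hj)]
    exact (natDegree_prod_le _ _).trans
      (Finset.sum_le_sum fun j hj => h j (Finset.mem_insert_of_mem hj))

open Polynomial in
theorem eulerWronskian_ne_zero {n : ℕ} (r : ℕ) (o : Fin n → ℕ)
    (ho : Function.Injective o) (hor : ∀ b, o b < r) (P : Fin n → ℂ[X]) (hP : ∀ b, P b ≠ 0) :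
    eulerWronskian r o P ≠ 0 := by
  intro h0
  have hc : (eulerWronskian r o P).coeff (∑ b, (P b).natDegree) =
      (∏ b, (P b).leadingCoeff) *
        (Matrix.vandermonde fun b => ((r * (P b).natDegree + o b : ℕ) : ℂ)).det := by
    rw [eulerWronskian, Matrix.det_apply, finsetSum_coeff, ← Matrix.det_transpose,
      ← Matrix.det_mul_row, Matrix.det_apply]
    refine Finset.sum_congr rfl fun σ _ => ?_
    rw [coeff_smul, coeff_prod_sum_of_natDegree_le]
    · congr 1
      refine Finset.prod_congr rfl fun b _ => ?_
      simp only [Matrix.of_apply, coeff_iterate_twistedEuler, Matrix.transpose_apply,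
        Matrix.vandermonde_apply, leadingCoeff]
      ring
    · intro b _
      exact natDegree_iterate_twistedEuler_le _ _ _ _
  rw [h0, coeff_zero, eq_comm, mul_eq_zero] at hc
  rcases hc with hc | hc
  · obtain ⟨b, _, hb⟩ := Finset.prod_eq_zero_iff.mp hc
    exact hP b (leadingCoeff_eq_zero.mp hb)
  · refine Matrix.det_vandermonde_ne_zero_iff.mpr ?_ hc
    intro b c hbc
    have hbc' : r * (P b).natDegree + o b = r * (P c).natDegree + o c := by
      simpa only [Nat.cast_inj] using hbc
    have := congrArg (· % r) hbc'
    simp only [Nat.mul_add_mod, Nat.mod_eq_of_lt (hor _)] at this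
    exact ho this

open Polynomial in
theorem natDegree_eulerWronskian_le {n : ℕ} (r d : ℕ) (o : Fin n → ℕ) (P : Fin n → ℂ[X])
    (hd : ∀ b, (P b).natDegree ≤ d) : (eulerWronskian r o P).natDegree ≤ n * d := by
  rw [eulerWronskian, Matrix.det_apply]
  refine natDegree_sum_le_of_forall_le _ _ fun σ _ => ?_
  refine (natDegree_smul_le _ _).trans ((natDegree_prod_le _ _).trans ?_)
  refine (Finset.sum_le_card_nsmul _ _ d fun b _ => ?_).trans (by simp)
  exact (natDegree_iterate_twistedEuler_le _ _ _ _).trans (hd b)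

open Polynomial in
theorem eulerWronskian_scale {n : ℕ} (r : ℕ) (o : Fin n → ℕ) (P : Fin n → ℂ[X]) (A : ℂ)
    (w : Fin n → ℂ) :
    eulerWronskian r o (fun b => C (w b) * (P b).comp (C A * X)) =
      C (∏ b, w b) * (eulerWronskian r o P).comp (C A * X) := by
  have h1 : (eulerWronskian r o P).comp (C A * X) =
      (Matrix.of fun a b : Fin n => ((twistedEuler r (o b))^[a] (P b)).comp (C A * X)).det := by
    have := RingHom.map_det (compRingHom (C A * X))
      (Matrix.of fun a b : Fin n => (twistedEuler r (o b))^[a] (P b))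
    rw [coe_compRingHom_apply] at this
    rw [eulerWronskian, this]
    rfl
  rw [h1, map_prod, ← Matrix.det_mul_row, eulerWronskian]
  congr 1
  ext a b l
  simp only [Matrix.of_apply, coeff_iterate_twistedEuler, coeff_C_mul, comp_C_mul_X_coeff]
  ring

open Polynomial in
/-- Zero estimate for lacunary polynomials with prescribed vanishing at two points. -/
theorem vanishing_order_add_le {n : ℕ} (hn : 0 < n) (r d T K : ℕ) (hr : 0 < r) (o : Fin n → ℕ)
    (ho : Function.Injective o) (hor : ∀ b, o b < r) (P : Fin n → ℂ[X]) (hP : ∀ b, P b ≠ 0)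
    (hd : ∀ b, (P b).natDegree ≤ d) (A : ℂ) (hA0 : A ≠ 0) (hA1 : A ≠ 1) (w : Fin n → ℂ)
    (hw : ∀ b, w b ≠ 0)
    (h1 : (X - C 1) ^ T ∣ ∑ b, X ^ o b * (P b).comp (X ^ r))
    (h2 : (X - C 1) ^ K ∣ ∑ b, X ^ o b * (C (w b) * (P b).comp (C A * X)).comp (X ^ r)) :
    T + K ≤ n * d + 2 * (n - 1) := by
  set V := eulerWronskian r o P with hV
  have hV0 : V ≠ 0 := eulerWronskian_ne_zero r o ho hor P hP
  have d1 := X_sub_one_pow_dvd_eulerWronskian hn r hr o P T h1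
  have d2 := X_sub_one_pow_dvd_eulerWronskian hn r hr o _ K h2
  rw [eulerWronskian_scale] at d2
  have hw0 : (∏ b, w b) ≠ 0 := Finset.prod_ne_zero_iff.mpr fun b _ => hw b
  have hu : IsUnit (C (∏ b, w b) : ℂ[X]) := isUnit_C.mpr (isUnit_iff_ne_zero.mpr hw0)
  rw [hu.dvd_mul_left] at d2
  have d3 : (X - C A) ^ (K - (n - 1)) ∣ V := by
    have h3 := map_dvd (compRingHom (C A⁻¹ * X : ℂ[X])) d2
    simp only [coe_compRingHom_apply, comp_assoc] at h3
    have h4 : (C A * X : ℂ[X]).comp (C A⁻¹ * X) = X := by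
      rw [mul_comp, C_comp, X_comp, ← mul_assoc, ← C_mul, mul_inv_cancel₀ hA0, C_1, one_mul]
    have h5 : (X - C (1 : ℂ)).comp (C A⁻¹ * X) = C A⁻¹ * (X - C A) := by
      rw [sub_comp, X_comp, C_comp, mul_sub, ← C_mul, inv_mul_cancel₀ hA0]
    rw [h4, comp_X, pow_comp, h5, mul_pow] at h3
    exact (Dvd.intro_left _ rfl).trans h3
  have hcop : IsCoprime ((X - C (1 : ℂ)) ^ (T - (n - 1))) ((X - C A) ^ (K - (n - 1))) := by
    apply IsCoprime.pow
    exact isCoprime_X_sub_C_of_isUnit_sub (isUnit_iff_ne_zero.mpr (sub_ne_zero.mpr hA1.symm))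
  have hdvd := hcop.mul_dvd d1 d3
  have hdeg := natDegree_le_of_dvd hdvd hV0
  rw [natDegree_mul (pow_ne_zero _ (X_sub_C_ne_zero _)) (pow_ne_zero _ (X_sub_C_ne_zero _)),
    natDegree_pow, natDegree_pow, natDegree_X_sub_C, natDegree_X_sub_C] at hdeg
  have := hdeg.trans (natDegree_eulerWronskian_le r d o P hd)
  omega

open Polynomial in
theorem X_sub_one_pow_dvd_sum_of_choose {ι : Type*} (s : Finset ι) (c : ι → ℂ) (e : ι → ℕ) (T : ℕ)
    (h : ∀ n < T, ∑ p ∈ s, c p * (e p).choose n = 0) :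
    (X - C 1) ^ T ∣ ∑ p ∈ s, C (c p) * X ^ e p := by
  rw [X_sub_C_pow_dvd_iff, ← taylor_apply, X_pow_dvd_iff]
  intro n hn
  rw [taylor_coeff, map_sum, eval_finsetSum, ← h n hn]
  refine Finset.sum_congr rfl fun p _ => ?_
  rw [C_mul_X_pow_eq_monomial, hasseDeriv_monomial, eval_monomial, one_pow, mul_one, mul_comm]

open Polynomial in
/-- If the exponential sums with frequencies `r * l + j` vanish to order `T` at `1`, then twisting
by `A ^ l * η ^ j` cannot produce another zero of high order. -/
theorem exists_twisted_sum_ne_zero (L m r T K : ℕ) (hm : 0 < m) (hmr : m ≤ r)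
    (hTK : m * (L + 1) ≤ T + K) (c : Fin L × Fin m → ℂ) (hc : c ≠ 0) (A η : ℂ) (hA0 : A ≠ 0)
    (hA1 : A ≠ 1) (hη : η ≠ 0)
    (h : ∀ n < T, ∑ p, c p * (r * p.1 + p.2 : ℕ).choose n = 0) :
    ∃ n < K, ∑ p, c p * (r * p.1 + p.2 : ℕ).choose n * (A ^ (p.1 : ℕ) * η ^ (p.2 : ℕ)) ≠ 0 := by
  classical
  by_contra! hcon
  set J : Finset (Fin m) := Finset.univ.filter fun j => ∃ l, c (l, j) ≠ 0 with hJ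
  obtain ⟨⟨l₀, j₀⟩, hlj⟩ := Function.ne_iff.mp hc
  have hj₀ : j₀ ∈ J := by rw [hJ, Finset.mem_filter]; exact ⟨Finset.mem_univ _, l₀, hlj⟩
  have hn : 0 < J.card := Finset.card_pos.mpr ⟨j₀, hj₀⟩
  have hnm : J.card ≤ m := by simpa using J.card_le_univ
  have hL : 0 < L := l₀.pos
  let e := J.equivFin.symm
  let o : Fin J.card → ℕ := fun b => ((e b : Fin m) : ℕ)
  let P : Fin J.card → ℂ[X] := fun b => ∑ l : Fin L, C (c (l, e b)) * X ^ (l : ℕ)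
  have hcoeff : ∀ b (l : Fin L), (P b).coeff l = c (l, e b) := by
    intro b l
    simp only [P, finsetSum_coeff, coeff_C_mul, coeff_X_pow, mul_ite, mul_one, mul_zero]
    rw [Finset.sum_eq_single l]
    · simp
    · intro l' _ hl'
      rw [if_neg]
      exact fun h => hl' (Fin.ext h.symm)
    · simp
  have hP : ∀ b, P b ≠ 0 := by
    intro b hb
    obtain ⟨l, hl⟩ := (Finset.mem_filter.mp (e b).2).2
    apply hl
    rw [← hcoeff b l, hb, coeff_zero]
  have hd : ∀ b, (P b).natDegree ≤ L - 1 := by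
    intro b
    refine natDegree_sum_le_of_forall_le _ _ fun l _ => ?_
    refine (natDegree_C_mul_X_pow_le _ _).trans ?_
    have := l.2
    omega
  have hor : ∀ b, o b < r := fun b => (e b : Fin m).2.trans_le hmr
  have ho : Function.Injective o := fun a b hab =>
    e.injective (Subtype.ext (Fin.ext hab))
  have hsum : ∀ F : Fin L × Fin m → ℂ[X], (∀ l j, c (l, j) = 0 → F (l, j) = 0) →
      ∑ p, F p = ∑ b, ∑ l, F (l, (e b : Fin m)) := by
    intro F hF
    rw [Fintype.sum_prod_type_right, ← e.symm.sum_comp, ← Finset.sum_subset (Finset.subset_univ J)]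
    · rw [← Finset.sum_coe_sort]
      exact Finset.sum_congr rfl fun b _ => by simp
    · intro j _ hj
      refine Finset.sum_eq_zero fun l _ => hF l j ?_
      by_contra hlj
      exact hj (Finset.mem_filter.mpr ⟨Finset.mem_univ _, l, hlj⟩)
  have h1 : (X - C 1) ^ T ∣ ∑ b, X ^ o b * (P b).comp (X ^ r) := by
    have := X_sub_one_pow_dvd_sum_of_choose Finset.univ c (fun p => r * p.1 + p.2) T h
    rw [hsum _ fun l j hlj => by rw [hlj, C_0, zero_mul]] at this
    convert this using 2 with b _
    simp only [P, Polynomial.sum_comp, Polynomial.mul_comp, C_comp, X_pow_comp, Finset.mul_sum]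
    refine Finset.sum_congr rfl fun l _ => ?_
    simp only [o]
    ring
  have h2 : (X - C 1) ^ K ∣
      ∑ b, X ^ o b * (C (η ^ o b) * (P b).comp (C A * X)).comp (X ^ r) := by
    have := X_sub_one_pow_dvd_sum_of_choose Finset.univ
      (fun p : Fin L × Fin m => c p * (A ^ (p.1 : ℕ) * η ^ (p.2 : ℕ)))
      (fun p => r * p.1 + p.2) K fun n hn => by
        rw [← hcon n hn]
        exact Finset.sum_congr rfl fun p _ => by ring
    rw [hsum _ fun l j hlj => by rw [hlj, zero_mul, C_0, zero_mul]] at this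
    convert this using 2 with b _
    simp only [P, Polynomial.sum_comp, Polynomial.mul_comp, C_comp, X_comp, Finset.mul_sum, C_mul,
      C_pow, pow_comp]
    refine Finset.sum_congr rfl fun l _ => ?_
    simp only [o]
    ring
  have := vanishing_order_add_le hn r (L - 1) T K (hm.trans_le hmr) o ho hor P hP hd A hA0 hA1
    (fun b => η ^ o b) (fun b => pow_ne_zero _ hη) h1 h2
  obtain ⟨L', rfl⟩ : ∃ L', L = L' + 1 := ⟨L - 1, by omega⟩
  obtain ⟨n', hn'⟩ : ∃ n', J.card = n' + 1 := ⟨J.card - 1, by omega⟩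
  rw [hn'] at this hnm
  simp only [Nat.add_sub_cancel] at this
  have h3 : (n' + 1) * (L' + 1 + 1) ≤ m * (L' + 1 + 1) := Nat.mul_le_mul_right _ hnm
  nlinarith

theorem one_add_inv_pow_le (y Q N : ℕ) (hy : 27 ≤ y) (hN : N ≤ 3 * y * Q) :
    (1 + (y : ℝ)⁻¹) ^ N ≤ (y : ℝ) ^ Q := by
  have hy0 : (0 : ℝ) < y := by exact_mod_cast (by omega : 0 < y)
  have hyR : (27 : ℝ) ≤ y := by exact_mod_cast hy
  have h1 : 1 + (y : ℝ)⁻¹ ≤ Real.exp ((y : ℝ)⁻¹) := by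
    rw [add_comm]; exact Real.add_one_le_exp _
  have h2 : (1 + (y : ℝ)⁻¹) ^ (3 * y) ≤ y := by
    calc (1 + (y : ℝ)⁻¹) ^ (3 * y) ≤ (Real.exp ((y : ℝ)⁻¹)) ^ (3 * y) := by gcongr
      _ = Real.exp 1 ^ 3 := by
        rw [← Real.exp_nat_mul, ← Real.exp_nat_mul]
        congr 1
        push_cast
        field_simp
      _ ≤ 3 ^ 3 := by
        gcongr
        exact Real.exp_one_lt_three.le
      _ ≤ y := by linarith
  calc (1 + (y : ℝ)⁻¹) ^ N ≤ (1 + (y : ℝ)⁻¹) ^ (3 * y * Q) :=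
        pow_le_pow_right₀ (by simp) hN
    _ = ((1 + (y : ℝ)⁻¹) ^ (3 * y)) ^ Q := pow_mul _ _ _
    _ ≤ (y : ℝ) ^ Q := by gcongr

theorem choose_le_pow_three_mul (y Q e n : ℕ) (hy : 27 ≤ y) (he : e ≤ 3 * y * Q)
    (hn : n ≤ 2 * Q) : (e.choose n : ℝ) ≤ (y : ℝ) ^ (3 * Q) := by
  have hy0 : (0 : ℝ) < y := by exact_mod_cast (by omega : 0 < y)
  have hy1 : (1 : ℝ) ≤ y := by exact_mod_cast (by omega : 1 ≤ y)
  have h1 : ((y : ℝ)⁻¹) ^ n * (e.choose n : ℝ) ≤ (1 + (y : ℝ)⁻¹) ^ e := by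
    rw [add_comm, add_pow]
    rcases le_or_gt n e with hne | hne
    · have := Finset.single_le_sum (f := fun i => ((y : ℝ)⁻¹) ^ i * 1 ^ (e - i) * (e.choose i : ℝ))
        (fun i _ => by positivity) (Finset.mem_range.mpr (Nat.lt_succ_of_le hne))
      simpa using this
    · rw [Nat.choose_eq_zero_of_lt hne]
      simp only [Nat.cast_zero, mul_zero]
      positivity
  have h2 := h1.trans (one_add_inv_pow_le y Q e hy he)
  calc (e.choose n : ℝ) = (y : ℝ) ^ n * (((y : ℝ)⁻¹) ^ n * (e.choose n : ℝ)) := by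
        rw [← mul_assoc, ← mul_pow, mul_inv_cancel₀ hy0.ne', one_pow, one_mul]
    _ ≤ (y : ℝ) ^ (2 * Q) * (y : ℝ) ^ Q := by
        gcongr
    _ = (y : ℝ) ^ (3 * Q) := by rw [← pow_add]; congr 1; ring

theorem three_mul_le_pow (y Q : ℕ) (hy : 27 ≤ y) : (3 * Q : ℝ) ≤ (y : ℝ) ^ Q := by
  have h1 : 3 * Q ≤ y ^ Q := by
    have h2 : Q < 3 ^ Q := Nat.lt_pow_self (by norm_num)
    rcases Nat.eq_zero_or_pos Q with rfl | hQ
    · simp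
    · calc 3 * Q ≤ 3 ^ Q * 3 ^ Q := Nat.mul_le_mul (by
            calc 3 = 3 ^ 1 := rfl
              _ ≤ 3 ^ Q := Nat.pow_le_pow_right (by norm_num) hQ) h2.le
        _ = 9 ^ Q := by rw [← mul_pow]; norm_num
        _ ≤ y ^ Q := Nat.pow_le_pow_left (by omega) Q
  exact_mod_cast h1

theorem frequency_le {y m L : ℕ} (p : Fin (3 * L) × Fin m) (hy : 27 ≤ y) :
    y * m * p.1 + p.2 ≤ 3 * y * (m * L) := by
  have h1 : (p.1 : ℕ) + 1 ≤ 3 * L := p.1.2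
  have h2 : (p.2 : ℕ) ≤ m := p.2.2.le
  have h3 : y * m * (p.1 + 1) ≤ y * m * (3 * L) := Nat.mul_le_mul_left _ h1
  have h4 : m ≤ y * m := Nat.le_mul_of_pos_left _ (by omega)
  nlinarith

/-- Auxiliary coefficients from Siegel's lemma. -/
theorem exists_auxiliary_coefficients (y m L : ℕ) (hy : 27 ≤ y) (hm : 0 < m) (hL : 0 < L) :
    ∃ c : Fin (3 * L) × Fin m → ℤ, c ≠ 0 ∧
      (∀ n < 2 * (m * L), ∑ p, c p * (y * m * p.1 + p.2 : ℕ).choose n = 0) ∧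
      ∀ p, |(c p : ℝ)| ≤ (y : ℝ) ^ (8 * (m * L)) := by
  set Q := m * L with hQ
  have hQ0 : 0 < Q := Nat.mul_pos hm hL
  have hy1 : (1 : ℝ) ≤ y := by exact_mod_cast (by omega : 1 ≤ y)
  let {α β : Type} [Fintype α] [Fintype β] : SeminormedAddCommGroup (Matrix α β ℤ) :=
    Matrix.seminormedAddCommGroup
  let M : Matrix (Fin (2 * Q)) (Fin (3 * L) × Fin m) ℤ :=
    Matrix.of fun n p => ((y * m * p.1 + p.2 : ℕ).choose n : ℤ)
  have hcard : Fintype.card (Fin (3 * L) × Fin m) = 3 * Q := by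
    rw [Fintype.card_prod, Fintype.card_fin, Fintype.card_fin, hQ]; ring
  obtain ⟨c, hc0, hc, hcn⟩ := Int.Matrix.exists_ne_zero_int_vec_norm_le M
    (by rw [hcard, Fintype.card_fin]; omega) (by rw [Fintype.card_fin]; omega)
  refine ⟨c, hc0, ?_, ?_⟩
  · intro n hn
    have := congrFun hc ⟨n, hn⟩
    simp only [Matrix.mulVec, dotProduct, M, Matrix.of_apply, Pi.zero_apply] at this
    rw [← this]
    exact Finset.sum_congr rfl fun p _ => mul_comm _ _
  · intro p
    have h1 : |(c p : ℝ)| ≤ ‖c‖ := by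
      rw [← Int.norm_eq_abs]; exact norm_le_pi_norm c p
    have hM : ‖M‖ ≤ (y : ℝ) ^ (3 * Q) := by
      rw [Matrix.norm_le_iff (by positivity)]
      intro n p
      simp only [M, Matrix.of_apply, Int.norm_natCast]
      exact choose_le_pow_three_mul y Q _ _ hy (frequency_le p hy) n.2.le
    rw [hcard, Fintype.card_fin] at hcn
    have hexp : (((2 * Q : ℕ) : ℝ) / (((3 * Q : ℕ) : ℝ) - ((2 * Q : ℕ) : ℝ))) = (2 : ℕ) := by
      have : (0 : ℝ) < Q := by exact_mod_cast hQ0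
      push_cast
      rw [div_eq_iff (by linarith)]
      ring
    rw [hexp, Real.rpow_natCast] at hcn
    refine h1.trans (hcn.trans ?_)
    calc ((3 * Q : ℕ) * max 1 ‖M‖ : ℝ) ^ 2 ≤ ((y : ℝ) ^ Q * (y : ℝ) ^ (3 * Q)) ^ 2 := by
          gcongr
          · have := three_mul_le_pow y Q hy
            push_cast; exact this
          · exact max_le (one_le_pow₀ hy1) hM
      _ = (y : ℝ) ^ (8 * Q) := by rw [← pow_add, ← pow_mul]; congr 1; ring

theorem sum_choose_mul_pow_ge_le (y N T : ℕ) (hy : 0 < y) (z : ℝ) (hz : 0 ≤ z) (hyz : y * z ≤ 1) :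
    ∑ i ∈ (Finset.range (N + 1)).filter (T ≤ ·), (N.choose i : ℝ) * z ^ i ≤
      (y * z) ^ T * (1 + (y : ℝ)⁻¹) ^ N := by
  have hy0 : (0 : ℝ) < y := by exact_mod_cast hy
  rw [add_comm (1 : ℝ), add_pow, Finset.mul_sum]
  calc _ ≤ ∑ i ∈ (Finset.range (N + 1)).filter (T ≤ ·),
        (y * z) ^ T * (((y : ℝ)⁻¹) ^ i * 1 ^ (N - i) * (N.choose i : ℝ)) := by
        refine Finset.sum_le_sum fun i hi => ?_
        have hTi := (Finset.mem_filter.mp hi).2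
        have h1 : z ^ i = (y * z) ^ i * ((y : ℝ)⁻¹) ^ i := by
          rw [← mul_pow]; congr 1; field_simp
        have h2 : (y * z) ^ i ≤ (y * z) ^ T :=
          pow_le_pow_of_le_one (by positivity) hyz hTi
        rw [h1, one_pow, mul_one]
        calc (N.choose i : ℝ) * ((y * z) ^ i * ((y : ℝ)⁻¹) ^ i)
            ≤ (N.choose i : ℝ) * ((y * z) ^ T * ((y : ℝ)⁻¹) ^ i) := by gcongr
          _ = _ := by ring
    _ ≤ _ := Finset.sum_le_sum_of_subset_of_nonneg (Finset.filter_subset _ _)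
        fun i _ _ => by positivity

/-- A sum of powers whose hyperderivatives vanish to high order at `1` is small near `1`. -/
theorem norm_sum_choose_mul_pow_le {ι : Type*} (s : Finset ι) (c : ι → ℂ) (e : ι → ℕ)
    (y N T k : ℕ) (hy : 0 < y) (he : ∀ p ∈ s, e p ≤ N) (hk : k ≤ T) (C B : ℝ)
    (hC : ∀ p ∈ s, ‖c p‖ ≤ C) (hB : ∀ p ∈ s, ((e p).choose k : ℝ) ≤ B)
    (h : ∀ n < T, ∑ p ∈ s, c p * (e p).choose n = 0) (z : ℂ) (hz : y * ‖z‖ ≤ 1) :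
    ‖∑ p ∈ s, c p * (e p).choose k * (1 + z) ^ e p‖ ≤
      s.card * (C * B * ((1 + ‖z‖) ^ k * ((y * ‖z‖) ^ (T - k) * (1 + (y : ℝ)⁻¹) ^ N))) := by
  have hexp : ∀ p ∈ s, c p * (e p).choose k * (1 + z) ^ e p =
      (1 + z) ^ k * ∑ i ∈ Finset.range (N + 1),
        z ^ i * ((k + i).choose k * (c p * (e p).choose (k + i))) := by
    intro p hp
    rcases lt_or_ge (e p) k with hlt | hle
    · rw [Nat.choose_eq_zero_of_lt hlt]
      simp only [Nat.cast_zero, mul_zero, zero_mul]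
      rw [Finset.sum_eq_zero, mul_zero]
      intro i _
      rw [Nat.choose_eq_zero_of_lt (by omega : e p < k + i)]
      simp
    · obtain ⟨d, hd⟩ := Nat.exists_eq_add_of_le hle
      have h1 : (1 + z) ^ d = ∑ i ∈ Finset.range (N + 1), z ^ i * d.choose i := by
        rw [add_comm, add_pow]
        simp only [one_pow, mul_one]
        refine Finset.sum_subset ?_ ?_
        · intro i; have := he p hp; simp only [Finset.mem_range]; omega
        · intro i _ hi
          rw [Finset.mem_range, not_lt] at hi
          rw [Nat.choose_eq_zero_of_lt (by omega)]; simp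
      rw [hd, pow_add, h1]
      simp only [Finset.mul_sum]
      refine Finset.sum_congr rfl fun i _ => ?_
      have h2 : ((k + d).choose k : ℂ) * d.choose i = (k + d).choose (k + i) * (k + i).choose k := by
        rcases le_or_gt i d with hid | hid
        · have := Nat.choose_mul (n := k + d) (k := k + i) (s := k) (by omega)
          rw [Nat.add_sub_cancel_left, Nat.add_sub_cancel_left] at this
          exact_mod_cast this.symm
        · rw [Nat.choose_eq_zero_of_lt hid, Nat.choose_eq_zero_of_lt (by omega : k + d < k + i)]
          simp
      linear_combination ((1 + z) ^ k * c p * z ^ i) * h2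
  have hsum : ∑ p ∈ s, c p * (e p).choose k * (1 + z) ^ e p = ∑ p ∈ s, (1 + z) ^ k *
      ∑ i ∈ (Finset.range (N + 1)).filter (T - k ≤ ·),
        z ^ i * ((k + i).choose k * (c p * (e p).choose (k + i))) := by
    rw [Finset.sum_congr rfl hexp, ← Finset.mul_sum, ← Finset.mul_sum, Finset.sum_comm,
      Finset.sum_comm (s := s)]
    congr 1
    symm
    refine Finset.sum_subset (Finset.filter_subset _ _) ?_
    intro i hi hi'
    rw [← Finset.mul_sum, ← Finset.mul_sum, h, mul_zero, mul_zero]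
    by_contra hcon
    exact hi' (Finset.mem_filter.mpr ⟨hi, by omega⟩)
  rw [hsum, ← nsmul_eq_mul]
  refine (norm_sum_le _ _).trans (Finset.sum_le_card_nsmul _ _ _ fun p hp => ?_)
  have hC0 : 0 ≤ C := (norm_nonneg _).trans (hC p hp)
  have hB0 : 0 ≤ B := (Nat.cast_nonneg _).trans (hB p hp)
  rw [norm_mul, norm_pow]
  have h1 : ‖1 + z‖ ≤ 1 + ‖z‖ := (norm_add_le _ _).trans (by simp)
  have h3 : ‖∑ i ∈ (Finset.range (N + 1)).filter (T - k ≤ ·),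
        z ^ i * ((k + i).choose k * (c p * (e p).choose (k + i)))‖ ≤
      C * B * ∑ i ∈ (Finset.range (N + 1)).filter (T - k ≤ ·), (N.choose i : ℝ) * ‖z‖ ^ i := by
    rw [Finset.mul_sum]
    refine (norm_sum_le _ _).trans (Finset.sum_le_sum fun i _ => ?_)
    have h4 : ((k + i).choose k : ℝ) * (e p).choose (k + i) ≤ B * N.choose i := by
      rcases lt_or_ge (e p) (k + i) with hlt | hle
      · rw [Nat.choose_eq_zero_of_lt hlt, Nat.cast_zero, mul_zero]; positivity
      · have h5 := Nat.choose_mul (n := e p) (k := k + i) (s := k) (by omega)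
        rw [Nat.add_sub_cancel_left] at h5
        have h6 : ((k + i).choose k : ℝ) * (e p).choose (k + i) =
            (e p).choose k * (e p - k).choose i := by
          rw [mul_comm]; exact_mod_cast h5
        rw [h6]
        gcongr
        · exact hB p hp
        · exact (Nat.sub_le _ _).trans (he p hp)
    simp only [norm_mul, norm_pow, Complex.norm_natCast]
    calc ‖z‖ ^ i * (((k + i).choose k : ℝ) * (‖c p‖ * (e p).choose (k + i)))
        = ‖z‖ ^ i * (‖c p‖ * (((k + i).choose k : ℝ) * (e p).choose (k + i))) := by ring
      _ ≤ ‖z‖ ^ i * (C * (B * N.choose i)) := by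
        gcongr
        exact hC p hp
      _ = _ := by ring
  calc ‖1 + z‖ ^ k * _ ≤ (1 + ‖z‖) ^ k * (C * B * ((y * ‖z‖) ^ (T - k) * (1 + (y : ℝ)⁻¹) ^ N)) := by
        gcongr
        refine h3.trans ?_
        gcongr
        exact sum_choose_mul_pow_ge_le y N (T - k) hy _ (norm_nonneg _) hz
    _ = _ := by ring

theorem NumberField.one_le_norm_mul_pow_of_isIntegral {F : Type*} [Field F] [NumberField F]
    {d : ℕ} (hF : Module.finrank ℚ F ≤ d + 1) (φ : F →+* ℂ) {z : F} (hz : z ≠ 0)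
    (hInt : IsIntegral ℤ z) {B : ℝ} (hB : 1 ≤ B) (h : ∀ ψ : F →+* ℂ, ‖ψ z‖ ≤ B) :
    1 ≤ ‖φ z‖ * B ^ d := by
  classical
  have h1 : ∏ ψ : F →+* ℂ, ‖ψ z‖ = |((Algebra.norm ℚ z : ℚ) : ℝ)| := by
    have := Algebra.norm_eq_prod_embeddings ℚ ℂ z
    have h2 := congrArg norm this
    rw [norm_prod, ← Fintype.prod_equiv (RingHom.equivRatAlgHom (R := F) (S := ℂ))
      (fun ψ => ‖ψ z‖) _ (fun _ => rfl)] at h2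
    rw [← h2]
    simp
  have h2 : 1 ≤ |((Algebra.norm ℚ z : ℚ) : ℝ)| := by
    obtain ⟨n, hn⟩ := IsIntegrallyClosed.isIntegral_iff.mp (Algebra.isIntegral_norm ℚ hInt)
    have hne : Algebra.norm ℚ z ≠ 0 := Algebra.norm_ne_zero_iff.mpr hz
    rw [← hn] at hne ⊢
    simp only [algebraMap_int_eq, eq_intCast, ne_eq, Int.cast_eq_zero, Rat.cast_intCast] at hne ⊢
    exact_mod_cast Int.one_le_abs hne
  rw [← h1, ← Finset.mul_prod_erase _ _ (Finset.mem_univ φ)] at h2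
  refine h2.trans (mul_le_mul_of_nonneg_left ?_ (norm_nonneg _))
  calc _ ≤ ∏ ψ ∈ Finset.univ.erase φ, B := Finset.prod_le_prod (fun _ _ => norm_nonneg _)
        fun ψ _ => h ψ
    _ = B ^ (Finset.univ.erase φ).card := Finset.prod_const _
    _ ≤ B ^ d := by
      refine pow_le_pow_right₀ hB ?_
      rw [Finset.card_erase_of_mem (Finset.mem_univ _), Finset.card_univ,
        NumberField.Embeddings.card]
      omega

theorem false_of_close_powers {F : Type*} [Field F] [NumberField F]
    (hF : Module.finrank ℚ F ≤ 6) (φ : F →+* ℂ) (y m L D : ℕ) (hy : 27 ≤ y) (hm : 0 < m)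
    (hL : 2 ≤ L) (hD : 0 < D) (A η : F) (hA0 : A ≠ 0) (hA1 : A ≠ 1) (hη0 : η ≠ 0)
    (hA : IsIntegral ℤ (D * A)) (hη : IsIntegral ℤ η) (hDy : (D : ℝ) ^ 3 ≤ (y : ℝ) ^ m)
    (hAy : ∀ ψ : F →+* ℂ, ‖ψ A‖ ^ 3 ≤ (y : ℝ) ^ m) (hηy : ∀ ψ : F →+* ℂ, ‖ψ η‖ ≤ (y : ℝ) ^ L)
    (hη1 : ‖φ η - 1‖ * (y : ℝ) ^ 200 ≤ 1)
    (hAη : ∀ l < 3 * L, ‖φ A ^ l - φ η ^ (y * m * l)‖ * (y : ℝ) ^ (91 * (m * L)) ≤ 1) : False := by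
  obtain ⟨c, hc0, hcv, hcb⟩ := exists_auxiliary_coefficients y m L hy hm (by omega)
  set Q := m * L with hQ
  have hQ0 : 0 < Q := Nat.mul_pos hm (by omega)
  have hyR : (27 : ℝ) ≤ y := by exact_mod_cast hy
  have hy0 : (0 : ℝ) < y := by linarith
  have hy1 : (1 : ℝ) ≤ y := by linarith
  have hcv' : ∀ n < 2 * Q, ∑ p, (c p : ℂ) * (y * m * p.1 + p.2 : ℕ).choose n = 0 := by
    intro n hn
    exact_mod_cast congrArg (Int.cast (R := ℂ)) (hcv n hn)
  obtain ⟨k, hk, hG⟩ := exists_twisted_sum_ne_zero (3 * L) m (y * m) (2 * Q) (m * (L + 1)) hm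
    (Nat.le_mul_of_pos_left _ (by omega)) (by rw [hQ]; apply le_of_eq; ring)
    (fun p => (c p : ℂ)) (fun h => hc0 (funext fun p => by
      have := congrFun h p; simpa using this)) (φ A) (φ η)
    (by simpa using hA0) (fun h => hA1 (φ.injective (by simpa using h))) (by simpa using hη0) hcv'
  have hkT : k ≤ 2 * Q := by rw [hQ]; nlinarith
  have hkT' : Q ≤ 2 * (2 * Q - k) := by
    have : 2 * (m * (L + 1)) ≤ 3 * Q := by rw [hQ]; nlinarith
    omega
  set X : ℝ := (y : ℝ) ^ Q with hX
  have hX27 : 27 ≤ X := hyR.trans (le_self_pow₀ hy1 hQ0.ne')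
  have hX1 : 1 ≤ X := by linarith
  have hX0 : 0 < X := by linarith
  have hXp : ∀ n, (y : ℝ) ^ (n * Q) = X ^ n := fun n => by rw [hX, ← pow_mul, mul_comm]
  have hc : ∀ p, |(c p : ℝ)| ≤ X ^ 8 := fun p => by rw [← hXp]; exact hcb p
  have hch : ∀ p : Fin (3 * L) × Fin m, ((y * m * p.1 + p.2 : ℕ).choose k : ℝ) ≤ X ^ 3 :=
    fun p => by
      rw [← hXp]; exact choose_le_pow_three_mul y Q _ k hy (frequency_le p hy) hkT
  have hcard : ((Finset.univ : Finset (Fin (3 * L) × Fin m)).card : ℝ) ≤ X := by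
    have : ((Finset.univ : Finset (Fin (3 * L) × Fin m)).card : ℝ) = 3 * Q := by
      rw [Finset.card_univ, Fintype.card_prod, Fintype.card_fin, Fintype.card_fin, hQ]
      push_cast; ring
    rw [this]; exact three_mul_le_pow y Q hy
  have hpow : ∀ (a : ℝ), 0 ≤ a → a ^ 3 ≤ (y : ℝ) ^ m → ∀ l ≤ 3 * L, a ^ l ≤ X := by
    intro a ha h l hl
    calc a ^ l ≤ (max 1 a) ^ l := by gcongr; exact le_max_right _ _
      _ ≤ (max 1 a) ^ (3 * L) := pow_le_pow_right₀ (le_max_left _ _) hl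
      _ = ((max 1 a) ^ 3) ^ L := pow_mul _ _ _
      _ ≤ ((y : ℝ) ^ m) ^ L := by
        gcongr
        rcases max_choice 1 a with h' | h' <;> rw [h']
        · rw [one_pow]; exact one_le_pow₀ hy1
        · exact h
      _ = X := by rw [← pow_mul]
  have hDX : (D : ℝ) ^ (3 * L) ≤ X := hpow D (by positivity) hDy _ le_rfl
  have hηX : ∀ ψ : F →+* ℂ, ∀ p : Fin (3 * L) × Fin m, ‖ψ η‖ ^ (p.2 : ℕ) ≤ X := by
    intro ψ p
    calc ‖ψ η‖ ^ (p.2 : ℕ) ≤ ((y : ℝ) ^ L) ^ (p.2 : ℕ) := by gcongr; exact hηy ψ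
      _ ≤ ((y : ℝ) ^ L) ^ m := pow_le_pow_right₀ (one_le_pow₀ hy1) p.2.2.le
      _ = X := by rw [← pow_mul, hX, hQ, mul_comm]
  -- the algebraic integer
  let z : F := ∑ p : Fin (3 * L) × Fin m, (c p : F) * ((y * m * p.1 + p.2 : ℕ).choose k : ℕ) *
    ((D : F) ^ (3 * L - (p.1 : ℕ)) * (D * A) ^ (p.1 : ℕ) * η ^ (p.2 : ℕ))
  have hzint : IsIntegral ℤ z := by
    refine IsIntegral.sum _ fun p _ => ?_
    have hDint : IsIntegral ℤ (D : F) := by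
      simpa using (isIntegral_algebraMap (R := ℤ) (A := F) (x := (D : ℤ)))
    have h1 : IsIntegral ℤ (c p : F) := by
      simpa using (isIntegral_algebraMap (R := ℤ) (A := F) (x := c p))
    have h2 : IsIntegral ℤ (((y * m * p.1 + p.2 : ℕ).choose k : ℕ) : F) := by
      simpa using (isIntegral_algebraMap (R := ℤ) (A := F)
        (x := ((y * m * p.1 + p.2 : ℕ).choose k : ℤ)))
    exact (h1.mul h2).mul (((hDint.pow _).mul (hA.pow _)).mul (hη.pow _))
  have hψz : ∀ ψ : F →+* ℂ, ψ z = (D : ℂ) ^ (3 * L) * ∑ p : Fin (3 * L) × Fin m,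
      (c p : ℂ) * (y * m * p.1 + p.2 : ℕ).choose k * (ψ A ^ (p.1 : ℕ) * ψ η ^ (p.2 : ℕ)) := by
    intro ψ
    rw [map_sum, Finset.mul_sum]
    refine Finset.sum_congr rfl fun p _ => ?_
    have : (D : ℂ) ^ (3 * L) = (D : ℂ) ^ (3 * L - (p.1 : ℕ)) * (D : ℂ) ^ (p.1 : ℕ) := by
      rw [← pow_add]; congr 1; have := p.1.2; omega
    rw [this]
    simp only [map_mul, map_pow, map_intCast, map_natCast]
    ring
  have hz0 : z ≠ 0 := by
    intro h
    have := hψz φ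
    rw [h, map_zero] at this
    exact (mul_ne_zero (pow_ne_zero _ (by exact_mod_cast hD.ne')) hG) this.symm
  have hbound : ∀ ψ : F →+* ℂ, ‖ψ z‖ ≤ X ^ 15 := by
    intro ψ
    rw [hψz, norm_mul, norm_pow, Complex.norm_natCast]
    calc _ ≤ X * (X * (X ^ 8 * X ^ 3 * (X * X))) := by
          refine mul_le_mul hDX ?_ (norm_nonneg _) hX0.le
          refine (norm_sum_le_of_le (f := _) (n := fun _ => X ^ 8 * X ^ 3 * (X * X)) _
            fun p _ => ?_).trans ?_
          · rw [norm_mul, norm_mul, norm_mul, norm_pow, norm_pow, Complex.norm_natCast,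
              Complex.norm_intCast]
            gcongr
            · exact hc p
            · exact hch p
            · exact hpow _ (norm_nonneg _) (hAy ψ) _ p.1.2.le
            · exact hηX ψ p
          · rw [Finset.sum_const, nsmul_eq_mul]
            gcongr
      _ = X ^ 15 := by ring_nf
  have hlow := NumberField.one_le_norm_mul_pow_of_isIntegral (d := 5) hF φ hz0 hzint
    (one_le_pow₀ hX1) hbound
  set G := ∑ p : Fin (3 * L) × Fin m, (c p : ℂ) * (y * m * p.1 + p.2 : ℕ).choose k *
    (φ A ^ (p.1 : ℕ) * φ η ^ (p.2 : ℕ)) with hGdef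
  have hlow' : 1 ≤ ‖G‖ * X ^ 76 := by
    refine hlow.trans ?_
    rw [hψz, norm_mul, norm_pow, Complex.norm_natCast]
    calc _ ≤ X * ‖G‖ * (X ^ 15) ^ 5 := by gcongr
      _ = ‖G‖ * X ^ 76 := by ring
  -- the two small parts
  let S₁ := ∑ p : Fin (3 * L) × Fin m, (c p : ℂ) * (y * m * p.1 + p.2 : ℕ).choose k *
    (1 + (φ η - 1)) ^ (y * m * p.1 + p.2 : ℕ)
  let S₂ := ∑ p : Fin (3 * L) × Fin m, (c p : ℂ) * (y * m * p.1 + p.2 : ℕ).choose k *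
    (φ η ^ (p.2 : ℕ) * (φ A ^ (p.1 : ℕ) - φ η ^ (y * m * p.1)))
  have hsplit : G = S₁ + S₂ := by
    simp only [G, S₁, S₂]
    rw [← Finset.sum_add_distrib]
    refine Finset.sum_congr rfl fun p _ => ?_
    rw [add_sub_cancel, pow_add]
    ring
  set ε := ‖φ η - 1‖ with hε
  have hε0 : 0 ≤ ε := norm_nonneg _
  have hyε : y * ε * (y : ℝ) ^ 199 ≤ 1 := by
    refine le_trans (le_of_eq ?_) hη1
    ring
  have hε1 : y * ε ≤ 1 := by
    have : (1 : ℝ) ≤ (y : ℝ) ^ 199 := one_le_pow₀ hy1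
    have h2 : 0 ≤ y * ε := by positivity
    nlinarith
  have hw : (y * ε) ^ (2 * Q - k) * X ^ 99 ≤ 1 := by
    calc (y * ε) ^ (2 * Q - k) * X ^ 99 ≤ (y * ε) ^ (2 * Q - k) * ((y : ℝ) ^ 199) ^ (2 * Q - k) := by
          gcongr
          rw [← hXp, ← pow_mul]
          exact pow_le_pow_right₀ hy1 (by omega)
      _ = (y * ε * (y : ℝ) ^ 199) ^ (2 * Q - k) := (mul_pow _ _ _).symm
      _ ≤ 1 := pow_le_one₀ (by positivity) hyε
  have h1 := norm_sum_choose_mul_pow_le Finset.univ (fun p => (c p : ℂ))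
    (fun p : Fin (3 * L) × Fin m => y * m * p.1 + p.2) y (3 * y * Q) (2 * Q) k (by omega)
    (fun p _ => frequency_le p hy) hkT (X ^ 8) (X ^ 3)
    (fun p _ => by rw [Complex.norm_intCast]; exact hc p) (fun p _ => hch p) hcv' (φ η - 1) hε1
  have hS₁ : ‖S₁‖ * X ^ 85 ≤ 1 := by
    refine le_trans (mul_le_mul_of_nonneg_right h1 (by positivity)) ?_
    have h2 : (1 + ε) ^ k ≤ X := by
      refine le_trans (pow_le_pow_left₀ (by positivity) (?_ : 1 + ε ≤ 1 + (y : ℝ)⁻¹) k)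
        (one_add_inv_pow_le y Q k hy (by nlinarith))
      rw [add_le_add_iff_left, ← one_div, le_div_iff₀ hy0, mul_comm]
      exact hε1
    have h3 : (1 + (y : ℝ)⁻¹) ^ (3 * y * Q) ≤ X := one_add_inv_pow_le y Q _ hy le_rfl
    calc _ ≤ X * (X ^ 8 * X ^ 3 * (X * ((y * ε) ^ (2 * Q - k) * X))) * X ^ 85 := by gcongr
      _ = (y * ε) ^ (2 * Q - k) * X ^ 99 := by ring
      _ ≤ 1 := hw
  have hS₂ : ‖S₂‖ * X ^ 78 ≤ 1 := by
    have h2 : ‖S₂‖ ≤ X * (X ^ 8 * X ^ 3 * (X * (X ^ 91)⁻¹)) := by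
      refine (norm_sum_le_of_le (f := _) (n := fun _ => X ^ 8 * X ^ 3 * (X * (X ^ 91)⁻¹)) _
            fun p _ => ?_).trans ?_
      · rw [norm_mul, norm_mul, norm_mul, norm_pow, Complex.norm_natCast,
              Complex.norm_intCast]
        gcongr
        · exact hc p
        · exact hch p
        · exact hηX φ p
        · rw [← one_div, le_div_iff₀ (by positivity), ← hXp]
          exact hAη _ p.1.2
      · rw [Finset.sum_const, nsmul_eq_mul]
        gcongr
    calc ‖S₂‖ * X ^ 78 ≤ X * (X ^ 8 * X ^ 3 * (X * (X ^ 91)⁻¹)) * X ^ 78 := by gcongr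
      _ = 1 := by field_simp
  have h2 : ‖S₁‖ * X ^ 78 ≤ 1 := le_trans (by gcongr; norm_num) hS₁
  have h3 : ‖G‖ ≤ ‖S₁‖ + ‖S₂‖ := by rw [hsplit]; exact norm_add_le _ _
  have h4 : X ^ 2 ≤ ‖G‖ * X ^ 78 := by
    calc X ^ 2 = 1 * X ^ 2 := by ring
      _ ≤ ‖G‖ * X ^ 76 * X ^ 2 := by gcongr
      _ = ‖G‖ * X ^ 78 := by ring
  have h5 : ‖G‖ * X ^ 78 ≤ (‖S₁‖ + ‖S₂‖) * X ^ 78 := by gcongr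
  nlinarith

open MeasureTheory in
/-- Minkowski's theorem on linear forms. -/
theorem Matrix.exists_int_vec_ne_zero_abs_mulVec_le {n : ℕ} (B : Matrix (Fin n) (Fin n) ℝ)
    (hB : B.det ≠ 0) (b : Fin n → ℝ) (hb : ∀ i, 0 < b i) (h : |B.det| < ∏ i, b i) :
    ∃ v : Fin n → ℤ, v ≠ 0 ∧ ∀ i, |(B.mulVec fun j => (v j : ℝ)) i| ≤ b i := by
  have hdet : LinearMap.det (Matrix.toLin' B) ≠ 0 := by rwa [LinearMap.det_toLin']
  have : Countable (Submodule.span ℤ (Set.range (Pi.basisFun ℝ (Fin n)))).toAddSubgroup :=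
    inferInstanceAs (Countable (Submodule.span ℤ (Set.range (Pi.basisFun ℝ (Fin n)))))
  obtain ⟨x, hx0, hx⟩ := exists_ne_zero_mem_lattice_of_measure_mul_two_pow_lt_measure
    (μ := (volume : Measure (Fin n → ℝ)))
    (s := Matrix.toLin' B ⁻¹' Set.Icc (-b) b)
    (ZSpan.isAddFundamentalDomain' (Pi.basisFun ℝ (Fin n)) volume) (by
      intro x hx
      simp only [Set.mem_preimage, Set.mem_Icc, map_neg] at hx ⊢
      exact ⟨neg_le_neg hx.2, neg_le.mp hx.1⟩) ((convex_Icc _ _).linear_preimage _) (by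
      rw [Measure.addHaar_preimage_linearMap _ hdet, Real.volume_Icc_pi,
        ZSpan.volume_fundamentalDomain, LinearMap.det_toLin', Module.finrank_fin_fun,
        ← ENNReal.ofReal_prod_of_nonneg fun i _ => by
          have := hb i; simp only [Pi.neg_apply]; linarith,
        ← ENNReal.ofReal_mul (abs_nonneg _)]
      have h1 : ENNReal.ofReal |(Matrix.of (Pi.basisFun ℝ (Fin n))).det| * 2 ^ n =
          ENNReal.ofReal (2 ^ n) := by
        have : Matrix.of (⇑(Pi.basisFun ℝ (Fin n))) = 1 := by
          ext i j; simp [Matrix.one_apply, Pi.single_apply, eq_comm]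
        rw [this]
        simp [ENNReal.ofReal_pow]
      rw [h1, ENNReal.ofReal_lt_ofReal_iff_of_nonneg (by positivity)]
      have h2 : ∏ i, (b i - (-b) i) = 2 ^ n * ∏ i, b i := by
        rw [← Fin.prod_const n (2 : ℝ), ← Finset.prod_mul_distrib]
        exact Finset.prod_congr rfl fun i _ => by simp only [Pi.neg_apply]; ring
      have h3 : 0 < |B.det| := abs_pos.mpr hB
      rw [h2, abs_inv, inv_mul_eq_div, lt_div_iff₀ h3]
      gcongr)
  have hmem : ∀ i, ∃ z : ℤ, (z : ℝ) = (x : Fin n → ℝ) i := fun i => by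
    have := ((Pi.basisFun ℝ (Fin n)).mem_span_iff_repr_mem ℤ _).mp x.2 i
    simpa using this
  choose v hv using hmem
  have hvx : (fun j => (v j : ℝ)) = x := funext hv
  refine ⟨v, ?_, fun i => ?_⟩
  · rintro rfl
    refine hx0 (Subtype.ext ?_)
    rw [← hvx]
    ext j
    simp
  · rw [hvx, ← Matrix.toLin'_apply, abs_le]
    exact ⟨hx.1 i, hx.2 i⟩

/-- The value `v 0 + v 1 * t + v 2 * t ^ 2` of a quadratic polynomial with integer coefficients. -/
def quadEval {R : Type*} [CommRing R] (v : Fin 3 → ℤ) (t : R) : R :=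
  v 0 + v 1 * t + v 2 * t ^ 2

/-- The norm of `v 0 + v 1 * t + v 2 * t ^ 2` for `t` a root of `T ^ 3 + a * T + b`. -/
def quadNorm (a b : ℤ) (v : Fin 3 → ℤ) : ℤ :=
  v 0 ^ 3 - v 1 ^ 3 * b + v 2 ^ 3 * b ^ 2 + v 0 * v 1 ^ 2 * a - 2 * v 0 ^ 2 * v 2 * a
    + v 0 * v 2 ^ 2 * a ^ 2 - v 1 * v 2 ^ 2 * a * b + 3 * v 0 * v 1 * v 2 * b

open Polynomial in
/-- The product of the other two conjugates of `v 0 + v 1 * t + v 2 * t ^ 2`, for `t` a root of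
`T ^ 3 + a * T + b`. -/
noncomputable def quadCofactor (a b : ℤ) (v : Fin 3 → ℤ) : ℤ[X] :=
  C (v 0 ^ 2) - C (v 0 * v 1) * X - C (v 0 * v 2) * (C (2 * a) + X ^ 2)
    + C (v 1 ^ 2) * (X ^ 2 + C a) + C (v 1 * v 2 * b) + C (v 2 ^ 2) * (X ^ 2 + C a) ^ 2

theorem quadNorm_eq {R : Type*} [CommRing R] {a b : ℤ} {t₁ t₂ t₃ : R} (h₁ : t₁ + t₂ + t₃ = 0)
    (h₂ : t₁ * t₂ + t₁ * t₃ + t₂ * t₃ = a) (h₃ : t₁ * t₂ * t₃ = -b) (v : Fin 3 → ℤ) :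
    (quadNorm a b v : R) = quadEval v t₁ * quadEval v t₂ * quadEval v t₃ := by
  obtain rfl : t₃ = -t₁ - t₂ := by linear_combination h₁
  obtain h₃ : (b : R) = -(t₁ * t₂ * (-t₁ - t₂)) := by rw [h₃]; ring
  simp only [quadNorm, quadEval]
  push_cast
  rw [← h₂, h₃]
  ring

theorem aeval_quadCofactor {R : Type*} [CommRing R] {a b : ℤ} {t₁ t₂ t₃ : R}
    (h₁ : t₁ + t₂ + t₃ = 0)
    (h₂ : t₁ * t₂ + t₁ * t₃ + t₂ * t₃ = a) (h₃ : t₁ * t₂ * t₃ = -b) (v : Fin 3 → ℤ) :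
    Polynomial.aeval t₁ (quadCofactor a b v) = quadEval v t₂ * quadEval v t₃ := by
  obtain rfl : t₃ = -t₁ - t₂ := by linear_combination h₁
  obtain h₃ : (b : R) = -(t₁ * t₂ * (-t₁ - t₂)) := by rw [h₃]; ring
  simp only [quadCofactor, quadEval, map_add, map_sub, map_mul, map_pow,
    Polynomial.aeval_X, eq_intCast, map_intCast]
  push_cast
  rw [← h₂, h₃]
  ring

theorem exists_quadEval_le (w p r M : ℝ) (q : ℂ) (hq : q ^ 2 = r)
    (hdet0 : ‖q‖ * ((w - p) ^ 2 - r) ≠ 0) (hdet : |‖q‖ * ((w - p) ^ 2 - r)| < M) (s : ℕ) :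
    ∃ v : Fin 3 → ℤ, v ≠ 0 ∧ ‖quadEval v (w : ℂ)‖ ≤ M * Real.exp s ^ 2 ∧
      ‖quadEval v (p + q)‖ * Real.exp s ≤ 2 ∧ ‖quadEval v (p - q)‖ * Real.exp s ≤ 2 := by
  have hM : 0 < M := (abs_nonneg _).trans_lt hdet
  have hE := Real.exp_pos s
  set E := Real.exp s
  let B : Matrix (Fin 3) (Fin 3) ℝ :=
    !![1, w, w ^ 2; 1, p, p ^ 2 + r; 0, ‖q‖, 2 * p * ‖q‖]
  have hB : B.det = ‖q‖ * ((w - p) ^ 2 - r) := by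
    simp only [B, Matrix.det_fin_three, Matrix.of_apply, Matrix.cons_val', Matrix.cons_val_zero,
      Matrix.cons_val_one, Matrix.cons_val]
    ring
  obtain ⟨v, hv0, hv⟩ := B.exists_int_vec_ne_zero_abs_mulVec_le (by rwa [hB])
    ![M * E ^ 2, E⁻¹, E⁻¹] (by
      intro i; fin_cases i <;> simp <;> positivity) (by
      rw [hB, Fin.prod_univ_three]
      simp only [Matrix.cons_val_zero, Matrix.cons_val_one, Matrix.cons_val]
      refine hdet.trans_le (le_of_eq ?_)
      field_simp)
  have h0 : |v 0 + v 1 * w + v 2 * w ^ 2| ≤ M * E ^ 2 := by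
    have := hv 0
    simp only [B, Matrix.mulVec, dotProduct, Fin.sum_univ_three, Matrix.of_apply, Matrix.cons_val',
      Matrix.cons_val_zero, Matrix.cons_val_one, Matrix.cons_val] at this
    convert this using 2; ring
  have h1 : |v 0 + v 1 * p + v 2 * (p ^ 2 + r)| ≤ E⁻¹ := by
    have := hv 1
    simp only [B, Matrix.mulVec, dotProduct, Fin.sum_univ_three, Matrix.of_apply, Matrix.cons_val',
      Matrix.cons_val_zero, Matrix.cons_val_one, Matrix.cons_val] at this
    convert this using 2; ring
  have h2 : ‖q‖ * |v 1 + 2 * p * v 2| ≤ E⁻¹ := by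
    have := hv 2
    simp only [B, Matrix.mulVec, dotProduct, Fin.sum_univ_three, Matrix.of_apply, Matrix.cons_val',
      Matrix.cons_val_zero, Matrix.cons_val_one, Matrix.cons_val] at this
    rw [← abs_of_nonneg (norm_nonneg q), ← abs_mul]
    refine le_trans (le_of_eq ?_) this
    congr 1
    ring
  have key : ∀ q' : ℂ, q' ^ 2 = r → ‖q'‖ = ‖q‖ → ‖quadEval v (p + q')‖ * E ≤ 2 := by
    intro q' hq' hn
    have h3 : quadEval v ((p : ℂ) + q') = ((v 0 + v 1 * p + v 2 * (p ^ 2 + r) : ℝ) : ℂ) +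
        q' * ((v 1 + 2 * p * v 2 : ℝ) : ℂ) := by
      simp only [quadEval]
      push_cast
      rw [← hq']
      ring
    have h4 : ‖quadEval v ((p : ℂ) + q')‖ ≤ E⁻¹ + E⁻¹ := by
      rw [h3]
      refine (norm_add_le _ _).trans (add_le_add ?_ ?_)
      · rw [Complex.norm_real]; exact h1
      · rw [norm_mul, Complex.norm_real, hn]; exact h2
    calc _ ≤ (E⁻¹ + E⁻¹) * E := by gcongr
      _ = 2 := by field_simp; norm_num
  refine ⟨v, hv0, ?_, key q hq rfl, ?_⟩
  · have : quadEval v (w : ℂ) = ((v 0 + v 1 * w + v 2 * w ^ 2 : ℝ) : ℂ) := by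
      simp only [quadEval]; push_cast; ring
    rw [this, Complex.norm_real]; exact h0
  · rw [sub_eq_add_neg]; exact key (-q) (by rw [neg_sq, hq]) (norm_neg q)

theorem norm_sub_mul_le_two_of_floor_eq {W : ℕ} {z z' : ℂ} (hre : ⌊W * z.re⌋ = ⌊W * z'.re⌋)
    (him : ⌊W * z.im⌋ = ⌊W * z'.im⌋) : ‖z - z'‖ * W ≤ 2 := by
  have h1 := (Int.abs_sub_lt_one_of_floor_eq_floor hre).le
  have h2 := (Int.abs_sub_lt_one_of_floor_eq_floor him).le
  rw [← mul_sub, abs_mul, Nat.abs_cast] at h1 h2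
  have h3 := Complex.norm_le_abs_re_add_abs_im (z - z')
  rw [Complex.sub_re, Complex.sub_im] at h3
  have hW : (0 : ℝ) ≤ W := Nat.cast_nonneg W
  nlinarith [mul_le_mul_of_nonneg_right h3 hW]

theorem floor_mem_Icc_of_norm_le_two {W K : ℕ} (hK : 2 * W ≤ K) {z : ℂ} (hz : ‖z‖ ≤ 2) :
    ⌊W * z.re⌋ ∈ Finset.Icc (-(K : ℤ)) K ∧ ⌊W * z.im⌋ ∈ Finset.Icc (-(K : ℤ)) K := by
  have key : ∀ u : ℝ, |u| ≤ ‖z‖ → ⌊W * u⌋ ∈ Finset.Icc (-(K : ℤ)) K := by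
    intro u hu
    have hu2 := abs_le.mp (hu.trans hz)
    have hW : (0 : ℝ) ≤ W := Nat.cast_nonneg W
    have hK' : (2 * W : ℝ) ≤ K := by exact_mod_cast hK
    rw [Finset.mem_Icc, Int.le_floor]
    constructor
    · push_cast; nlinarith
    · have h1 : (⌊W * u⌋ : ℝ) ≤ K := (Int.floor_le _).trans (by nlinarith)
      exact_mod_cast h1
  exact ⟨key _ (Complex.abs_re_le_norm z), key _ (Complex.abs_im_le_norm z)⟩

/-- A unit of `ℤ[T] / (T ^ 3 + a * T + b)` whose two small conjugates are nearly equal. -/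
theorem exists_unit_polynomial (a b : ℤ) (w p r : ℝ) (q : ℂ) (hq : q ^ 2 = r) (κ W : ℕ)
    (hκ : 0 < κ) (hW : 0 < W) (hdet0 : ‖q‖ * ((w - p) ^ 2 - r) ≠ 0)
    (hdet : |‖q‖ * ((w - p) ^ 2 - r)| < 6 * κ)
    (h₁ : (w : ℂ) + (p + q) + (p - q) = 0)
    (h₂ : (w : ℂ) * (p + q) + w * (p - q) + (p + q) * (p - q) = a)
    (h₃ : (w : ℂ) * (p + q) * (p - q) = -b)
    (hlin : ∀ v : Fin 3 → ℤ, v ≠ 0 → quadEval v (w : ℂ) ≠ 0 ∧ quadEval v (p + q) ≠ 0 ∧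
      quadEval v (p - q) ≠ 0) :
    ∃ t : ℕ, 0 < t ∧ t ≤ (49 * κ * W) ^ 8 ∧ ∃ V : Polynomial ℤ,
      Polynomial.aeval (w : ℂ) V * Polynomial.aeval (p + q) V * Polynomial.aeval (p - q) V = 1 ∧
      ‖Polynomial.aeval (p + q) V - Real.exp t‖ * W ≤ 24 * κ * Real.exp t ∧
      ‖Polynomial.aeval (p - q) V - Real.exp t‖ * W ≤ 24 * κ * Real.exp t := by
  choose v hv0 hv1 hv2 hv3 using exists_quadEval_le w p r (6 * κ) q hq hdet0 hdet
  have hW' : (0 : ℝ) < W := by exact_mod_cast hW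
  have hκ' : (0 : ℝ) < κ := by exact_mod_cast hκ
  let n : ℕ → ℤ := fun s => quadNorm a b (v s)
  have hn : ∀ s, (n s : ℂ) = quadEval (v s) (w : ℂ) * quadEval (v s) (p + q) *
      quadEval (v s) (p - q) := fun s => quadNorm_eq h₁ h₂ h₃ (v s)
  have hn0 : ∀ s, n s ≠ 0 := by
    intro s h
    have h' := hn s
    rw [h, Int.cast_zero] at h'
    obtain ⟨g1, g2, g3⟩ := hlin (v s) (hv0 s)
    exact mul_ne_zero (mul_ne_zero g1 g2) g3 h'.symm
  let z₂ : ℕ → ℂ := fun s => quadEval (v s) (p + q) * Real.exp s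
  let z₃ : ℕ → ℂ := fun s => quadEval (v s) (p - q) * Real.exp s
  have hz₂ : ∀ s, ‖z₂ s‖ ≤ 2 := fun s => by
    rw [norm_mul, Complex.norm_real, Real.norm_of_nonneg (Real.exp_pos _).le]; exact hv2 s
  have hz₃ : ∀ s, ‖z₃ s‖ ≤ 2 := fun s => by
    rw [norm_mul, Complex.norm_real, Real.norm_of_nonneg (Real.exp_pos _).le]; exact hv3 s
  have hnz : ∀ s, |(n s : ℝ)| ≤ 6 * κ * ‖z₂ s‖ * ‖z₃ s‖ := by
    intro s
    have hE := Real.exp_pos s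
    have : |(n s : ℝ)| = ‖(n s : ℂ)‖ := (Complex.norm_intCast _).symm
    rw [this, hn, norm_mul, norm_mul, norm_mul, norm_mul, Complex.norm_real,
      Real.norm_of_nonneg hE.le]
    calc _ ≤ 6 * κ * Real.exp s ^ 2 * ‖quadEval (v s) (p + q)‖ * ‖quadEval (v s) (p - q)‖ := by
          gcongr; exact hv1 s
      _ = _ := by ring
  have hn1 : ∀ s, (1 : ℝ) ≤ |(n s : ℝ)| := fun s => by exact_mod_cast Int.one_le_abs (hn0 s)
  have hnK : ∀ s, |n s| ≤ 24 * κ := by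
    intro s
    have : |(n s : ℝ)| ≤ 24 * κ := by
      calc _ ≤ 6 * κ * ‖z₂ s‖ * ‖z₃ s‖ := hnz s
        _ ≤ 6 * κ * 2 * 2 := by gcongr; exacts [hz₂ s, hz₃ s]
        _ = 24 * κ := by ring
    exact_mod_cast this
  have hz₂' : ∀ s, 1 ≤ 12 * κ * ‖z₂ s‖ := fun s => by
    calc (1 : ℝ) ≤ 6 * κ * ‖z₂ s‖ * ‖z₃ s‖ := (hn1 s).trans (hnz s)
      _ ≤ 6 * κ * ‖z₂ s‖ * 2 := by gcongr; exact hz₃ s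
      _ = _ := by ring
  have hz₃' : ∀ s, 1 ≤ 12 * κ * ‖z₃ s‖ := fun s => by
    calc (1 : ℝ) ≤ 6 * κ * ‖z₂ s‖ * ‖z₃ s‖ := (hn1 s).trans (hnz s)
      _ ≤ 6 * κ * 2 * ‖z₃ s‖ := by gcongr; exact hz₂ s
      _ = _ := by ring
  let key : ℕ → Fin 8 → ℤ := fun s => ![n s, v s 0 % n s, v s 1 % n s, v s 2 % n s,
    ⌊W * (z₂ s).re⌋, ⌊W * (z₂ s).im⌋, ⌊W * (z₃ s).re⌋, ⌊W * (z₃ s).im⌋]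
  set K := 24 * κ * W with hK
  have hK1 : 2 * W ≤ K := by rw [hK]; nlinarith
  have hK2 : ((24 * κ : ℕ) : ℤ) ≤ K := by exact_mod_cast (by rw [hK]; nlinarith)
  have hkey : ∀ s, key s ∈ Fintype.piFinset fun _ : Fin 8 => Finset.Icc (-(K : ℤ)) K := by
    intro s
    rw [Fintype.mem_piFinset]
    have hnK' : |n s| ≤ K := (hnK s).trans (by exact_mod_cast hK2)
    have hmod : ∀ u : ℤ, u % n s ∈ Finset.Icc (-(K : ℤ)) K := fun u => by
      have g1 := Int.emod_nonneg u (hn0 s)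
      have g2 := Int.emod_lt_abs u (hn0 s)
      rw [Finset.mem_Icc]; omega
    obtain ⟨g1, g2⟩ := floor_mem_Icc_of_norm_le_two hK1 (hz₂ s)
    obtain ⟨g3, g4⟩ := floor_mem_Icc_of_norm_le_two hK1 (hz₃ s)
    intro i
    fin_cases i
    · exact Finset.mem_Icc.mpr (abs_le.mp hnK')
    · exact hmod _
    · exact hmod _
    · exact hmod _
    · exact g1
    · exact g2
    · exact g3
    · exact g4
  have main : ∀ s s' : ℕ, s < s' → s' ≤ (49 * κ * W) ^ 8 → key s = key s' →
      ∃ t : ℕ, 0 < t ∧ t ≤ (49 * κ * W) ^ 8 ∧ ∃ V : Polynomial ℤ,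
      Polynomial.aeval (w : ℂ) V * Polynomial.aeval (p + q) V * Polynomial.aeval (p - q) V = 1 ∧
      ‖Polynomial.aeval (p + q) V - Real.exp t‖ * W ≤ 24 * κ * Real.exp t ∧
      ‖Polynomial.aeval (p - q) V - Real.exp t‖ * W ≤ 24 * κ * Real.exp t := by
    intro s s' hs hs' hkk
    have k0 : n s = n s' := congrFun hkk 0
    have kd : ∀ i : Fin 3, n s' ∣ v s i - v s' i := by
      have k1 : v s 0 % n s = v s' 0 % n s' := congrFun hkk 1
      have k2 : v s 1 % n s = v s' 1 % n s' := congrFun hkk 2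
      have k3 : v s 2 % n s = v s' 2 % n s' := congrFun hkk 3
      rw [k0] at k1 k2 k3
      intro i
      fin_cases i
      · exact Int.ModEq.dvd k1.symm
      · exact Int.ModEq.dvd k2.symm
      · exact Int.ModEq.dvd k3.symm
    choose u hu using kd
    let V : Polynomial ℤ := 1 + (Polynomial.C (u 0) + Polynomial.C (u 1) * Polynomial.X +
      Polynomial.C (u 2) * Polynomial.X ^ 2) * quadCofactor a b (v s')
    obtain ⟨g1, g2, g3⟩ := hlin (v s') (hv0 s')
    have hV : ∀ t₁ t₂ t₃ : ℂ, t₁ + t₂ + t₃ = 0 → t₁ * t₂ + t₁ * t₃ + t₂ * t₃ = a →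
        t₁ * t₂ * t₃ = -b → Polynomial.aeval t₁ V * quadEval (v s') t₁ = quadEval (v s) t₁ := by
      intro t₁ t₂ t₃ e1 e2 e3
      have e4 := aeval_quadCofactor e1 e2 e3 (v s')
      have e5 := quadNorm_eq e1 e2 e3 (v s')
      have e6 : ∀ i : Fin 3, (v s i : ℂ) = v s' i + n s' * u i := fun i => by
        have := hu i
        rw [sub_eq_iff_eq_add'] at this
        rw [this]; push_cast; ring
      have e7 : (n s' : ℂ) = quadEval (v s') t₁ * quadEval (v s') t₂ * quadEval (v s') t₃ := e5
      have e8 : quadEval (v s) t₁ = quadEval (v s') t₁ + n s' * quadEval u t₁ := by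
        simp only [quadEval, e6]; ring
      rw [e8, e7]
      simp only [V, map_add, map_mul, e4, map_one, map_pow, Polynomial.aeval_C, Polynomial.aeval_X,
        quadEval]
      simp only [algebraMap_int_eq, eq_intCast]
      ring
    have hV1 := hV w (p + q) (p - q) h₁ h₂ h₃
    have hV2 := hV (p + q) w (p - q) (by rw [← h₁]; ring) (by rw [← h₂]; ring) (by rw [← h₃]; ring)
    have hV3 := hV (p - q) w (p + q) (by rw [← h₁]; ring) (by rw [← h₂]; ring) (by rw [← h₃]; ring)
    obtain ⟨t, rfl⟩ := Nat.exists_eq_add_of_lt hs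
    have hexp : Real.exp ((s + t + 1 : ℕ) : ℝ) = Real.exp s * Real.exp ((t + 1 : ℕ) : ℝ) := by
      rw [← Real.exp_add]; push_cast; ring_nf
    have close : ∀ (θ : ℂ) (z : ℕ → ℂ), (∀ s, z s = quadEval (v s) θ * Real.exp s) →
        Polynomial.aeval θ V * quadEval (v (s + t + 1)) θ = quadEval (v s) θ →
        1 ≤ 12 * κ * ‖z (s + t + 1)‖ → ‖z s - z (s + t + 1)‖ * W ≤ 2 →
        ‖Polynomial.aeval θ V - Real.exp (t + 1 : ℕ)‖ * W ≤ 24 * κ * Real.exp (t + 1 : ℕ) := by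
      intro θ z hz hVθ hz1 hz2
      have f1 : (Polynomial.aeval θ V - Real.exp (t + 1 : ℕ)) * z (s + t + 1) =
          (z s - z (s + t + 1)) * Real.exp (t + 1 : ℕ) := by
        rw [hz, hz, ← hVθ, hexp]; push_cast; ring
      have f2 := congrArg norm f1
      rw [norm_mul, norm_mul, Complex.norm_real, Real.norm_of_nonneg (Real.exp_pos _).le] at f2
      have hE := Real.exp_pos ((t + 1 : ℕ) : ℝ)
      calc _ = ‖Polynomial.aeval θ V - Real.exp (t + 1 : ℕ)‖ * W * 1 := by ring
        _ ≤ ‖Polynomial.aeval θ V - Real.exp (t + 1 : ℕ)‖ * W * (12 * κ * ‖z (s + t + 1)‖) := by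
          gcongr
        _ = 12 * κ * ((‖Polynomial.aeval θ V - Real.exp (t + 1 : ℕ)‖ * ‖z (s + t + 1)‖) * W) := by
          ring
        _ = 12 * κ * (‖z s - z (s + t + 1)‖ * W) * Real.exp (t + 1 : ℕ) := by rw [f2]; ring
        _ ≤ 12 * κ * 2 * Real.exp (t + 1 : ℕ) := by gcongr
        _ = _ := by ring
    refine ⟨t + 1, by omega, by omega, V, ?_, ?_, ?_⟩
    · have e1 := hn s
      rw [k0, hn (s + t + 1), ← hV1, ← hV2, ← hV3] at e1
      refine mul_right_cancel₀ (mul_ne_zero (mul_ne_zero g1 g2) g3) ?_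
      linear_combination -e1
    · exact close _ z₂ (fun _ => rfl) hV2 (hz₂' _)
        (norm_sub_mul_le_two_of_floor_eq (congrFun hkk 4) (congrFun hkk 5))
    · exact close _ z₃ (fun _ => rfl) hV3 (hz₃' _)
        (norm_sub_mul_le_two_of_floor_eq (congrFun hkk 6) (congrFun hkk 7))
  obtain ⟨s, hs, s', hs', hne, hkk⟩ := Finset.exists_ne_map_eq_of_card_lt_of_maps_to
    (s := Finset.range ((49 * κ * W) ^ 8 + 1)) (f := key)
    (t := Fintype.piFinset fun _ : Fin 8 => Finset.Icc (-(K : ℤ)) K) (by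
      rw [Fintype.card_piFinset_const, Finset.card_range, Int.card_Icc, Nat.lt_succ_iff]
      refine Nat.pow_le_pow_left ?_ 8
      have : 0 < κ * W := Nat.mul_pos hκ hW
      rw [hK, mul_assoc, mul_assoc]
      omega) (fun s _ => hkey s)
  rw [Finset.mem_range] at hs hs'
  rcases lt_or_gt_of_ne hne with hlt | hlt
  · exact main s s' hlt (by omega) hkk
  · exact main s' s hlt (by omega) hkk.symm

section DepressedCubic

open Polynomial

/-- The polynomial `X ^ 3 + a * X + b`. -/
noncomputable def depressedCubic (a b : ℤ) : ℤ[X] := X ^ 3 + C a * X + C b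

theorem depressedCubic_eq (a b : ℤ) : depressedCubic a b = X ^ (2 + 1) + (C a * X + C b) := by
  rw [depressedCubic, add_assoc]

theorem degree_linear_lt (a b : ℤ) : (C a * X + C b : ℤ[X]).degree < ((2 + 1 : ℕ) : WithBot ℕ) :=
  degree_linear_le.trans_lt (by exact_mod_cast (by norm_num : 1 < 3))

theorem depressedCubic_monic (a b : ℤ) : (depressedCubic a b).Monic := by
  rw [depressedCubic_eq]
  exact monic_X_pow_add (degree_linear_lt a b)

theorem natDegree_depressedCubic (a b : ℤ) : (depressedCubic a b).natDegree = 3 := by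
  rw [depressedCubic]
  compute_degree!

theorem aeval_depressedCubic {R : Type*} [CommRing R] (a b : ℤ) (t : R) :
    aeval t (depressedCubic a b) = t ^ 3 + a * t + b := by
  simp [depressedCubic]

theorem isIntegral_of_depressedCubic {R : Type*} [CommRing R] {a b : ℤ} {t : R}
    (ht : t ^ 3 + a * t + b = 0) : IsIntegral ℤ t :=
  ⟨depressedCubic a b, depressedCubic_monic a b, by
    rw [← aeval_def, aeval_depressedCubic, ht]⟩

theorem irreducible_map_depressedCubic {a b : ℤ} (h : ∀ n : ℤ, n ^ 3 + a * n + b ≠ 0) :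
    Irreducible ((depressedCubic a b).map (algebraMap ℤ ℚ)) := by
  rw [← (depressedCubic_monic a b).irreducible_iff_irreducible_map_fraction_map,
    (depressedCubic_monic a b).irreducible_iff_roots_eq_zero_of_degree_le_three
      (by rw [natDegree_depressedCubic]; norm_num) (by rw [natDegree_depressedCubic])]
  refine Multiset.eq_zero_of_forall_notMem fun n hn => h n ?_
  have := (mem_roots'.mp hn).2
  rw [IsRoot.def, ← coe_aeval_eq_eval, aeval_depressedCubic] at this
  simpa using this

theorem quadEval_ne_zero_of_irreducible {a b : ℤ}
    (hirr : Irreducible ((depressedCubic a b).map (algebraMap ℤ ℚ))) {t : ℂ}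
    (ht : t ^ 3 + a * t + b = 0) {v : Fin 3 → ℤ} (hv : v ≠ 0) : quadEval v t ≠ 0 := by
  intro h
  have hmin := minpoly.eq_of_irreducible_of_monic hirr (x := t) (by
    rw [aeval_map_algebraMap, aeval_depressedCubic, ht]) ((depressedCubic_monic a b).map _)
  let g : ℤ[X] := C (v 2) * X ^ 2 + C (v 1) * X + C (v 0)
  have hg : aeval t (g.map (algebraMap ℤ ℚ)) = 0 := by
    rw [aeval_map_algebraMap, ← h, quadEval]
    simp [g]
    ring
  have hdvd := minpoly.dvd ℚ t hg
  rw [← hmin] at hdvd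
  have hg0 : g.map (algebraMap ℤ ℚ) = 0 := by
    refine eq_zero_of_dvd_of_natDegree_lt hdvd ?_
    rw [(depressedCubic_monic a b).natDegree_map, natDegree_depressedCubic]
    refine (natDegree_map_le).trans_lt ?_
    exact natDegree_quadratic_le.trans_lt (by norm_num)
  rw [Polynomial.map_eq_zero_iff (algebraMap ℤ ℚ).injective_int] at hg0
  apply hv
  funext i
  fin_cases i
  · simpa [g] using congrArg (coeff · 0) hg0
  · simpa [g, coeff_X, coeff_C, -eq_intCast] using congrArg (coeff · 1) hg0
  · simpa [g, coeff_X, coeff_C, -eq_intCast] using congrArg (coeff · 2) hg0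

theorem exists_quadEval_eq_aeval (a b : ℤ) (g : ℤ[X]) :
    ∃ v : Fin 3 → ℤ, ∀ t : ℂ, t ^ 3 + a * t + b = 0 → aeval t g = quadEval v t := by
  have hdeg : (g %ₘ depressedCubic a b).natDegree < 3 := by
    have := natDegree_modByMonic_lt g (depressedCubic_monic a b) (by
      intro h
      have := natDegree_depressedCubic a b
      rw [h] at this
      simp at this)
    rwa [natDegree_depressedCubic] at this
  refine ⟨fun i => (g %ₘ depressedCubic a b).coeff i, fun t ht => ?_⟩
  rw [← aeval_modByMonic_eq_self_of_root (q := depressedCubic a b)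
    (by rw [aeval_depressedCubic, ht]), aeval_eq_sum_range' hdeg]
  simp [Finset.sum_range_succ, quadEval]

theorem aeval_eq_zero_of_add_eq_zero {a b : ℤ}
    (hirr : Irreducible ((depressedCubic a b).map (algebraMap ℤ ℚ))) {t₁ t₂ t₃ : ℂ}
    (h₁ : t₁ + t₂ + t₃ = 0) (h₂ : t₁ * t₂ + t₁ * t₃ + t₂ * t₃ = a) (h₃ : t₁ * t₂ * t₃ = -b)
    (g : ℤ[X]) (h : aeval t₂ g + aeval t₃ g = 0) : aeval t₁ g = 0 := by
  have hroot : ∀ t, (t - t₁) * (t - t₂) * (t - t₃) = 0 → t ^ 3 + a * t + b = 0 := by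
    intro t ht
    linear_combination ht + t ^ 2 * h₁ - t * h₂ + h₃
  obtain ⟨v, hv⟩ := exists_quadEval_eq_aeval a b g
  have e1 := hv t₁ (hroot _ (by ring))
  rw [hv t₂ (hroot _ (by ring)), hv t₃ (hroot _ (by ring))] at h
  let v' : Fin 3 → ℤ := ![2 * v 0 - 2 * a * v 2, - v 1, -v 2]
  have hv' : quadEval v' t₁ = 0 := by
    have : quadEval v' t₁ = quadEval v t₂ + quadEval v t₃ := by
      simp only [quadEval, v', Matrix.cons_val_zero, Matrix.cons_val_one, Matrix.cons_val]
      push_cast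
      linear_combination (-(v 1 : ℂ) - v 2 * (t₁ + t₂ + t₃)) * h₁ + 2 * v 2 * h₂
    rw [this, h]
  have h0 : v' = 0 := by
    by_contra hne
    exact quadEval_ne_zero_of_irreducible hirr (hroot t₁ (by ring)) hne hv'
  have c0 := congrFun h0 0
  have c1 := congrFun h0 1
  have c2 := congrFun h0 2
  simp only [v', Matrix.cons_val_zero, Matrix.cons_val_one, Matrix.cons_val, Pi.zero_apply] at c0 c1 c2
  have d2 : v 2 = 0 := by omega
  have d1 : v 1 = 0 := by omega
  have d0 : v 0 = 0 := by rw [d2] at c0; omega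
  rw [e1, quadEval, d0, d1, d2]
  simp

theorem finrank_splittingField_le_factorial {f : ℚ[X]} (hf : Irreducible f) :
    Module.finrank ℚ f.SplittingField ≤ f.natDegree.factorial := by
  classical
  rw [← Gal.card_of_separable hf.separable]
  have : Fact ((f.map (algebraMap ℚ ℂ)).Splits) := ⟨IsAlgClosed.splits _⟩
  refine (Nat.card_le_card_of_injective _ (Gal.galActionHom_injective f ℂ)).trans ?_
  rw [Nat.card_perm, Nat.card_eq_fintype_card, card_rootSet_eq_natDegree hf.separable
    (IsAlgClosed.splits _)]

theorem exists_numberField_of_depressedCubic {a b : ℤ}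
    (hirr : Irreducible ((depressedCubic a b).map (algebraMap ℤ ℚ))) {t₁ t₂ t₃ : ℂ}
    (h₁ : t₁ + t₂ + t₃ = 0) (h₂ : t₁ * t₂ + t₁ * t₃ + t₂ * t₃ = a) (h₃ : t₁ * t₂ * t₃ = -b) :
    ∃ (F : Type) (_ : Field F) (_ : NumberField F), Module.finrank ℚ F ≤ 6 ∧
      ∃ (φ : F →+* ℂ) (α : Fin 3 → F), (∀ i, φ (α i) = ![t₁, t₂, t₃] i) ∧
        (∀ i, IsIntegral ℤ (α i)) ∧ ∀ (ψ : F →+* ℂ) (i : Fin 3), ∃ j, ψ (α i) = ![t₁, t₂, t₃] j := by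
  set f : ℚ[X] := (depressedCubic a b).map (algebraMap ℤ ℚ) with hf
  have hdeg : f.natDegree = 3 := by
    rw [hf, (depressedCubic_monic a b).natDegree_map, natDegree_depressedCubic]
  have hroot : ∀ t : ℂ, t ^ 3 + a * t + b = (t - t₁) * (t - t₂) * (t - t₃) := by
    intro t
    linear_combination t ^ 2 * h₁ - t * h₂ + h₃
  have : NumberField f.SplittingField :=
    { to_charZero := inferInstance
      to_finiteDimensional := inferInstance }
  refine ⟨f.SplittingField, inferInstance, inferInstance, ?_, ?_⟩
  · refine (finrank_splittingField_le_factorial hirr).trans ?_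
    rw [hdeg]
    decide
  let φ : f.SplittingField →ₐ[ℚ] ℂ := SplittingField.lift f (IsAlgClosed.splits _)
  have himg := (SplittingField.splits f).image_rootSet φ
  have hex : ∀ i : Fin 3, ∃ x ∈ f.rootSet f.SplittingField, φ x = ![t₁, t₂, t₃] i := by
    intro i
    have hmem : ![t₁, t₂, t₃] i ∈ f.rootSet ℂ := by
      rw [mem_rootSet]
      refine ⟨hirr.ne_zero, ?_⟩
      rw [hf, aeval_map_algebraMap, aeval_depressedCubic, hroot]
      fin_cases i <;> simp
    rw [← himg] at hmem
    exact hmem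
  choose α hα hφα using hex
  have hα0 : ∀ i, α i ^ 3 + a * α i + b = 0 := by
    intro i
    refine (φ : f.SplittingField →+* ℂ).injective ?_
    have hφi : (φ : f.SplittingField →+* ℂ) (α i) = ![t₁, t₂, t₃] i := hφα i
    rw [map_add, map_add, map_mul, map_pow, map_intCast, map_intCast, map_zero, hφi, hroot]
    fin_cases i <;> simp
  refine ⟨φ, α, hφα, fun i => isIntegral_of_depressedCubic (hα0 i), ?_⟩
  intro ψ i
  have h0 := congrArg ψ (hα0 i)
  rw [map_add, map_add, map_mul, map_pow, map_intCast, map_intCast, map_zero,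
    hroot, mul_eq_zero, mul_eq_zero, sub_eq_zero, sub_eq_zero, sub_eq_zero] at h0
  rcases h0 with (h0 | h0) | h0
  exacts [⟨0, h0⟩, ⟨1, h0⟩, ⟨2, h0⟩]

end DepressedCubic

section UnitContradiction

open Polynomial

theorem map_aeval_int {R S : Type*} [CommRing R] [CommRing S] (φ : R →+* S) (t : R) (g : ℤ[X]) :
    φ (aeval t g) = aeval (φ t) g :=
  (aeval_algHom_apply φ.toIntAlgHom t g).symm

theorem isIntegral_aeval_int {R : Type*} [CommRing R] {t : R} (ht : IsIntegral ℤ t) (g : ℤ[X]) :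
    IsIntegral ℤ (aeval t g) := by
  have : ∀ a ∈ Algebra.adjoin ℤ {t}, IsIntegral ℤ a := fun a ha =>
    IsIntegral.of_mem_of_fg _ ht.fg_adjoin_singleton a ha
  exact this _ (aeval_mem_adjoin_singleton ℤ t)

theorem derivative_prod_eq {R : Type*} [CommRing R] {a b : ℤ} {t₁ t₂ t₃ : R}
    (h₁ : t₁ + t₂ + t₃ = 0) (h₂ : t₁ * t₂ + t₁ * t₃ + t₂ * t₃ = a) (h₃ : t₁ * t₂ * t₃ = -b) :
    (3 * t₁ ^ 2 + a) * (3 * t₂ ^ 2 + a) * (3 * t₃ ^ 2 + a) = ((4 * a ^ 3 + 27 * b ^ 2 : ℤ) : R) := by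
  obtain rfl : t₃ = -t₁ - t₂ := by linear_combination h₁
  obtain h₃ : (b : R) = -(t₁ * t₂ * (-t₁ - t₂)) := by rw [h₃]; ring
  push_cast
  rw [← h₂, h₃]
  ring

theorem false_of_unit_polynomial {a b : ℤ}
    (hirr : Irreducible ((depressedCubic a b).map (algebraMap ℤ ℚ))) {t₁ t₂ t₃ : ℂ}
    (h₁ : t₁ + t₂ + t₃ = 0) (h₂ : t₁ * t₂ + t₁ * t₃ + t₂ * t₃ = a) (h₃ : t₁ * t₂ * t₃ = -b)
    (V : ℤ[X]) (hV : aeval t₁ V * aeval t₂ V * aeval t₃ V = 1) (ρ : ℂ → ℂ) (y m L D : ℕ)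
    (hρ : ∀ t, ρ t = (3 * t ^ 2 + a) * aeval t V ^ (y * m))
    (hDab : (D : ℤ) = 4 * a ^ 3 + 27 * b ^ 2 ∨ (D : ℤ) = -(4 * a ^ 3 + 27 * b ^ 2))
    (hy : 27 ≤ y) (hm : 0 < m) (hL : 2 ≤ L) (hD : 0 < D) (hDy : (D : ℝ) ^ 3 ≤ (y : ℝ) ^ m)
    (hρy : ∀ i j, ‖ρ (![t₁, t₂, t₃] i)‖ ^ 3 ≤ (y : ℝ) ^ m * ‖ρ (![t₁, t₂, t₃] j)‖ ^ 3)
    (hVy : ∀ i j, ‖aeval (![t₁, t₂, t₃] i) V‖ ≤ (y : ℝ) ^ L * ‖aeval (![t₁, t₂, t₃] j) V‖)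
    (hV1 : ‖aeval t₂ V - aeval t₃ V‖ * (y : ℝ) ^ 200 ≤ ‖aeval t₃ V‖)
    (hAη : ∀ l < 3 * L, ‖(-(ρ t₂ / ρ t₃)) ^ l - (aeval t₂ V / aeval t₃ V) ^ (y * m * l)‖ *
      (y : ℝ) ^ (91 * (m * L)) ≤ 1) : False := by
  obtain ⟨F, _, _, hF, φ, α, hφ, hInt, hψ⟩ := exists_numberField_of_depressedCubic hirr h₁ h₂ h₃
  let R : ℤ[X] := (3 * X ^ 2 + C a) * V ^ (y * m)
  have hR : ∀ t : ℂ, aeval t R = ρ t := fun t => by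
    rw [hρ]
    simp [R, map_ofNat (aeval t)]
  have hV0 : ∀ i, aeval (α i) V ≠ 0 := by
    intro i h
    have := congrArg φ h
    rw [map_aeval_int, hφ, map_zero] at this
    fin_cases i <;> simp at this <;> rw [this] at hV <;> simp at hV
  have hRprod : ρ t₁ * ρ t₂ * ρ t₃ = ((4 * a ^ 3 + 27 * b ^ 2 : ℤ) : ℂ) := by
    have e1 := derivative_prod_eq h₁ h₂ h₃
    have e2 : (aeval t₁ V * aeval t₂ V * aeval t₃ V) ^ (y * m) = 1 := by rw [hV, one_pow]
    rw [hρ, hρ, hρ, ← e1]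
    rw [mul_pow, mul_pow] at e2
    linear_combination ((3 * t₁ ^ 2 + a) * (3 * t₂ ^ 2 + a) * (3 * t₃ ^ 2 + a)) * e2
  have hRF : aeval (α 0) R * aeval (α 1) R * aeval (α 2) R =
      ((4 * a ^ 3 + 27 * b ^ 2 : ℤ) : F) := by
    refine φ.injective ?_
    rw [map_mul, map_mul, map_aeval_int, map_aeval_int, map_aeval_int, hφ, hφ, hφ, hR, hR, hR,
      map_intCast]
    exact hRprod
  have hVF : aeval (α 0) V * aeval (α 1) V * aeval (α 2) V = 1 := by
    refine φ.injective ?_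
    rw [map_mul, map_mul, map_aeval_int, map_aeval_int, map_aeval_int, hφ, hφ, hφ, map_one]
    exact hV
  have hN0 : (4 * a ^ 3 + 27 * b ^ 2 : ℤ) ≠ 0 := by omega
  have hRF0 : aeval (α 0) R * aeval (α 1) R * aeval (α 2) R ≠ 0 := by
    rw [hRF]; exact_mod_cast hN0
  have hR0 : aeval (α 0) R ≠ 0 := left_ne_zero_of_mul (left_ne_zero_of_mul hRF0)
  have hR1 : aeval (α 1) R ≠ 0 := right_ne_zero_of_mul (left_ne_zero_of_mul hRF0)
  have hR2 : aeval (α 2) R ≠ 0 := right_ne_zero_of_mul hRF0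
  have hRint : ∀ i, IsIntegral ℤ (aeval (α i) R) := fun i => isIntegral_aeval_int (hInt i) R
  have hVint : ∀ i, IsIntegral ℤ (aeval (α i) V) := fun i => isIntegral_aeval_int (hInt i) V
  have hφA : φ (-(aeval (α 1) R / aeval (α 2) R)) = -(ρ t₂ / ρ t₃) := by
    rw [map_neg, map_div₀, map_aeval_int, map_aeval_int, hφ, hφ, hR, hR]
    rfl
  have hφη : φ (aeval (α 1) V / aeval (α 2) V) = aeval t₂ V / aeval t₃ V := by
    rw [map_div₀, map_aeval_int, map_aeval_int, hφ, hφ]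
    rfl
  have hV3 : aeval t₃ V ≠ 0 := by
    intro h; rw [h, mul_zero] at hV; exact zero_ne_one hV
  refine false_of_close_powers hF φ y m L D hy hm hL hD (-(aeval (α 1) R / aeval (α 2) R))
    (aeval (α 1) V / aeval (α 2) V) (neg_ne_zero.mpr (div_ne_zero hR1 hR2)) ?_
    (div_ne_zero (hV0 1) (hV0 2)) ?_ ?_ hDy ?_ ?_ ?_ ?_
  · intro h
    have h' : aeval (α 1) R + aeval (α 2) R = 0 := by
      field_simp at h
      linear_combination -h
    have h2 := congrArg φ h'
    rw [map_add, map_aeval_int, map_aeval_int, hφ, hφ, map_zero] at h2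
    have h3 := aeval_eq_zero_of_add_eq_zero hirr h₁ h₂ h₃ R h2
    refine hR0 (φ.injective ?_)
    rw [map_aeval_int, hφ, map_zero]
    exact h3
  · have h4 : ((4 * a ^ 3 + 27 * b ^ 2 : ℤ) : F) * (-(aeval (α 1) R / aeval (α 2) R)) =
        -(aeval (α 0) R * aeval (α 1) R * aeval (α 1) R) := by
      rw [← hRF]; field_simp
    have h5 : IsIntegral ℤ (-(aeval (α 0) R * aeval (α 1) R * aeval (α 1) R)) :=
      (((hRint 0).mul (hRint 1)).mul (hRint 1)).neg
    have hcast : (D : F) = ((D : ℤ) : F) := by push_cast; rfl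
    rw [hcast]
    rcases hDab with h | h
    · rw [h, h4]; exact h5
    · rw [h, Int.cast_neg, neg_mul, h4]; exact h5.neg
  · have : aeval (α 1) V / aeval (α 2) V = aeval (α 1) V * (aeval (α 0) V * aeval (α 1) V) := by
      rw [div_eq_iff (hV0 2), mul_assoc, hVF, mul_one]
    rw [this]
    exact (hVint 1).mul ((hVint 0).mul (hVint 1))
  · intro ψ
    obtain ⟨i, hi⟩ := hψ ψ 1
    obtain ⟨j, hj⟩ := hψ ψ 2
    have hj0 : ρ (![t₁, t₂, t₃] j) ≠ 0 := by
      rw [← hR, ← hj, ← map_aeval_int]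
      simpa using hR2
    rw [map_neg, map_div₀, map_aeval_int, map_aeval_int, hi, hj, hR, hR, norm_neg, norm_div, div_pow,
      div_le_iff₀ (pow_pos (norm_pos_iff.mpr hj0) 3)]
    exact hρy i j
  · intro ψ
    obtain ⟨i, hi⟩ := hψ ψ 1
    obtain ⟨j, hj⟩ := hψ ψ 2
    have hj0 : aeval (![t₁, t₂, t₃] j) V ≠ 0 := by
      rw [← hj, ← map_aeval_int]
      simpa using hV0 2
    rw [map_div₀, map_aeval_int, map_aeval_int, hi, hj, norm_div,
      div_le_iff₀ (norm_pos_iff.mpr hj0)]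
    exact hVy i j
  · have : aeval t₂ V / aeval t₃ V - 1 = (aeval t₂ V - aeval t₃ V) / aeval t₃ V := by
      field_simp
    rw [hφη, this, norm_div, div_mul_eq_mul_div, div_le_one (norm_pos_iff.mpr hV3)]
    exact hV1
  · intro l hl
    rw [hφA, hφη]
    exact hAη l hl

end UnitContradiction

theorem exists_neg_root_cubic {X Y : ℝ} (hX : 0 < X) (hY : 0 < Y) :
    ∃ w : ℝ, w < 0 ∧ 3 * X ≤ w ^ 2 ∧ w ^ 3 - 3 * X * w + 2 * Y = 0 := by
  have hs : √(3 * X) ^ 2 = 3 * X := Real.sq_sqrt (by positivity)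
  have hs0 : 0 < √(3 * X) := Real.sqrt_pos.mpr (by positivity)
  set s := √(3 * X)
  set N := 3 * X + 2 * Y + 1 with hN
  have hNs : s ≤ N := by nlinarith
  have hN1 : 1 ≤ N := by linarith
  obtain ⟨w, ⟨hw1, hw2⟩, hw⟩ := intermediate_value_Icc (neg_le_neg hNs)
    (f := fun w : ℝ => w ^ 3 - 3 * X * w + 2 * Y) (by fun_prop) (show (0 : ℝ) ∈ _ by
      constructor
      · have h1 : N ≤ N ^ 2 := by nlinarith
        have h2 : (-N) ^ 3 - 3 * X * -N + 2 * Y =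
            -(3 * X * (N ^ 2 - N)) - 2 * Y * (N ^ 2 - 1) - N ^ 2 := by rw [hN]; ring
        have h3 : 0 ≤ 3 * X * (N ^ 2 - N) := mul_nonneg (by positivity) (by linarith)
        have h4 : 0 ≤ 2 * Y * (N ^ 2 - 1) := mul_nonneg (by positivity) (by linarith)
        show (-N) ^ 3 - 3 * X * -N + 2 * Y ≤ 0
        nlinarith
      · show 0 ≤ (-s) ^ 3 - 3 * X * -s + 2 * Y
        have : (-s) ^ 3 - 3 * X * -s + 2 * Y = 2 * Y := by rw [← hs]; ring
        linarith)
  exact ⟨w, by linarith, by nlinarith, hw⟩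

/-- The roots `w`, `p + q`, `p - q` of `T ^ 3 - 3 * X * T + 2 * Y`, the last two being close. -/
theorem exists_roots_cubic {X Y κ : ℝ} (hX : 0 < X) (hY : 0 < Y) (hκ : 1 ≤ κ)
    (hk : |X ^ 3 - Y ^ 2| = κ) (hκX : 100 * κ ≤ X) :
    ∃ (w p r β : ℝ) (q : ℂ), q ^ 2 = r ∧ (w - p) ^ 2 - r = β ∧ 6 * X ≤ β ∧
      (‖q‖ * β) ^ 2 = 27 * κ ∧ ‖q‖ ≤ p ∧ ‖q‖ * β ≤ p ∧ 0 < p ∧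
      (w : ℂ) + (p + q) + (p - q) = 0 ∧
      (w : ℂ) * (p + q) + w * (p - q) + (p + q) * (p - q) = -3 * (X : ℂ) ∧
      (w : ℂ) * (p + q) * (p - q) = -(2 * (Y : ℂ)) ∧
      3 * (w : ℂ) ^ 2 + -3 * (X : ℂ) = β ∧
      3 * (p + q) ^ 2 + -3 * (X : ℂ) = 2 * q * (3 * p + q) ∧
      3 * (p - q) ^ 2 + -3 * (X : ℂ) = -(2 * q * (3 * p - q)) := by
  obtain ⟨w, hw0, hw2, hw⟩ := exists_neg_root_cubic hX hY
  obtain ⟨q, hq'⟩ := IsAlgClosed.exists_pow_nat_eq ((3 * X - 3 * w ^ 2 / 4 : ℝ) : ℂ) two_pos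
  have hwC : (w : ℂ) ^ 3 - 3 * X * w + 2 * Y = 0 := by exact_mod_cast hw
  have hqC : q ^ 2 = 3 * (X : ℂ) - 3 * (w : ℂ) ^ 2 / 4 := by rw [hq']; push_cast; ring
  have hβ6 : 6 * X ≤ 3 * (w ^ 2 - X) := by linarith
  have hβ0 : 0 ≤ 3 * (w ^ 2 - X) := by linarith
  have hqn : ‖q‖ ^ 2 = |3 * X - 3 * w ^ 2 / 4| := by
    rw [← norm_pow, hq', Complex.norm_real, Real.norm_eq_abs]
  have hprod : (‖q‖ * (3 * (w ^ 2 - X))) ^ 2 = 27 * κ := by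
    have e : (3 * X - 3 * w ^ 2 / 4) * (3 * (w ^ 2 - X)) ^ 2 = 27 * (X ^ 3 - Y ^ 2) := by
      linear_combination (27 / 4 * (2 * Y - (w ^ 3 - 3 * X * w))) * hw
    have e' := congrArg abs e
    rwa [abs_mul, abs_mul, hk, abs_sq, abs_of_nonneg (show (0 : ℝ) ≤ 27 by norm_num), ← hqn,
      ← mul_pow] at e'
  have hq0 := norm_nonneg q
  have hp2 : 27 * κ ≤ (-w / 2) ^ 2 := by nlinarith
  have hqβ : ‖q‖ * (3 * (w ^ 2 - X)) ≤ -w / 2 :=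
    abs_le_of_sq_le_sq' (by rw [hprod]; exact hp2) (by linarith) |>.2
  have hqp : ‖q‖ ≤ -w / 2 := by
    refine le_trans ?_ hqβ
    exact le_mul_of_one_le_right hq0 (by linarith)
  refine ⟨w, -w / 2, 3 * X - 3 * w ^ 2 / 4, 3 * (w ^ 2 - X), q, hq', by ring, hβ6, hprod, hqp, hqβ,
    by linarith, by push_cast; ring, ?_, ?_, by push_cast; ring, ?_, ?_⟩
  · push_cast; linear_combination -hqC
  · push_cast; linear_combination (-(w : ℂ)) * hqC + hwC
  · push_cast; linear_combination hqC
  · push_cast; linear_combination hqC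

theorem cube_sub_three_mul_add_ne_zero {x y κ : ℕ} (h : (x : ℤ) ^ 3 ≠ (y : ℤ) ^ 2)
    (hκ : ((x : ℤ) ^ 3 - (y : ℤ) ^ 2).natAbs = κ) (hκx : 100 * κ ≤ x) (n : ℤ) :
    n ^ 3 + (-3 * x) * n + 2 * y ≠ 0 := by
  intro hn
  have hk : 4 * ((x : ℤ) ^ 3 - (y : ℤ) ^ 2) = (4 * x - n ^ 2) * (x - n ^ 2) ^ 2 := by
    linear_combination (n ^ 3 - 3 * x * n - 2 * y) * hn
  have hk0 : (x : ℤ) ^ 3 - (y : ℤ) ^ 2 ≠ 0 := sub_ne_zero.mpr h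
  have habs : |4 * (x : ℤ) - n ^ 2| * (x - n ^ 2) ^ 2 = 4 * κ := by
    rw [← abs_of_nonneg (sq_nonneg ((x : ℤ) - n ^ 2)), ← abs_mul, ← hk, abs_mul, ← hκ,
      Int.natCast_natAbs]
    rfl
  have h1 : (4 * (x : ℤ) - n ^ 2) ≠ 0 := fun h0 => hk0 (by rw [h0] at hk; linarith)
  have h2 : ((x : ℤ) - n ^ 2) ≠ 0 := fun h0 => hk0 (by rw [h0] at hk; linarith)
  have h3 : 1 ≤ |4 * (x : ℤ) - n ^ 2| := Int.one_le_abs h1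
  have h4 : 1 ≤ |(x : ℤ) - n ^ 2| := Int.one_le_abs h2
  rw [← sq_abs ((x : ℤ) - n ^ 2)] at habs
  have h5 : |4 * (x : ℤ) - n ^ 2| ≤ 4 * (κ : ℤ) := by
    rw [← habs]; exact le_mul_of_one_le_right (by linarith) (one_le_pow₀ h4)
  have h6 : |(x : ℤ) - n ^ 2| ≤ 4 * (κ : ℤ) := by
    rw [← habs]; exact (le_self_pow₀ h4 two_ne_zero).trans (le_mul_of_one_le_left (by positivity) h3)
  have h7 := abs_le.mp h5
  have h8 := abs_le.mp h6
  have h9 : 100 * (κ : ℤ) ≤ x := by exact_mod_cast hκx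
  have h10 : κ ≠ 0 := by
    rw [← hκ]; exact Int.natAbs_ne_zero.mpr hk0
  omega

theorem pow_mem_Icc_of_abs_sub_le {v E ε : ℝ} (hE : 0 ≤ E) (hε : 0 ≤ ε) {n : ℕ}
    (hn : 2 * n * ε ≤ 1) (hn0 : 0 < n) (h : |v - E| ≤ ε * E) :
    E ^ n ≤ 2 * v ^ n ∧ v ^ n ≤ 2 * E ^ n := by
  obtain ⟨h1, h2⟩ := abs_le.mp h
  have hn1 : (1 : ℝ) ≤ n := by exact_mod_cast hn0
  have hε1 : ε ≤ 1 / 2 := by nlinarith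
  constructor
  · have h3 : ((1 - ε) * E) ^ n ≤ v ^ n := pow_le_pow_left₀ (by nlinarith) (by linarith) n
    have h4 := one_add_mul_le_pow (a := -ε) (by linarith) n
    rw [mul_pow] at h3
    have h5 : 1 / 2 ≤ (1 - ε) ^ n := by
      rw [← sub_eq_add_neg] at h4
      linarith
    have := mul_le_mul_of_nonneg_right h5 (pow_nonneg hE n)
    linarith
  · have h3 : v ^ n ≤ ((1 + ε) * E) ^ n := pow_le_pow_left₀ (by nlinarith) (by linarith) n
    have h4 : (1 + ε) ^ n ≤ 2 := by
      calc (1 + ε) ^ n ≤ Real.exp ε ^ n :=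
            pow_le_pow_left₀ (by linarith) (by linarith [Real.add_one_le_exp ε]) n
        _ = Real.exp (n * ε) := (Real.exp_nat_mul _ _).symm
        _ ≤ Real.exp (1 / 2) := Real.exp_le_exp.mpr (by linarith)
        _ ≤ 2 := by
            have := Real.exp_bound_div_one_sub_of_interval (x := 1 / 2) (by norm_num) (by norm_num)
            norm_num at this ⊢
            exact this
    rw [mul_pow] at h3
    have := mul_le_mul_of_nonneg_right h4 (pow_nonneg hE n)
    linarith

theorem norm_pow_sub_one_le {z : ℂ} {d : ℝ} (hd : d ≤ 1) (hz : ‖z - 1‖ ≤ d) (l : ℕ) :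
    ‖z ^ l - 1‖ ≤ 2 ^ l * d := by
  have hd0 := (norm_nonneg _).trans hz
  have hz2 : ‖z‖ ≤ 2 := by
    have := norm_add_le (z - 1) 1
    rw [sub_add_cancel, norm_one] at this
    linarith
  have key : ‖z ^ l - 1‖ ≤ (2 ^ l - 1) * d := by
    induction l with
    | zero => simp
    | succ l ih =>
      have h1 : z ^ (l + 1) - 1 = z * (z ^ l - 1) + (z - 1) := by ring
      rw [h1]
      refine (norm_add_le _ _).trans ?_
      rw [norm_mul]
      have h2 := mul_le_mul hz2 ih (norm_nonneg _) zero_le_two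
      rw [pow_succ]
      linarith
  linarith

theorem norm_three_mul_add_le {p : ℝ} {q : ℂ} (hq : ‖q‖ ≤ p) :
    2 * p ≤ ‖3 * (p : ℂ) + q‖ ∧ ‖3 * (p : ℂ) + q‖ ≤ 4 * p := by
  have hp : 0 ≤ p := (norm_nonneg q).trans hq
  have h1 : ‖3 * (p : ℂ)‖ = 3 * p := by
    rw [norm_mul, Complex.norm_real, Real.norm_of_nonneg hp]
    norm_num
  constructor
  · have := norm_sub_norm_le (3 * (p : ℂ)) (-q)
    rw [sub_neg_eq_add, norm_neg] at this
    linarith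
  · have := norm_add_le (3 * (p : ℂ)) q
    linarith

theorem cube_le_mul_cube_of_mul_eq {u : Fin 3 → ℝ} (hu : ∀ i, 0 < u i) {A F D T : ℝ} (hA : 1 ≤ A)
    (hF : 1 ≤ F) (hD : 1 ≤ D) (hT : 0 ≤ T) (hprod : u 0 * u 1 * u 2 = D) (h₀ : u 0 ≤ A * F)
    (h₀' : 1 ≤ A * u 0) (h₁ : u 1 ≤ 2 * A * u 2) (h₂ : u 2 ≤ 2 * A * u 1)
    (hT2 : (4 * A ^ 4 * D * F ^ 3) ^ 3 ≤ T ^ 2) (i j : Fin 3) : u i ^ 3 ≤ T * u j ^ 3 := by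
  have hu0 := hu 0
  have hu1 := hu 1
  have hu2 := hu 2
  have hF2 : 1 ≤ F ^ 2 := one_le_pow₀ hF
  have hDF : 1 ≤ D * F ^ 2 := one_le_mul_of_one_le_of_one_le hD hF2
  have small : ∀ u₁ u₂ : ℝ, 0 < u₁ → 0 < u₂ → u 0 * u₁ * u₂ = D → u₁ ≤ 2 * A * u₂ →
      u₂ ≤ 2 * A * u₁ → u₁ ^ 2 ≤ 2 * A ^ 2 * D * F ^ 2 ∧ 1 ≤ 2 * A ^ 2 * F * u₁ ^ 2 := by
    intro u₁ u₂ p₁ p₂ hp q₁ q₂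
    have e1 : u₁ ^ 2 ≤ 2 * A * (u₁ * u₂) := by nlinarith
    have e2 : u₁ * u₂ ≤ A * D := by
      rw [← hp]
      have := mul_le_mul_of_nonneg_right h₀' (mul_pos p₁ p₂).le
      linarith
    have e3 : u₁ * u₂ ≤ 2 * A * u₁ ^ 2 := by nlinarith
    have e4 : 1 ≤ A * F * (u₁ * u₂) := by
      have := mul_le_mul_of_nonneg_right h₀ (mul_pos p₁ p₂).le
      linarith
    constructor
    · have e5 : 2 * A * (u₁ * u₂) ≤ 2 * A * (A * D) := by gcongr
      have e6 : 2 * A ^ 2 * D * 1 ≤ 2 * A ^ 2 * D * F ^ 2 := by gcongr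
      linarith
    · have e5 : A * F * (u₁ * u₂) ≤ A * F * (2 * A * u₁ ^ 2) := by gcongr
      linarith
  have bound : ∀ i, u i ^ 2 ≤ 2 * A ^ 2 * D * F ^ 2 ∧ 1 ≤ 2 * A ^ 2 * F * u i ^ 2 := by
    intro i
    fin_cases i
    · constructor
      · have e1 : u 0 ^ 2 ≤ (A * F) ^ 2 := by gcongr
        have e2 : A ^ 2 * F ^ 2 * 1 ≤ A ^ 2 * F ^ 2 * D := by gcongr
        have e3 : 0 ≤ A ^ 2 * F ^ 2 * D := by positivity
        show u 0 ^ 2 ≤ _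
        linarith
      · have e1 : 1 ≤ (A * u 0) ^ 2 := one_le_pow₀ h₀'
        have e2 : A ^ 2 * u 0 ^ 2 * 1 ≤ A ^ 2 * u 0 ^ 2 * F := by gcongr
        have e3 : 0 ≤ A ^ 2 * u 0 ^ 2 * F := by positivity
        show 1 ≤ 2 * A ^ 2 * F * u 0 ^ 2
        linarith
    · exact small _ _ hu1 hu2 hprod h₁ h₂
    · exact small _ _ hu2 hu1 (show u 0 * u 2 * u 1 = D by linarith) h₂ h₁
  have h1 := (bound i).1
  have h2 := (bound j).2
  have hi := hu i
  have hj := hu j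
  refine (sq_le_sq₀ (by positivity) (by positivity)).mp ?_
  calc (u i ^ 3) ^ 2 = (u i ^ 2 * 1) ^ 3 := by ring
    _ ≤ (2 * A ^ 2 * D * F ^ 2 * (2 * A ^ 2 * F * u j ^ 2)) ^ 3 := by gcongr
    _ = (4 * A ^ 4 * D * F ^ 3) ^ 3 * (u j ^ 3) ^ 2 := by ring
    _ ≤ T ^ 2 * (u j ^ 3) ^ 2 := by gcongr
    _ = (T * u j ^ 3) ^ 2 := by ring

theorem norm_bounds_of_mul_eq_one {V₁ V₂ V₃ : ℂ} (hV : V₁ * V₂ * V₃ = 1) {E : ℝ} (hE : 1 ≤ E)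
    {N : ℕ} (hN : 100 ≤ N) (h₂ : ‖V₂ - E‖ * (N : ℝ) ^ 202 ≤ 24 * E)
    (h₃ : ‖V₃ - E‖ * (N : ℝ) ^ 202 ≤ 24 * E) :
    (∀ m : ℕ, ‖V₁‖ ^ (N * m) * E ^ (2 * N * m) ≤ 4 ^ m ∧
      1 ≤ 4 ^ m * (‖V₁‖ ^ (N * m) * E ^ (2 * N * m)) ∧
      ‖V₂‖ ^ (N * m) ≤ 4 ^ m * ‖V₃‖ ^ (N * m) ∧ ‖V₃‖ ^ (N * m) ≤ 4 ^ m * ‖V₂‖ ^ (N * m)) ∧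
    ‖V₂ - V₃‖ * (N : ℝ) ^ 200 ≤ ‖V₃‖ ∧
    ∀ i j : Fin 3, ‖![V₁, V₂, V₃] i‖ ≤ 16 * E ^ 3 * ‖![V₁, V₂, V₃] j‖ := by
  have hN' : (100 : ℝ) ≤ N := by exact_mod_cast hN
  have hN0 : (0 : ℝ) < (N : ℝ) ^ 202 := by positivity
  have hE0 : 0 ≤ E := by linarith
  have hN200 : (1 : ℝ) ≤ (N : ℝ) ^ 200 := one_le_pow₀ (by linarith)
  have hN201 : (N : ℝ) ^ 202 = (N : ℝ) ^ 200 * N ^ 2 := by rw [← pow_add]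
  have dist : ∀ z : ℂ, ‖z - E‖ * (N : ℝ) ^ 202 ≤ 24 * E →
      |‖z‖ - E| ≤ 24 / (N : ℝ) ^ 202 * E := by
    intro z hz
    have h := abs_norm_sub_norm_le z (E : ℂ)
    rw [Complex.norm_real, Real.norm_of_nonneg hE0] at h
    refine h.trans ?_
    rw [div_mul_eq_mul_div, le_div_iff₀ hN0]
    exact hz
  have hε : 2 * (N : ℝ) * (24 / (N : ℝ) ^ 202) ≤ 1 := by
    rw [mul_div_assoc', div_le_one hN0, hN201]
    nlinarith
  have hε1 : 2 * ((1 : ℕ) : ℝ) * (24 / (N : ℝ) ^ 202) ≤ 1 := by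
    refine le_trans ?_ hε
    have : (0 : ℝ) ≤ 24 / (N : ℝ) ^ 202 := by positivity
    push_cast
    nlinarith
  have hε0 : (0 : ℝ) ≤ 24 / (N : ℝ) ^ 202 := by positivity
  obtain ⟨a2, b2⟩ := pow_mem_Icc_of_abs_sub_le hE0 hε0 hε (by omega) (dist _ h₂)
  obtain ⟨a3, b3⟩ := pow_mem_Icc_of_abs_sub_le hE0 hε0 hε (by omega) (dist _ h₃)
  obtain ⟨c2, d2⟩ := pow_mem_Icc_of_abs_sub_le hE0 hε0 hε1 one_pos (dist _ h₂)
  obtain ⟨c3, d3⟩ := pow_mem_Icc_of_abs_sub_le hE0 hε0 hε1 one_pos (dist _ h₃)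
  rw [pow_one, pow_one] at c2 d2 c3 d3
  have hn : ‖V₁‖ * ‖V₂‖ * ‖V₃‖ = 1 := by rw [← norm_mul, ← norm_mul, hV, norm_one]
  have p2 : 0 < ‖V₂‖ := by linarith
  have p3 : 0 < ‖V₃‖ := by linarith
  have p1 : 0 ≤ ‖V₁‖ := norm_nonneg _
  have s1 : ∀ P₁ P₂ P₃ G : ℝ, 0 ≤ P₁ → 0 ≤ P₂ → 0 ≤ P₃ → 0 ≤ G → P₁ * P₂ * P₃ = 1 →
      G ≤ 2 * P₂ → P₂ ≤ 2 * G → G ≤ 2 * P₃ → P₃ ≤ 2 * G →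
      P₁ * G ^ 2 ≤ 4 ∧ 1 ≤ 4 * (P₁ * G ^ 2) := by
    intro P₁ P₂ P₃ G q1 q2 q3 q4 hP g1 g2 g3 g4
    have k1 : G * G ≤ 2 * P₂ * (2 * P₃) := mul_le_mul g1 g3 q4 (by positivity)
    have k2 : P₂ * P₃ ≤ 2 * G * (2 * G) := mul_le_mul g2 g4 q3 (by positivity)
    constructor
    · nlinarith [mul_le_mul_of_nonneg_left k1 q1]
    · nlinarith [mul_le_mul_of_nonneg_left k2 q1]
  refine ⟨fun m => ?_, ?_, ?_⟩
  · have hnN : ‖V₁‖ ^ N * ‖V₂‖ ^ N * ‖V₃‖ ^ N = 1 := by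
      rw [← mul_pow, ← mul_pow, hn, one_pow]
    obtain ⟨k1, k2⟩ := s1 (‖V₁‖ ^ N) (‖V₂‖ ^ N) (‖V₃‖ ^ N) (E ^ N) (by positivity) (by positivity)
      (by positivity) (by positivity) hnN a2 b2 a3 b3
    have e : ‖V₁‖ ^ (N * m) * E ^ (2 * N * m) = (‖V₁‖ ^ N * (E ^ N) ^ 2) ^ m := by
      rw [mul_pow, ← pow_mul, ← pow_mul, ← pow_mul]
      ring_nf
    rw [e, ← mul_pow, pow_mul, pow_mul, ← mul_pow, ← mul_pow]
    exact ⟨pow_le_pow_left₀ (by positivity) k1 m, one_le_pow₀ k2,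
      pow_le_pow_left₀ (by positivity) (by linarith) m,
      pow_le_pow_left₀ (by positivity) (by linarith) m⟩
  · have e1 : V₂ - V₃ = (V₂ - E) - (V₃ - E) := by ring
    have e2 := norm_sub_le (V₂ - E) (V₃ - E)
    rw [← e1] at e2
    have e3 : ‖V₂ - V₃‖ * (N : ℝ) ^ 202 ≤ 48 * E := by
      have := mul_le_mul_of_nonneg_right e2 hN0.le
      linarith
    rw [hN201, ← mul_assoc] at e3
    have e4 : 0 ≤ ‖V₂ - V₃‖ * (N : ℝ) ^ 200 := by positivity
    have e5 : (10000 : ℝ) ≤ (N : ℝ) ^ 2 := by nlinarith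
    have e6 := mul_le_mul_of_nonneg_left e5 e4
    linarith
  · obtain ⟨k1, k2⟩ := s1 ‖V₁‖ ‖V₂‖ ‖V₃‖ E p1 p2.le p3.le hE0 hn c2 d2 c3 d3
    have hE2 : 1 ≤ E ^ 2 := one_le_pow₀ hE
    have hE3 : E ^ 2 ≤ E ^ 3 := pow_le_pow_right₀ hE (by norm_num)
    have up : ∀ i : Fin 3, ‖![V₁, V₂, V₃] i‖ ≤ 4 * E := by
      intro i
      fin_cases i
      · show ‖V₁‖ ≤ 4 * E
        nlinarith
      · show ‖V₂‖ ≤ 4 * E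
        linarith
      · show ‖V₃‖ ≤ 4 * E
        linarith
    have lo : ∀ i : Fin 3, 1 ≤ 4 * E ^ 2 * ‖![V₁, V₂, V₃] i‖ := by
      intro i
      fin_cases i
      · show 1 ≤ 4 * E ^ 2 * ‖V₁‖
        linarith
      · show 1 ≤ 4 * E ^ 2 * ‖V₂‖
        nlinarith
      · show 1 ≤ 4 * E ^ 2 * ‖V₃‖
        nlinarith
    intro i j
    have := mul_le_mul (up i) (lo j) zero_le_one (by positivity)
    linarith

theorem norm_mul_pow_sub_pow_mul_le_one {N t m l : ℕ} (hN : N = 10000) (ht : 0 < t) (hm : 0 < m)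
    {β : ℝ} (hβ : 1 ≤ β) (hβlo : Real.exp t ^ (2 * N * m) ≤ β) {ζ η : ℂ} (hζ : ‖ζ - 1‖ ≤ 1 / β)
    (hη : ‖η‖ ≤ 1 + (N : ℝ)⁻¹) (hl : l < 3 * (t + 1)) :
    ‖(ζ * η ^ (N * m)) ^ l - η ^ (N * m * l)‖ * (N : ℝ) ^ (91 * (m * (t + 1))) ≤ 1 := by
  have hNr : (N : ℝ) = 10000 := by rw [hN]; norm_num
  set Q := m * (t + 1) with hQ
  have hη2 : ‖η‖ ^ (N * m * l) ≤ (N : ℝ) ^ Q := by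
    refine (pow_le_pow_left₀ (norm_nonneg _) hη _).trans (one_add_inv_pow_le N Q _ (by omega) ?_)
    rw [hQ]
    calc N * m * l ≤ N * m * (3 * (t + 1)) := Nat.mul_le_mul_left _ hl.le
      _ = _ := by ring
  have h2l : (2 : ℝ) ^ l ≤ (N : ℝ) ^ Q := by
    calc (2 : ℝ) ^ l ≤ 2 ^ (3 * Q) := by
          refine pow_le_pow_right₀ (by norm_num) ?_
          rw [hQ]
          exact hl.le.trans (Nat.mul_le_mul_left _ (Nat.le_mul_of_pos_left _ hm))
      _ = (2 ^ 3) ^ Q := pow_mul _ _ _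
      _ ≤ _ := pow_le_pow_left₀ (by norm_num) (by rw [hNr]; norm_num) _
  have hNQ : (N : ℝ) ^ (93 * Q) ≤ β := by
    refine le_trans ?_ hβlo
    have e1 : (N : ℝ) ^ 186 ≤ Real.exp 1 ^ (2 * N) := by
      calc (N : ℝ) ^ 186 ≤ (2 ^ 14) ^ 186 := pow_le_pow_left₀ (Nat.cast_nonneg _)
              (by rw [hNr]; norm_num) _
        _ = 2 ^ (14 * 186) := (pow_mul _ _ _).symm
        _ ≤ 2 ^ (2 * N) := pow_le_pow_right₀ one_le_two (by omega)
        _ ≤ _ := pow_le_pow_left₀ zero_le_two (by linarith [Real.add_one_le_exp 1]) _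
    have e2 : Real.exp t = Real.exp 1 ^ t := by rw [← Real.exp_nat_mul, mul_one]
    calc (N : ℝ) ^ (93 * Q) ≤ (N : ℝ) ^ (186 * (t * m)) := by
          refine pow_le_pow_right₀ (by rw [hNr]; norm_num) ?_
          rw [hQ]
          calc 93 * (m * (t + 1)) ≤ 93 * (m * (t + t)) := by gcongr; exact ht
            _ = _ := by ring
      _ = ((N : ℝ) ^ 186) ^ (t * m) := pow_mul _ _ _
      _ ≤ (Real.exp 1 ^ (2 * N)) ^ (t * m) := by gcongr
      _ = Real.exp t ^ (2 * N * m) := by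
        rw [e2, ← pow_mul, ← pow_mul]; ring_nf
  have hfac : (ζ * η ^ (N * m)) ^ l - η ^ (N * m * l) = η ^ (N * m * l) * (ζ ^ l - 1) := by
    rw [mul_pow, ← pow_mul]
    ring
  have hζl := norm_pow_sub_one_le (by rw [div_le_one (by linarith)]; exact hβ) hζ l
  rw [hfac, norm_mul, norm_pow]
  have hNp : (0 : ℝ) ≤ (N : ℝ) ^ Q := by positivity
  calc _ ≤ (N : ℝ) ^ Q * ((N : ℝ) ^ Q * (1 / β)) * (N : ℝ) ^ (91 * Q) := by
        gcongr
        exact hζl.trans (by gcongr)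
    _ = (N : ℝ) ^ (93 * Q) / β := by
        rw [show 93 * Q = Q + Q + 91 * Q by ring, pow_add, pow_add]; ring
    _ ≤ 1 := (div_le_one (by linarith)).mpr hNQ

open Polynomial in
theorem false_of_parameters {x y κ N t m : ℕ} (hκ : 0 < κ)
    (hk : ((x : ℤ) ^ 3 - (y : ℤ) ^ 2).natAbs = κ) (hκx : 100 * κ ≤ x) (hN : N = 10000)
    (ht : 0 < t) (hm : 0 < m) {w p β : ℝ} {q : ℂ}
    (hβ : 1 ≤ β) (hqβ2 : (‖q‖ * β) ^ 2 = 27 * κ) (hqp : ‖q‖ ≤ p) (hqβ : ‖q‖ * β ≤ p) (hp : 0 < p)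
    (h₁ : (w : ℂ) + (p + q) + (p - q) = 0)
    (h₂ : (w : ℂ) * (p + q) + w * (p - q) + (p + q) * (p - q) = (-3 * x : ℤ))
    (h₃ : (w : ℂ) * (p + q) * (p - q) = -(2 * y : ℤ))
    (hβ1 : 3 * (w : ℂ) ^ 2 + (-3 * x : ℤ) = β)
    (hβ2 : 3 * (p + q) ^ 2 + (-3 * x : ℤ) = 2 * q * (3 * p + q))
    (hβ3 : 3 * (p - q) ^ 2 + (-3 * x : ℤ) = -(2 * q * (3 * p - q)))
    (V : ℤ[X]) (hV : aeval (w : ℂ) V * aeval (p + q) V * aeval (p - q) V = 1)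
    (hV2 : ‖aeval (p + q) V - Real.exp t‖ * (N : ℝ) ^ 202 ≤ 24 * Real.exp t)
    (hV3 : ‖aeval (p - q) V - Real.exp t‖ * (N : ℝ) ^ 202 ≤ 24 * Real.exp t)
    (hβlo : Real.exp t ^ (2 * N * m) ≤ β) (hβhi : β ≤ Real.exp t ^ (2 * N * (m + 1)))
    (hm' : 64 * ((108 * κ : ℕ) : ℝ) ^ 3 * Real.exp t ^ (18 * N) ≤ 4 ^ m) : False := by
  have hNr : (N : ℝ) = 10000 := by rw [hN]; norm_num
  have hκ1 : (1 : ℝ) ≤ κ := by exact_mod_cast hκ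
  have hk0 : (x : ℤ) ^ 3 - (y : ℤ) ^ 2 ≠ 0 := Int.natAbs_ne_zero.mp (by omega)
  have hirr := irreducible_map_depressedCubic
    (cube_sub_three_mul_add_ne_zero (sub_ne_zero.mp hk0) hk hκx)
  have hE : 1 ≤ Real.exp t := Real.one_le_exp (by positivity)
  set E := Real.exp t with hEdef
  obtain ⟨hpow, hnear, hratio⟩ := norm_bounds_of_mul_eq_one hV hE (by omega) hV2 hV3
  let ρ : ℂ → ℂ := fun z => (3 * z ^ 2 + (-3 * x : ℤ)) * aeval z V ^ (N * m)
  have hDD : ‖ρ w * ρ (p + q) * ρ (p - q)‖ = (108 * κ : ℕ) := by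
    have e1 := derivative_prod_eq h₁ h₂ h₃
    have e2 : (aeval (w : ℂ) V * aeval (p + q) V * aeval (p - q) V) ^ (N * m) = 1 := by
      rw [hV, one_pow]
    rw [mul_pow, mul_pow] at e2
    have e3 : ρ w * ρ (p + q) * ρ (p - q) = ((4 * (-3 * x) ^ 3 + 27 * (2 * y) ^ 2 : ℤ) : ℂ) := by
      rw [← e1]
      linear_combination ((3 * (w : ℂ) ^ 2 + (-3 * x : ℤ)) * (3 * (p + q) ^ 2 + (-3 * x : ℤ)) *
        (3 * (p - q) ^ 2 + (-3 * x : ℤ))) * e2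
    have e4 : (4 * (-3 * x) ^ 3 + 27 * (2 * y) ^ 2 : ℤ) = -108 * ((x : ℤ) ^ 3 - (y : ℤ) ^ 2) := by
      ring
    rw [e3, e4, Complex.norm_intCast, ← Int.cast_abs, abs_mul, ← Int.natCast_natAbs (_ - _), hk]
    push_cast
    norm_num
  have hq0 : q ≠ 0 := by
    rintro rfl
    rw [norm_zero, zero_mul] at hqβ2
    linarith
  have hqn : 0 < ‖q‖ := norm_pos_iff.mpr hq0
  obtain ⟨g1, g2⟩ := norm_three_mul_add_le hqp
  obtain ⟨g3, g4⟩ := norm_three_mul_add_le (p := p) (q := -q) (by rwa [norm_neg])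
  rw [← sub_eq_add_neg] at g3 g4
  have b2 : ‖(3 * (p + q) ^ 2 + (-3 * x : ℤ) : ℂ)‖ = 2 * ‖q‖ * ‖3 * (p : ℂ) + q‖ := by
    rw [hβ2, norm_mul, norm_mul, Complex.norm_two]
  have b3 : ‖(3 * (p - q) ^ 2 + (-3 * x : ℤ) : ℂ)‖ = 2 * ‖q‖ * ‖3 * (p : ℂ) - q‖ := by
    rw [hβ3, norm_neg, norm_mul, norm_mul, Complex.norm_two]
  have hv2 : aeval ((p : ℂ) + q) V ≠ 0 := right_ne_zero_of_mul (left_ne_zero_of_mul_eq_one hV)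
  have hv3 : aeval ((p : ℂ) - q) V ≠ 0 := right_ne_zero_of_mul_eq_one hV
  have hu : ∀ i : Fin 3, 0 < ‖ρ (![(w : ℂ), p + q, p - q] i)‖ := by
    have h0 : ρ w * ρ (p + q) * ρ (p - q) ≠ 0 := by
      rw [← norm_pos_iff, hDD]; positivity
    intro i
    rw [norm_pos_iff]
    fin_cases i
    exacts [left_ne_zero_of_mul (left_ne_zero_of_mul h0),
      right_ne_zero_of_mul (left_ne_zero_of_mul h0), right_ne_zero_of_mul h0]
  have n1 : ‖ρ w‖ = β * ‖aeval (w : ℂ) V‖ ^ (N * m) := by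
    simp only [ρ]
    rw [hβ1, norm_mul, norm_pow, Complex.norm_real, Real.norm_of_nonneg (by linarith)]
  have n2 : ‖ρ (p + q)‖ = 2 * ‖q‖ * ‖3 * (p : ℂ) + q‖ * ‖aeval (p + q) V‖ ^ (N * m) := by
    simp only [ρ]
    rw [norm_mul, norm_pow, b2]
  have n3 : ‖ρ (p - q)‖ = 2 * ‖q‖ * ‖3 * (p : ℂ) - q‖ * ‖aeval (p - q) V‖ ^ (N * m) := by
    simp only [ρ]
    rw [norm_mul, norm_pow, b3]
  obtain ⟨f1, f2, f3, f4⟩ := hpow m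
  have hA : (1 : ℝ) ≤ 4 ^ m := one_le_pow₀ (by norm_num)
  have hT8 : ((10000 : ℝ) ^ m) ^ 2 = (10 ^ 8) ^ m := by
    rw [← pow_mul, mul_comm, pow_mul]; norm_num
  have hT : (4 * ((4 : ℝ) ^ m) ^ 4 * ((108 * κ : ℕ) : ℝ) * (E ^ (2 * N)) ^ 3) ^ 3 ≤
      ((N : ℝ) ^ m) ^ 2 := by
    have e1 : (4 * ((4 : ℝ) ^ m) ^ 4 * ((108 * κ : ℕ) : ℝ) * (E ^ (2 * N)) ^ 3) ^ 3 =
        (64 * ((108 * κ : ℕ) : ℝ) ^ 3 * E ^ (18 * N)) * (4 ^ 12) ^ m := by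
      rw [show 18 * N = 2 * N * 9 by ring, pow_mul E (2 * N) 9, ← pow_mul (4 : ℝ) 12 m, mul_comm 12 m,
        pow_mul (4 : ℝ) m 12]
      ring
    rw [e1, hNr, hT8]
    calc _ ≤ (4 : ℝ) ^ m * (4 ^ 12) ^ m := by gcongr
      _ = (4 * 4 ^ 12) ^ m := (mul_pow _ _ _).symm
      _ ≤ _ := pow_le_pow_left₀ (by norm_num) (by norm_num) m
  have hD1 : (1 : ℝ) ≤ ((108 * κ : ℕ) : ℝ) := by exact_mod_cast (by omega : 1 ≤ 108 * κ)
  have hρ3 := cube_le_mul_cube_of_mul_eq hu hA (one_le_pow₀ hE : 1 ≤ E ^ (2 * N)) hD1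
    (by positivity) (by rw [← hDD, norm_mul (ρ w * _), norm_mul (ρ w)]; rfl)
    (by
      show ‖ρ w‖ ≤ _
      rw [n1]
      calc _ ≤ E ^ (2 * N * (m + 1)) * ‖aeval (w : ℂ) V‖ ^ (N * m) := by gcongr
        _ = (‖aeval (w : ℂ) V‖ ^ (N * m) * E ^ (2 * N * m)) * E ^ (2 * N) := by
          rw [mul_add, pow_add, mul_one]; ring
        _ ≤ _ := by gcongr)
    (by
      show _ ≤ _ * ‖ρ w‖
      rw [n1]
      refine f2.trans ?_
      rw [mul_comm β]
      gcongr)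
    (by
      show ‖ρ (p + q)‖ ≤ _ * ‖ρ (p - q)‖
      rw [n2, n3]
      calc _ ≤ 2 * ‖q‖ * (2 * ‖3 * (p : ℂ) - q‖) * (4 ^ m * ‖aeval (p - q) V‖ ^ (N * m)) := by
            gcongr
            linarith
        _ = _ := by ring)
    (by
      show ‖ρ (p - q)‖ ≤ _ * ‖ρ (p + q)‖
      rw [n2, n3]
      calc _ ≤ 2 * ‖q‖ * (2 * ‖3 * (p : ℂ) + q‖) * (4 ^ m * ‖aeval (p + q) V‖ ^ (N * m)) := by
            gcongr
            linarith
        _ = _ := by ring) hT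
  refine false_of_unit_polynomial hirr h₁ h₂ h₃ V hV ρ N m (t + 1) (108 * κ) (fun _ => rfl) ?_
    (by omega) hm (by omega) (by omega) ?_ hρ3 ?_ hnear ?_
  · have e4 : (4 * (-3 * x) ^ 3 + 27 * (2 * y) ^ 2 : ℤ) = -108 * ((x : ℤ) ^ 3 - (y : ℤ) ^ 2) := by
      ring
    rw [e4]
    omega
  · rw [hNr]
    have e1 : (1 : ℝ) ≤ E ^ (18 * N) := one_le_pow₀ hE
    have e2 : (4 : ℝ) ^ m ≤ 10000 ^ m := pow_le_pow_left₀ (by norm_num) (by norm_num) m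
    have e3 : 0 ≤ ((108 * κ : ℕ) : ℝ) ^ 3 := by positivity
    nlinarith
  · intro i j
    have e0 : ∀ i, ![aeval (w : ℂ) V, aeval ((p : ℂ) + q) V, aeval ((p : ℂ) - q) V] i =
        aeval (![(w : ℂ), p + q, p - q] i) V := by
      intro i
      fin_cases i <;> rfl
    have h0 := hratio i j
    rw [e0, e0] at h0
    refine h0.trans (mul_le_mul_of_nonneg_right ?_ (norm_nonneg _))
    have e1 : E ≤ 3 ^ t := by
      rw [hEdef, ← mul_one (t : ℝ), Real.exp_nat_mul]
      exact pow_le_pow_left₀ (Real.exp_pos _).le (by linarith [Real.exp_one_lt_d9]) t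
    have e2 : E ^ 3 ≤ 10000 ^ t := by
      calc E ^ 3 ≤ (3 ^ t) ^ 3 := by gcongr
        _ = (3 ^ 3) ^ t := by rw [← pow_mul, mul_comm, pow_mul]
        _ ≤ _ := pow_le_pow_left₀ (by norm_num) (by norm_num) t
    rw [hNr, pow_succ]
    calc 16 * E ^ 3 ≤ 10000 * 10000 ^ t := by gcongr; norm_num
      _ = _ := mul_comm _ _
  · intro l hl
    have hsub0 : 3 * (p : ℂ) - q ≠ 0 := norm_pos_iff.mp (by linarith)
    set η := aeval ((p : ℂ) + q) V / aeval ((p : ℂ) - q) V with hη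
    have hρρ : -(ρ (p + q) / ρ (p - q)) = (3 * p + q) / (3 * p - q) * η ^ (N * m) := by
      simp only [ρ]
      rw [hβ2, hβ3, hη, div_pow]
      field_simp
    have hζ : ‖(3 * (p : ℂ) + q) / (3 * p - q) - 1‖ ≤ 1 / β := by
      have e1 : (3 * (p : ℂ) + q) / (3 * p - q) - 1 = 2 * q / (3 * p - q) := by
        field_simp
        ring
      rw [e1, norm_div, norm_mul, Complex.norm_two, div_le_div_iff₀ (by linarith) (by linarith)]
      linarith
    have hηn : ‖η‖ ≤ 1 + (N : ℝ)⁻¹ := by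
      have e1 : η = 1 + (aeval ((p : ℂ) + q) V - aeval ((p : ℂ) - q) V) / aeval ((p : ℂ) - q) V := by
        rw [hη]; field_simp; ring
      rw [e1]
      refine (norm_add_le _ _).trans ?_
      rw [norm_one, norm_div]
      have hv3n : 0 < ‖aeval ((p : ℂ) - q) V‖ := norm_pos_iff.mpr hv3
      have hNpos : (0 : ℝ) < N := by rw [hNr]; norm_num
      have hN1 : (N : ℝ) ≤ N ^ 200 := le_self_pow₀ (by rw [hNr]; norm_num) (by norm_num)
      have e2 : ‖aeval ((p : ℂ) + q) V - aeval ((p : ℂ) - q) V‖ / ‖aeval ((p : ℂ) - q) V‖ ≤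
          (N : ℝ)⁻¹ := by
        rw [div_le_iff₀ hv3n, ← div_eq_inv_mul, le_div_iff₀ hNpos]
        exact (mul_le_mul_of_nonneg_left hN1 (norm_nonneg _)).trans hnear
      linarith
    rw [hρρ]
    exact norm_mul_pow_sub_pow_mul_le_one hN ht hm hβ hβlo hζ hηn hl

theorem pow_le_of_le_rpow_one_div {c L : ℝ} {n : ℕ} (hn : n ≠ 0) (hc : 0 ≤ c) (hL : 0 ≤ L)
    (h : c ≤ L ^ ((1 : ℝ) / n)) : c ^ n ≤ L := by
  rw [one_div] at h
  exact (pow_le_pow_left₀ hc h n).trans_eq (Real.rpow_inv_natCast_pow hL hn)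

theorem exists_nat_parameter {β : ℝ} {N t κ : ℕ} (hN : N = 10000) (ht : 0 < t) (hκ : 0 < κ)
    (hβ : 0 < β) (h : 10 ^ 11 * (t : ℝ) ^ 2 * κ ≤ Real.log β) :
    ∃ m : ℕ, 0 < m ∧ Real.exp t ^ (2 * N * m) ≤ β ∧ β ≤ Real.exp t ^ (2 * N * (m + 1)) ∧
      64 * ((108 * κ : ℕ) : ℝ) ^ 3 * Real.exp t ^ (18 * N) ≤ 4 ^ m := by
  have hNr : (N : ℝ) = 10000 := by rw [hN]; norm_num
  have ht1 : (1 : ℝ) ≤ t := by exact_mod_cast ht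
  have hκ1 : (1 : ℝ) ≤ κ := by exact_mod_cast hκ
  have htκ : (t : ℝ) ≤ t * κ := le_mul_of_one_le_right (by linarith) hκ1
  have hκt : (κ : ℝ) ≤ t * κ := le_mul_of_one_le_left (by linarith) ht1
  have hd : (0 : ℝ) < 20000 * t := by linarith
  set m := ⌊Real.log β / (20000 * t)⌋₊ with hm
  have h0 : 0 ≤ Real.log β := le_trans (by positivity) h
  have hlo : (m : ℝ) * (20000 * t) ≤ Real.log β :=
    (le_div_iff₀ hd).mp (Nat.floor_le (div_nonneg h0 hd.le))
  have hhi : Real.log β < (m + 1) * (20000 * t) :=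
    (div_lt_iff₀ hd).mp (Nat.lt_floor_add_one _)
  have hm5 : 5000000 * (t * κ : ℝ) < m + 1 := by
    refine lt_of_mul_lt_mul_right (lt_of_le_of_lt (le_trans (le_of_eq ?_) h) hhi) hd.le
    ring
  have hexp : ∀ n : ℕ, Real.exp t ^ (2 * N * n) = Real.exp (n * (20000 * t)) := by
    intro n
    rw [← Real.exp_nat_mul]
    push_cast
    rw [hNr]
    ring_nf
  refine ⟨m, ?_, ?_, ?_, ?_⟩
  · have : (0 : ℝ) < m := by linarith
    exact_mod_cast this
  · rw [hexp, ← Real.le_log_iff_exp_le hβ]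
    exact hlo
  · rw [hexp, ← Real.log_le_iff_le_exp hβ]
    push_cast
    exact hhi.le
  · have e1 : ((108 * κ : ℕ) : ℝ) ≤ Real.exp (108 * κ) := by
      push_cast
      linarith [Real.add_one_le_exp (108 * κ : ℝ)]
    have e2 : (64 : ℝ) ≤ Real.exp 1 ^ 6 := by
      calc (64 : ℝ) = 2 ^ 6 := by norm_num
        _ ≤ _ := pow_le_pow_left₀ zero_le_two (by linarith [Real.add_one_le_exp 1]) _
    calc _ ≤ Real.exp 1 ^ 6 * Real.exp (108 * κ) ^ 3 * Real.exp t ^ (18 * N) := by gcongr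
      _ = Real.exp (6 + 324 * κ + 180000 * t) := by
        rw [← Real.exp_nat_mul, ← Real.exp_nat_mul, ← Real.exp_nat_mul, ← Real.exp_add,
          ← Real.exp_add]
        push_cast
        rw [hNr]
        ring_nf
      _ ≤ Real.exp m := Real.exp_le_exp.mpr (by linarith)
      _ = Real.exp 1 ^ m := by rw [← Real.exp_nat_mul, mul_one]
      _ ≤ 4 ^ m := pow_le_pow_left₀ (Real.exp_pos _).le (by linarith [Real.exp_one_lt_d9]) m

theorem false_of_pow_le_log {x y κ N : ℕ} (hx : 0 < x) (hy : 0 < y) (hκ : 0 < κ)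
    (hk : ((x : ℤ) ^ 3 - (y : ℤ) ^ 2).natAbs = κ) (hN : N = 10000)
    (h : (10 ^ 10 * κ : ℝ) ^ N ≤ Real.log x) : False := by
  have hx0 : (0 : ℝ) < x := by exact_mod_cast hx
  have hy0 : (0 : ℝ) < y := by exact_mod_cast hy
  have hκ1 : (1 : ℝ) ≤ κ := by exact_mod_cast hκ
  have hNr : (N : ℝ) = 10000 := by rw [hN]; norm_num
  have hc1 : (1 : ℝ) ≤ 10 ^ 10 * κ := by linarith
  have hcx : (10 ^ 10 * κ : ℝ) ≤ x :=
    (le_self_pow₀ hc1 (by omega)).trans (h.trans (Real.log_le_self hx0.le))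
  have hκx : (100 * κ : ℝ) ≤ x := by linarith
  have hκx' : 100 * κ ≤ x := by exact_mod_cast hκx
  have hk0 : (x : ℤ) ^ 3 - (y : ℤ) ^ 2 ≠ 0 := Int.natAbs_ne_zero.mp (by omega)
  have hkr : |(x : ℝ) ^ 3 - (y : ℝ) ^ 2| = κ := by
    rw [← hk, Nat.cast_natAbs]
    push_cast
    rfl
  obtain ⟨w, p, r, β, q, hq, hβ, hβ6, hqβ2, hqp, hqβ, hp, h₁, h₂, h₃, hβ1, hβ2, hβ3⟩ :=
    exists_roots_cubic hx0 hy0 hκ1 hkr hκx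
  have hirr := irreducible_map_depressedCubic
    (cube_sub_three_mul_add_ne_zero (sub_ne_zero.mp hk0) hk hκx')
  have ha : ((-3 * x : ℤ) : ℂ) = -3 * ((x : ℝ) : ℂ) := by push_cast; rfl
  have hb : ((2 * y : ℤ) : ℂ) = 2 * ((y : ℝ) : ℂ) := by push_cast; rfl
  rw [← ha] at h₂ hβ1 hβ2 hβ3
  rw [← hb] at h₃
  have hroot : ∀ z : ℂ, (z - w) * (z - (p + q)) * (z - (p - q)) = 0 →
      z ^ 3 + (-3 * x : ℤ) * z + (2 * y : ℤ) = 0 := by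
    intro z hz
    linear_combination hz + z ^ 2 * h₁ - z * h₂ + h₃
  have hβ1' : 1 ≤ β := by linarith
  have hqβ0 : ‖q‖ * β ≠ 0 := by
    intro h0
    rw [h0] at hqβ2
    linarith
  have hdet : |‖q‖ * β| < 6 * κ := by
    refine abs_lt_of_sq_lt_sq ?_ (by linarith)
    rw [hqβ2]
    nlinarith
  have hW : 0 < N ^ 202 * κ := Nat.mul_pos (Nat.pow_pos (by omega)) hκ
  obtain ⟨t, ht, htle, V, hV, hV2, hV3⟩ := exists_unit_polynomial (-3 * x) (2 * y) w p r q hq κ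
    (N ^ 202 * κ) hκ hW (by rwa [hβ]) (by rwa [hβ]) h₁ h₂ h₃ fun v hv =>
      ⟨quadEval_ne_zero_of_irreducible hirr (hroot _ (by ring)) hv,
        quadEval_ne_zero_of_irreducible hirr (hroot _ (by ring)) hv,
        quadEval_ne_zero_of_irreducible hirr (hroot _ (by ring)) hv⟩
  have cancel : ∀ z : ℂ, ‖z‖ * ((N ^ 202 * κ : ℕ) : ℝ) ≤ 24 * κ * Real.exp t →
      ‖z‖ * (N : ℝ) ^ 202 ≤ 24 * Real.exp t := by
    intro z hz
    push_cast at hz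
    refine le_of_mul_le_mul_right (le_trans (le_of_eq ?_) (hz.trans (le_of_eq ?_)))
      (show (0 : ℝ) < κ by linarith) <;> ring
  have hlog : 10 ^ 11 * (t : ℝ) ^ 2 * κ ≤ Real.log β := by
    refine le_trans ?_ (Real.log_le_log hx0 (by linarith : (x : ℝ) ≤ β))
    refine le_trans ?_ h
    set c : ℝ := 10 ^ 10 * κ with hc
    have e1 : (t : ℝ) ≤ (c * c * (c ^ 202 * c)) ^ 8 := by
      have : (t : ℝ) ≤ (49 * κ * (N ^ 202 * κ)) ^ 8 := by exact_mod_cast htle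
      refine this.trans ?_
      gcongr
      all_goals linarith
    calc 10 ^ 11 * (t : ℝ) ^ 2 * κ ≤ c ^ 2 * ((c * c * (c ^ 202 * c)) ^ 8) ^ 2 * c := by
          gcongr
          · nlinarith
          · linarith
      _ = c ^ 3283 := by
        rw [show c * c * (c ^ 202 * c) = c ^ 205 by ring, ← pow_mul, ← pow_mul, ← pow_add,
          ← pow_succ]
      _ ≤ c ^ N := pow_le_pow_right₀ hc1 (by omega)
  obtain ⟨m, hm, hm1, hm2, hm3⟩ := exists_nat_parameter hN ht hκ (by linarith) hlog
  exact false_of_parameters hκ hk hκx' hN ht hm hβ1' hqβ2 hqp hqβ hp h₁ h₂ h₃ hβ1 hβ2 hβ3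
    V hV (cancel _ hV2) (cancel _ hV3) hm1 hm2 hm3

/-- **Baker's effective Mordell bound, reformulated.**
For all positive integers `x`, `y` with `x³ ≠ y²`, one has
`|x³ − y²| > 10⁻¹⁰ (log x)^(1/10000)`. -/
theorem baker_mordell_gap (x y : ℕ) (hx : 1 ≤ x) (hy : 1 ≤ y) (h : x ^ 3 ≠ y ^ 2) :
    |(x : ℝ) ^ 3 - (y : ℝ) ^ 2| > 10 ^ (-(10 : ℤ)) * Real.log x ^ ((1 : ℝ) / 10000) := by
  by_contra hle
  rw [gt_iff_lt, not_lt] at hle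
  have hkr : |(x : ℝ) ^ 3 - (y : ℝ) ^ 2| = (((x : ℤ) ^ 3 - (y : ℤ) ^ 2).natAbs : ℝ) := by
    rw [Nat.cast_natAbs]
    push_cast
    rfl
  have hk0 : ((x : ℤ) ^ 3 - (y : ℤ) ^ 2).natAbs ≠ 0 :=
    Int.natAbs_ne_zero.mpr (sub_ne_zero.mpr (by exact_mod_cast h))
  rw [hkr] at hle
  obtain ⟨N, hN⟩ : ∃ N : ℕ, N = 10000 := ⟨_, rfl⟩
  have hNr : (N : ℝ) = 10000 := by rw [hN]; norm_num
  rw [← hNr] at hle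
  refine false_of_pow_le_log hx hy (Nat.pos_of_ne_zero hk0) rfl hN
    (pow_le_of_le_rpow_one_div (by omega) (by positivity)
      (Real.log_nonneg (by exact_mod_cast hx)) ?_)
  have e : (10 : ℝ) ^ (-(10 : ℤ)) = (10 ^ 10)⁻¹ := by rw [zpow_neg]; norm_cast
  rw [e, ← div_eq_inv_mul, le_div_iff₀ (by positivity)] at hle
  linarith
end

section
/- For every integer p and every integer q ≥ 1, |2^(1/3) − p/q| > 10⁻⁶ / q^2.955. -/
open Finset Polynomial

/-- The linear functional on real polynomials sending `X ^ j` to `1 / (β + j)`. -/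
noncomputable def moment (β : ℝ) : ℝ[X] →ₗ[ℝ] ℝ :=
  Polynomial.lsum fun j => (β + j)⁻¹ • LinearMap.id

theorem moment_monomial (β : ℝ) (j : ℕ) (a : ℝ) :
    moment β (monomial j a) = a / (β + j) := by
  simp [moment, Polynomial.sum_monomial_index, div_eq_inv_mul]

theorem moment_C_mul (β c : ℝ) (P : ℝ[X]) : moment β (C c * P) = c * moment β P := by
  rw [← smul_eq_C_mul, map_smul, smul_eq_mul]

theorem moment_X_pow_mul_one_sub_X_pow {β : ℝ} (hβ : ∀ j : ℕ, β + j ≠ 0) (N k : ℕ) :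
    moment β (X ^ k * (1 - X) ^ N) = N.factorial / ∏ m ∈ range (N + 1), (β + k + m) := by
  induction N generalizing k with
  | zero => simp [← monomial_one_right_eq_X_pow, moment_monomial]
  | succ N ih =>
    have h : (X ^ k * (1 - X) ^ (N + 1) : ℝ[X]) =
        X ^ k * (1 - X) ^ N - X ^ (k + 1) * (1 - X) ^ N := by ring
    have h0 : ∀ m : ℕ, β + k + m ≠ 0 := fun m => by
      have := hβ (k + m); push_cast at this; rwa [add_assoc]
    have hp : ∏ m ∈ range N, (β + k + ((m + 1 : ℕ) : ℝ)) ≠ 0 :=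
      prod_ne_zero_iff.2 fun m _ => h0 _
    have e1 : ∏ m ∈ range (N + 1), (β + ((k + 1 : ℕ) : ℝ) + m) =
        (∏ m ∈ range N, (β + k + ((m + 1 : ℕ) : ℝ))) * (β + k + ((N + 1 : ℕ) : ℝ)) := by
      rw [prod_range_succ]
      congr 1
      · exact prod_congr rfl fun m _ => by push_cast; ring
      · push_cast; ring
    have e2 : ∏ m ∈ range (N + 1), (β + k + (m : ℝ)) =
        (∏ m ∈ range N, (β + k + ((m + 1 : ℕ) : ℝ))) * (β + k) := by
      rw [prod_range_succ']; simp
    have e3 : ∏ m ∈ range (N + 1 + 1), (β + k + (m : ℝ)) =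
        (∏ m ∈ range N, (β + k + ((m + 1 : ℕ) : ℝ))) * (β + k) * (β + k + ((N + 1 : ℕ) : ℝ)) := by
      rw [prod_range_succ, e2]
    rw [h, map_sub, ih, ih, e1, e2, e3, Nat.factorial_succ]
    have h1 := h0 (N + 1)
    have h2 := h0 0
    simp only [Nat.cast_zero, add_zero] at h2
    field_simp
    push_cast
    ring

theorem third_sub_ne (n : ℕ) (j : ℕ) : (1 / 3 - (n : ℝ)) + j ≠ 0 := by
  intro h
  have h' : (1 - 3 * n + 3 * j : ℤ) = 0 := by
    have : (1 - 3 * n + 3 * j : ℝ) = 0 := by linarith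
    exact_mod_cast this
  omega

theorem hasDerivAt_moment_comp (n : ℕ) (P : ℝ[X]) {w : ℝ} (hw : w ≠ 0) :
    HasDerivAt (fun w : ℝ => w / (w ^ 3) ^ n * moment (1 / 3 - n) (P.comp (C (w ^ 3) * X)))
      (3 * (P.eval (w ^ 3) / (w ^ 3) ^ n)) w := by
  induction P using Polynomial.induction_on' with
  | add p q hp hq =>
    simp only [add_comp, map_add, mul_add, eval_add, add_div]
    exact hp.add hq
  | monomial j a =>
    have h0 : (1 / 3 - (n : ℝ) + j) ≠ 0 := third_sub_ne n j
    have h1 := ((hasDerivAt_zpow (1 - 3 * n + 3 * j : ℤ) w (Or.inl hw)).const_mul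
      (a / (1 / 3 - (n : ℝ) + j)))
    refine (h1.congr_of_eventuallyEq ?_).congr_deriv ?_
    · filter_upwards [isOpen_ne.mem_nhds hw] with x (hx : x ≠ 0)
      have e : (monomial j a).comp (C (x ^ 3) * X) = monomial j (a * (x ^ 3) ^ j) := by
        rw [monomial_comp, mul_pow, ← C_pow, ← mul_assoc, ← C_mul, C_mul_X_pow_eq_monomial]
      rw [e, moment_monomial, zpow_add₀ hx, zpow_sub₀ hx, zpow_one, zpow_mul, zpow_mul]
      norm_cast
      field_simp
    · have e : (1 - 3 * n + 3 * j - 1 : ℤ) = 3 * j - 3 * n := by ring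
      rw [e, zpow_sub₀ hw, zpow_mul, zpow_mul, eval_monomial]
      push_cast
      norm_cast
      push_cast
      have e' : (1 - 3 * n + 3 * j : ℝ) = 3 * (1 / 3 - n + j) := by ring
      rw [e']
      generalize (1 / 3 - (n : ℝ) + j) = d at h0
      field_simp

/-- The common shape of the numerators and denominators of the approximants. -/
noncomputable def padeSum (γ : ℝ) (n : ℕ) : ℝ :=
  ∑ k ∈ range (n + 1), ((2 * n - k).choose n : ℝ) * 125 ^ (n - k) *
    (3 ^ k * (∏ m ∈ range k, (n + γ - m)) / k.factorial)

theorem factorial_sq_mul_choose_div {n k : ℕ} (hk : k ≤ n) :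
    (n.factorial : ℝ) ^ 2 * ((2 * n - k).choose n / k.factorial) =
      n.choose k * (2 * n - k).factorial := by
  rw [Nat.cast_choose ℝ (show n ≤ 2 * n - k by omega), Nat.cast_choose ℝ hk,
    show 2 * n - k - n = n - k by omega]
  have h1 : (n.factorial : ℝ) ≠ 0 := by positivity
  have h2 : ((n - k).factorial : ℝ) ≠ 0 := by positivity
  have h3 : (k.factorial : ℝ) ≠ 0 := by positivity
  field_simp

theorem prod_mul_moment_upper (n : ℕ) :
    (∏ m ∈ range (2 * n + 1), (1 / 3 - (n : ℝ) + m)) *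
      moment (1 / 3 - n) ((C 128 * X - C 125) ^ n * (1 - X) ^ n) =
    (-1) ^ n * n.factorial ^ 2 * padeSum (-(1 / 3)) n := by
  have h : ((C 128 * X - C 125) ^ n * (1 - X) ^ n : ℝ[X]) =
      ∑ k ∈ range (n + 1), C (3 ^ k * (-125) ^ (n - k) * (n.choose k : ℝ)) *
        (X ^ k * (1 - X) ^ (2 * n - k)) := by
    have : (C 128 * X - C 125 : ℝ[X]) = C 3 * X + C (-125) * (1 - X) := by
      simp only [C_neg, mul_sub, mul_one]
      have : (C 128 : ℝ[X]) = C 3 + C 125 := by rw [← C_add]; norm_num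
      rw [this]; ring
    rw [this, add_pow, sum_mul]
    refine sum_congr rfl fun k hk => ?_
    have hk : k ≤ n := by simpa [Nat.lt_succ_iff] using hk
    rw [show 2 * n - k = (n - k) + n by omega, pow_add]
    simp only [C_mul, C_pow, mul_pow]
    rw [C_eq_natCast]
    ring
  rw [h, map_sum, padeSum, mul_sum, mul_sum]
  refine sum_congr rfl fun k hk => ?_
  have hk : k ≤ n := by simpa [Nat.lt_succ_iff] using hk
  rw [moment_C_mul, moment_X_pow_mul_one_sub_X_pow (third_sub_ne n),
    show 2 * n + 1 = k + (2 * n - k + 1) by omega, prod_range_add]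
  have e1 : ∏ m ∈ range k, (1 / 3 - (n : ℝ) + m) =
      (-1) ^ k * ∏ m ∈ range k, (n + -(1 / 3) - (m : ℝ)) := by
    have : ((-1) ^ k : ℝ) = ∏ _m ∈ range k, (-1 : ℝ) := by simp
    rw [this, ← prod_mul_distrib]
    exact prod_congr rfl fun m _ => by ring
  have e2 : ∏ m ∈ range (2 * n - k + 1), (1 / 3 - (n : ℝ) + ((k + m : ℕ) : ℝ)) =
      ∏ m ∈ range (2 * n - k + 1), (1 / 3 - (n : ℝ) + k + m) :=
    prod_congr rfl fun m _ => by push_cast; ring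
  have h0 : ∏ m ∈ range (2 * n - k + 1), (1 / 3 - (n : ℝ) + k + m) ≠ 0 :=
    prod_ne_zero_iff.2 fun m _ => by
      have := third_sub_ne n (k + m); push_cast at this; rwa [add_assoc]
  rw [e1, e2, show (-125 : ℝ) = (-1) * 125 by norm_num, mul_pow,
    show (-1 : ℝ) ^ n = (-1) ^ k * (-1) ^ (n - k) by rw [← pow_add]; congr 1; omega]
  have hc := factorial_sq_mul_choose_div hk
  generalize ∏ m ∈ range (2 * n - k + 1), (1 / 3 - (n : ℝ) + k + m) = D at h0
  generalize ∏ m ∈ range k, ((n : ℝ) + -(1 / 3) - m) = E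
  calc _ = (-1) ^ k * (-1) ^ (n - k) * E * 3 ^ k * 125 ^ (n - k) *
        (n.choose k * (2 * n - k).factorial) * (D / D) := by ring
    _ = _ := by rw [← hc, div_self h0]; ring

theorem prod_mul_moment_lower (n : ℕ) :
    (∏ m ∈ range (2 * n + 1), (1 / 3 - (n : ℝ) + m)) *
      moment (1 / 3 - n) ((1 - X) ^ n * (C 128 - C 125 * X) ^ n) =
    n.factorial ^ 2 * padeSum (1 / 3) n := by
  have h : ((1 - X) ^ n * (C 128 - C 125 * X) ^ n : ℝ[X]) =
      ∑ k ∈ range (n + 1), C (3 ^ k * 125 ^ (n - k) * (n.choose k : ℝ)) *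
        (X ^ 0 * (1 - X) ^ (2 * n - k)) := by
    have : (C 128 - C 125 * X : ℝ[X]) = C 3 + C 125 * (1 - X) := by
      have : (C 128 : ℝ[X]) = C 3 + C 125 := by rw [← C_add]; norm_num
      rw [this]; ring
    rw [this, add_pow, mul_sum]
    refine sum_congr rfl fun k hk => ?_
    have hk : k ≤ n := by simpa [Nat.lt_succ_iff] using hk
    rw [show 2 * n - k = (n - k) + n by omega, pow_add]
    simp only [C_mul, C_pow, mul_pow]
    rw [C_eq_natCast]
    ring
  rw [h, map_sum, padeSum, mul_sum, mul_sum]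
  refine sum_congr rfl fun k hk => ?_
  have hk : k ≤ n := by simpa [Nat.lt_succ_iff] using hk
  rw [moment_C_mul, moment_X_pow_mul_one_sub_X_pow (third_sub_ne n),
    show 2 * n + 1 = (2 * n - k + 1) + k by omega, prod_range_add]
  have e1 : ∏ m ∈ range k, (1 / 3 - (n : ℝ) + ((2 * n - k + 1 + m : ℕ) : ℝ)) =
      ∏ m ∈ range k, (n + 1 / 3 - (m : ℝ)) := by
    rw [← prod_range_reflect]
    refine prod_congr rfl fun m hm => ?_
    have hm := mem_range.1 hm
    have : ((2 * n - k + 1 + (k - 1 - m) : ℕ) : ℝ) = 2 * n - m := by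
      rw [show 2 * n - k + 1 + (k - 1 - m) = 2 * n - m by omega,
        Nat.cast_sub (by omega)]
      push_cast; ring
    rw [this]; ring
  have h0 : ∏ m ∈ range (2 * n - k + 1), (1 / 3 - (n : ℝ) + m) ≠ 0 :=
    prod_ne_zero_iff.2 fun m _ => third_sub_ne n m
  simp only [Nat.cast_zero, add_zero]
  rw [e1]
  have hc := factorial_sq_mul_choose_div hk
  generalize ∏ m ∈ range (2 * n - k + 1), (1 / 3 - (n : ℝ) + m) = D at h0
  generalize ∏ m ∈ range k, ((n : ℝ) + 1 / 3 - m) = E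
  calc _ = E * 3 ^ k * 125 ^ (n - k) *
        (n.choose k * (2 * n - k).factorial) * (D / D) := by ring
    _ = _ := by rw [← hc, div_self h0]; ring

theorem prod_third_sub (n : ℕ) :
    ∏ m ∈ range (2 * n + 1), (1 / 3 - (n : ℝ) + m) =
      (-1) ^ n * n.factorial ^ 2 * (1 / 3 * ∏ j ∈ range n, (1 - 1 / (9 * ((j : ℝ) + 1) ^ 2))) := by
  induction n with
  | zero => simp
  | succ n ih =>
    rw [show 2 * (n + 1) + 1 = (2 * n + 1) + 1 + 1 by ring, prod_range_succ, prod_range_succ']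
    have e : ∏ m ∈ range (2 * n + 1), (1 / 3 - ((n + 1 : ℕ) : ℝ) + ((m + 1 : ℕ) : ℝ)) =
        ∏ m ∈ range (2 * n + 1), (1 / 3 - (n : ℝ) + m) :=
      prod_congr rfl fun m _ => by push_cast; ring
    rw [e, ih, prod_range_succ, Nat.factorial_succ]
    have : (n : ℝ) + 1 ≠ 0 := by positivity
    generalize ∏ j ∈ range n, (1 - 1 / (9 * ((j : ℝ) + 1) ^ 2)) = D
    push_cast
    field_simp
    ring

/-- The linear form in `1` and `θ`, which is small when `θ ^ 3 = 2`. -/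
noncomputable def padeForm (θ : ℝ) (n : ℕ) : ℝ :=
  4 * θ * padeSum (-(1 / 3)) n - 5 * padeSum (1 / 3) n

theorem padeForm_eq_integral {θ : ℝ} (hθ : 5 / 4 < θ) (hθ3 : θ ^ 3 = 2) (n : ℕ) :
    padeForm θ n = (1 / 3 * ∏ j ∈ range n, (1 - 1 / (9 * ((j : ℝ) + 1) ^ 2))) *
      ∫ w in (5 : ℝ)..(4 * θ), 3 * ((w ^ 3 - 125) * (128 - w ^ 3) / w ^ 3) ^ n := by
  have hpos : ∀ w ∈ Set.uIcc (5 : ℝ) (4 * θ), w ≠ 0 := fun w hw => by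
    rw [Set.uIcc_of_le (by linarith)] at hw
    linarith [hw.1]
  have hint : ∫ w in (5 : ℝ)..(4 * θ), 3 * ((w ^ 3 - 125) * (128 - w ^ 3) / w ^ 3) ^ n =
      4 * θ * moment (1 / 3 - n) ((C 128 * X - C 125) ^ n * (1 - X) ^ n) -
      (-1) ^ n * (5 * moment (1 / 3 - n) ((1 - X) ^ n * (C 128 - C 125 * X) ^ n)) := by
    have := intervalIntegral.integral_eq_sub_of_hasDerivAt
      (a := 5) (b := 4 * θ) (fun w hw => hasDerivAt_moment_comp n
        ((X - C 125) ^ n * (C 128 - X) ^ n : ℝ[X]) (hpos w hw)) ?_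
    · have e : ∀ w : ℝ, 3 * ((w ^ 3 - 125) * (128 - w ^ 3) / w ^ 3) ^ n =
          3 * (((X - C 125) ^ n * (C 128 - X) ^ n : ℝ[X]).eval (w ^ 3) / (w ^ 3) ^ n) := by
        intro w
        simp [mul_pow, div_pow]
      simp_rw [e]
      rw [this]
      have c1 : (4 * θ) ^ 3 = 128 := by rw [mul_pow, hθ3]; norm_num
      have c2 : ((X - C 125) ^ n * (C 128 - X) ^ n : ℝ[X]).comp (C 128 * X) =
          C (128 ^ n) * ((C 128 * X - C 125) ^ n * (1 - X) ^ n) := by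
        simp only [mul_comp, pow_comp, sub_comp, X_comp, C_comp]
        rw [show (C 128 - C 128 * X : ℝ[X]) = C 128 * (1 - X) by ring, mul_pow, C_pow]
        ring
      have c3 : ((X - C 125) ^ n * (C 128 - X) ^ n : ℝ[X]).comp (C 125 * X) =
          C ((-1) ^ n * 125 ^ n) * ((1 - X) ^ n * (C 128 - C 125 * X) ^ n) := by
        simp only [mul_comp, pow_comp, sub_comp, X_comp, C_comp]
        rw [show (C 125 * X - C 125 : ℝ[X]) = C (-1) * C 125 * (1 - X) by
          rw [C_neg, C_1]; ring, mul_pow, mul_pow, C_mul, C_pow, C_pow]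
        ring
      rw [c1, show (5 : ℝ) ^ 3 = 125 by norm_num, c2, c3, moment_C_mul, moment_C_mul]
      field_simp
    · apply ContinuousOn.intervalIntegrable
      refine continuousOn_const.mul (ContinuousOn.div ?_ (by fun_prop) fun w hw => ?_)
      · exact ((Polynomial.continuous _).comp (continuous_pow 3)).continuousOn
      · exact pow_ne_zero _ (pow_ne_zero _ (hpos w hw))
  have h1 := prod_mul_moment_upper n
  have h2 := prod_mul_moment_lower n
  rw [prod_third_sub] at h1 h2
  rw [hint]
  have hf : (n.factorial : ℝ) ≠ 0 := by positivity
  have hs : ((-1 : ℝ) ^ n) ^ 2 = 1 := by rw [← pow_mul, mul_comm, pow_mul]; simp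
  have hs' : ((-1 : ℝ) ^ n) ≠ 0 := by positivity
  generalize (1 / 3 * ∏ j ∈ range n, (1 - 1 / (9 * ((j : ℝ) + 1) ^ 2))) = D at h1 h2 ⊢
  have h1' : D * moment (1 / 3 - n) ((C 128 * X - C 125) ^ n * (1 - X) ^ n) =
      padeSum (-(1 / 3)) n :=
    mul_left_cancel₀ (mul_ne_zero hs' (pow_ne_zero 2 hf)) (by linear_combination h1)
  have h2' : (-1) ^ n * D * moment (1 / 3 - n) ((1 - X) ^ n * (C 128 - C 125 * X) ^ n) =
      padeSum (1 / 3) n :=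
    mul_left_cancel₀ (pow_ne_zero 2 hf) (by linear_combination h2)
  rw [padeForm, ← h1', ← h2']
  ring

theorem one_sub_inv_nine_sq_pos (j : ℕ) : 0 < 1 - 1 / (9 * ((j : ℝ) + 1) ^ 2) := by
  have : (1 : ℝ) < 9 * ((j : ℝ) + 1) ^ 2 := by
    have : (0 : ℝ) ≤ j := j.cast_nonneg
    nlinarith
  rw [sub_pos, div_lt_one (by linarith)]
  exact this

theorem kernel_nonneg_le {θ : ℝ} (hθ3 : θ ^ 3 = 2) {w : ℝ}
    (hw : w ∈ Set.Icc 5 (4 * θ)) :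
    0 ≤ (w ^ 3 - 125) * (128 - w ^ 3) / w ^ 3 ∧
      (w ^ 3 - 125) * (128 - w ^ 3) / w ^ 3 ≤ 0.01779 := by
  have h1 : 5 ^ 3 ≤ w ^ 3 := pow_le_pow_left₀ (by norm_num) hw.1 3
  have h2 : w ^ 3 ≤ (4 * θ) ^ 3 := pow_le_pow_left₀ (by linarith [hw.1]) hw.2 3
  rw [mul_pow, hθ3] at h2
  generalize w ^ 3 = u at *
  have hu : 0 < u := by linarith
  refine ⟨div_nonneg (mul_nonneg (by linarith) (by linarith)) hu.le, ?_⟩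
  rw [div_le_iff₀ hu]
  nlinarith [sq_nonneg (u - 126.491105)]

theorem padeForm_pos {θ : ℝ} (hθ : 5 / 4 < θ) (hθ3 : θ ^ 3 = 2) (n : ℕ) : 0 < padeForm θ n := by
  rw [padeForm_eq_integral hθ hθ3]
  refine mul_pos (mul_pos (by norm_num) (prod_pos fun j _ => one_sub_inv_nine_sq_pos j)) ?_
  refine intervalIntegral.intervalIntegral_pos_of_pos_on ?_ (fun w hw => ?_) (by linarith)
  · apply ContinuousOn.intervalIntegrable
    rw [Set.uIcc_of_le (by linarith)]
    refine continuousOn_const.mul (ContinuousOn.pow (ContinuousOn.div (by fun_prop) (by fun_prop)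
      fun w hw => ?_) _)
    have := hw.1
    positivity
  · have h1 : 5 ^ 3 < w ^ 3 := pow_lt_pow_left₀ hw.1 (by norm_num) (by norm_num)
    have h2 : w ^ 3 < (4 * θ) ^ 3 := pow_lt_pow_left₀ hw.2 (by linarith [hw.1]) (by norm_num)
    rw [mul_pow, hθ3] at h2
    have h3 : 0 < w ^ 3 - 125 := by linarith
    have h4 : 0 < 128 - w ^ 3 := by linarith
    have h5 : 0 < w ^ 3 := by linarith
    positivity

theorem padeForm_succ_le {θ : ℝ} (hθ : 5 / 4 < θ) (hθ3 : θ ^ 3 = 2) (n : ℕ) :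
    padeForm θ (n + 1) ≤ 0.01779 * padeForm θ n := by
  have hcont : ∀ n : ℕ, ContinuousOn
      (fun w : ℝ => 3 * ((w ^ 3 - 125) * (128 - w ^ 3) / w ^ 3) ^ n) (Set.Icc 5 (4 * θ)) := by
    intro n
    refine continuousOn_const.mul (ContinuousOn.pow (ContinuousOn.div (by fun_prop) (by fun_prop)
      fun w hw => ?_) _)
    have := hw.1
    positivity
  have hle : (5 : ℝ) ≤ 4 * θ := by linarith
  have hI : ∫ w in (5 : ℝ)..(4 * θ), 3 * ((w ^ 3 - 125) * (128 - w ^ 3) / w ^ 3) ^ (n + 1) ≤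
      0.01779 * ∫ w in (5 : ℝ)..(4 * θ), 3 * ((w ^ 3 - 125) * (128 - w ^ 3) / w ^ 3) ^ n := by
    rw [← intervalIntegral.integral_const_mul]
    refine intervalIntegral.integral_mono_on hle ?_ ?_ fun w hw => ?_
    · exact ContinuousOn.intervalIntegrable (by rw [Set.uIcc_of_le hle]; exact hcont _)
    · exact ContinuousOn.intervalIntegrable
        (by rw [Set.uIcc_of_le hle]; exact continuousOn_const.mul (hcont _))
    · obtain ⟨h1, h2⟩ := kernel_nonneg_le hθ3 hw
      rw [pow_succ]
      have := mul_le_mul_of_nonneg_left h2 (pow_nonneg h1 n)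
      linarith
  have hpos := padeForm_pos hθ hθ3 n
  rw [padeForm_eq_integral hθ hθ3] at hpos
  have hD : 0 < 1 / 3 * ∏ j ∈ range n, (1 - 1 / (9 * ((j : ℝ) + 1) ^ 2)) :=
    mul_pos (by norm_num) (prod_pos fun j _ => one_sub_inv_nine_sq_pos j)
  have h1 : 1 - 1 / (9 * ((n : ℝ) + 1) ^ 2) ≤ 1 := by
    rw [sub_le_self_iff]; positivity
  rw [padeForm_eq_integral hθ hθ3, padeForm_eq_integral hθ hθ3, prod_range_succ, ← mul_assoc]
  have h0 := (one_sub_inv_nine_sq_pos n).le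
  generalize (1 / 3 * ∏ j ∈ range n, (1 - 1 / (9 * ((j : ℝ) + 1) ^ 2))) = D at *
  generalize 1 - 1 / (9 * ((n : ℝ) + 1) ^ 2) = t at *
  calc _ ≤ D * t * (0.01779 * ∫ w in (5 : ℝ)..(4 * θ),
        3 * ((w ^ 3 - 125) * (128 - w ^ 3) / w ^ 3) ^ n) :=
        mul_le_mul_of_nonneg_left hI (mul_nonneg hD.le h0)
    _ = t * (0.01779 * (D * ∫ w in (5 : ℝ)..(4 * θ),
        3 * ((w ^ 3 - 125) * (128 - w ^ 3) / w ^ 3) ^ n)) := by ring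
    _ ≤ _ := mul_le_of_le_one_left (by positivity) h1

theorem padeForm_le {θ : ℝ} (hθ : 5 / 4 < θ) (hθ3 : θ ^ 3 = 2) (n : ℕ) :
    padeForm θ n ≤ 0.04 * 0.01779 ^ n := by
  induction n with
  | zero =>
    have : θ ≤ 1.26 := by
      by_contra! h
      have := pow_lt_pow_left₀ h (by norm_num) (n := 3) (by norm_num)
      norm_num [hθ3] at this
    norm_num [padeForm, padeSum]
    linarith
  | succ n ih =>
    have := padeForm_succ_le hθ hθ3 n
    rw [pow_succ]
    linarith

theorem factorial_dvd_three_pow_mul_prod (k : ℕ) (c : ℤ) :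
    (k.factorial : ℤ) ∣ 3 ^ (k / 2) * ∏ m ∈ range k, (c - 3 * m) := by
  obtain ⟨e, d, hd, hk⟩ :=
    Nat.exists_eq_pow_mul_and_not_dvd k.factorial_ne_zero 3 (by norm_num)
  have hcop : IsCoprime (3 : ℤ) d := by
    rw [← Nat.cast_ofNat, Nat.isCoprime_iff_coprime]
    exact (Nat.Prime.coprime_iff_not_dvd Nat.prime_three).2 hd
  have : Fact (Nat.Prime 3) := ⟨Nat.prime_three⟩
  have he : e ≤ k / 2 := by
    have h1 : e ≤ padicValNat 3 k.factorial :=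
      (padicValNat_dvd_iff_le k.factorial_ne_zero).1 ⟨d, hk⟩
    have h2 := sub_one_mul_padicValNat_factorial (p := 3) k
    omega
  rw [hk]
  push_cast
  refine mul_dvd_mul (pow_dvd_pow 3 he) ?_
  obtain ⟨t, u, htu⟩ := hcop
  have hmod : ∏ m ∈ range k, (c - 3 * m) ≡ ∏ m ∈ range k, (-3 * (-(c * t) + m)) [ZMOD d] := by
    refine Int.ModEq.prod fun m _ => ?_
    rw [Int.modEq_iff_dvd]
    exact ⟨-(c * u), by linear_combination c * htu⟩
  refine hmod.dvd_iff.2 ?_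
  rw [prod_mul_distrib]
  refine Dvd.dvd.mul_left (dvd_trans ?_ (Nat.factorial_coe_dvd_prod k (-(c * t)))) _
  rw [hk]
  push_cast
  exact dvd_mul_left _ _

theorem exists_int_eq_three_pow_mul_padeSum {γ : ℝ} {e : ℤ} (he : γ * 3 = e) (n : ℕ) :
    ∃ N : ℤ, (N : ℝ) = 3 ^ (n / 2) * padeSum γ n := by
  have h : ∀ k ∈ range (n + 1), ∃ N : ℤ,
      (N : ℝ) = 3 ^ (n / 2) * (3 ^ k * (∏ m ∈ range k, (n + γ - (m : ℝ))) / k.factorial) := by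
    intro k hk
    have hk : k ≤ n := by simpa [Nat.lt_succ_iff] using hk
    obtain ⟨N, hN⟩ := factorial_dvd_three_pow_mul_prod k (3 * n + e)
    obtain ⟨d, hd⟩ : ∃ d, n / 2 = d + k / 2 := ⟨n / 2 - k / 2, by omega⟩
    refine ⟨3 ^ d * N, ?_⟩
    have e1 : (3 ^ k * ∏ m ∈ range k, (n + γ - (m : ℝ))) =
        ((∏ m ∈ range k, (3 * n + e - 3 * m : ℤ) : ℤ) : ℝ) := by
      have : (3 ^ k : ℝ) = ∏ _m ∈ range k, 3 := by simp
      rw [this, ← prod_mul_distrib]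
      push_cast
      exact prod_congr rfl fun m _ => by rw [← he]; ring
    have e2 := congrArg (Int.cast (R := ℝ)) hN
    have hf : (k.factorial : ℝ) ≠ 0 := by positivity
    rw [e1, hd, pow_add, mul_assoc, ← mul_div_assoc]
    push_cast at e2 ⊢
    rw [e2]
    field_simp
  choose! N hN using h
  refine ⟨∑ k ∈ range (n + 1), (2 * n - k).choose n * 125 ^ (n - k) * N k, ?_⟩
  rw [padeSum, mul_sum]
  push_cast
  refine sum_congr rfl fun k hk => ?_
  rw [hN k hk]
  ring

theorem prod_sub_nonneg_le {γ : ℝ} (h0 : 0 ≤ 1 + γ) (h1 : γ ≤ 0) {n k : ℕ} (hk : k ≤ n) :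
    0 ≤ ∏ m ∈ range k, (n + γ - (m : ℝ)) ∧
      (∏ m ∈ range k, (n + γ - (m : ℝ))) / k.factorial ≤ n.choose k := by
  have hm : ∀ m ∈ range k, 0 ≤ n + γ - (m : ℝ) := fun m hm => by
    have : ((m + 1 : ℕ) : ℝ) ≤ n := by
      have := mem_range.1 hm
      exact_mod_cast (by omega : m + 1 ≤ n)
    push_cast at this
    linarith
  refine ⟨prod_nonneg hm, ?_⟩
  rw [div_le_iff₀ (by positivity), mul_comm]
  have e : ((k.factorial : ℝ) * n.choose k) = ∏ m ∈ range k, ((n : ℝ) - m) := by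
    rw [← Nat.cast_mul, ← Nat.descFactorial_eq_factorial_mul_choose,
      Nat.descFactorial_eq_prod_range, Nat.cast_prod]
    refine prod_congr rfl fun m hm => ?_
    rw [Nat.cast_sub (by have := mem_range.1 hm; omega)]
  rw [e]
  exact prod_le_prod hm fun m _ => by linarith

theorem padeSum_le {γ : ℝ} (h0 : 0 ≤ 1 + γ) (h1 : γ ≤ 0) (n : ℕ) : padeSum γ n ≤ 506 ^ n := by
  have e : (506 : ℝ) ^ n = ∑ k ∈ range (n + 1), (2 : ℝ) ^ (2 * n - k) * 125 ^ (n - k) *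
      (3 ^ k * (n.choose k : ℝ)) := by
    rw [show (506 : ℝ) = 6 + 500 by norm_num, add_pow]
    refine sum_congr rfl fun k hk => ?_
    have hk : k ≤ n := by simpa [Nat.lt_succ_iff] using hk
    rw [show 2 * n - k = k + 2 * (n - k) by omega, pow_add, pow_mul,
      show (6 : ℝ) = 2 * 3 by norm_num, show (500 : ℝ) = 2 ^ 2 * 125 by norm_num, mul_pow, mul_pow]
    ring
  rw [e, padeSum]
  refine sum_le_sum fun k hk => ?_
  have hk : k ≤ n := by simpa [Nat.lt_succ_iff] using hk
  obtain ⟨h2, h3⟩ := prod_sub_nonneg_le h0 h1 hk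
  have h4 : ((2 * n - k).choose n : ℝ) ≤ 2 ^ (2 * n - k) := by
    exact_mod_cast Nat.choose_le_two_pow _ _
  rw [mul_div_assoc]
  gcongr

theorem padeSum_mono {γ : ℝ} (h0 : 0 ≤ 1 + γ) (h1 : γ ≤ 0) (n : ℕ) :
    padeSum γ n ≤ padeSum γ (n + 1) := by
  rw [padeSum, padeSum, sum_range_succ _ (n + 1)]
  have h2 := (prod_sub_nonneg_le h0 h1 (le_refl (n + 1))).1
  refine le_add_of_le_of_nonneg (sum_le_sum fun k hk => ?_) (by positivity)
  have hk : k ≤ n := by simpa [Nat.lt_succ_iff] using hk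
  have h3 := (prod_sub_nonneg_le h0 h1 hk).1
  have h4 : (2 * n - k).choose n ≤ (2 * (n + 1) - k).choose (n + 1) := by
    rw [show 2 * (n + 1) - k = (2 * n - k + 1) + 1 by omega, Nat.choose_succ_succ]
    exact (Nat.choose_le_choose n (Nat.le_succ _)).trans (Nat.le_add_right _ _)
  have h5 : ∏ m ∈ range k, (n + γ - (m : ℝ)) ≤ ∏ m ∈ range k, (((n + 1 : ℕ) : ℝ) + γ - m) := by
    refine prod_le_prod (fun m hm => ?_) fun m _ => by push_cast; linarith
    have : ((m + 1 : ℕ) : ℝ) ≤ n := by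
      have := mem_range.1 hm
      exact_mod_cast (by omega : m + 1 ≤ n)
    push_cast at this
    linarith
  have h6 : (125 : ℝ) ^ (n - k) ≤ 125 ^ (n + 1 - k) :=
    pow_le_pow_right₀ (by norm_num) (by omega)
  gcongr

theorem padeSum_zero (γ : ℝ) : padeSum γ 0 = 1 := by simp [padeSum]

theorem padeSum_pos {γ : ℝ} (h0 : 0 ≤ 1 + γ) (h1 : γ ≤ 0) (n : ℕ) : 0 < padeSum γ n :=
  calc (0 : ℝ) < padeSum γ 0 := by rw [padeSum_zero]; exact one_pos
    _ ≤ _ := monotone_nat_of_le_succ (padeSum_mono h0 h1) n.zero_le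

theorem three_pow_half_le (n : ℕ) : (3 : ℝ) ^ (n / 2) ≤ 1.7321 ^ n := by
  refine le_of_pow_le_pow_left₀ two_ne_zero (by positivity) ?_
  calc ((3 : ℝ) ^ (n / 2)) ^ 2 = 3 ^ (n / 2 * 2) := by rw [pow_mul]
    _ ≤ 3 ^ n := pow_le_pow_right₀ (by norm_num) (Nat.div_mul_le_self n 2)
    _ ≤ (1.7321 ^ 2) ^ n := pow_le_pow_left₀ (by norm_num) (by norm_num) n
    _ = (1.7321 ^ n) ^ 2 := by rw [← pow_mul, ← pow_mul, mul_comm]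

/-- A rational number cannot coincide with two consecutive approximants. -/
theorem padeSum_ne_or_succ_ne {θ : ℝ} (hθ : 5 / 4 < θ) (hθ3 : θ ^ 3 = 2) (x : ℝ) (n : ℕ) :
    4 * x * padeSum (-(1 / 3)) n - 5 * padeSum (1 / 3) n ≠ 0 ∨
      4 * x * padeSum (-(1 / 3)) (n + 1) - 5 * padeSum (1 / 3) (n + 1) ≠ 0 := by
  by_contra! h
  obtain ⟨h1, h2⟩ := h
  have e1 : padeForm θ n = 4 * (θ - x) * padeSum (-(1 / 3)) n := by
    rw [padeForm]; linear_combination h1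
  have e2 : padeForm θ (n + 1) = 4 * (θ - x) * padeSum (-(1 / 3)) (n + 1) := by
    rw [padeForm]; linear_combination h2
  have h3 := padeForm_pos hθ hθ3 n
  have h4 := padeForm_succ_le hθ hθ3 n
  have h5 := padeSum_mono (γ := -(1 / 3)) (by norm_num) (by norm_num) n
  have h6 := padeSum_pos (γ := -(1 / 3)) (by norm_num) (by norm_num) n
  have h7 : 0 < 4 * (θ - x) := by
    rw [e1] at h3
    exact pos_of_mul_pos_left h3 h6.le
  have := mul_le_mul_of_nonneg_left h5 h7.le
  rw [← e1, ← e2] at this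
  linarith

theorem one_le_of_padeSum_ne {θ : ℝ} (hθ : 5 / 4 < θ) (hθ3 : θ ^ 3 = 2) {p q : ℤ} (hq : 1 ≤ q)
    {n : ℕ} (hne : 4 * ((p : ℝ) / q) * padeSum (-(1 / 3)) n - 5 * padeSum (1 / 3) n ≠ 0)
    (hn : 0.08 * q * 0.03082 ^ n ≤ (1 : ℝ)) :
    1 ≤ 8 * q * 876.5 ^ n * |θ - (p : ℝ) / q| := by
  obtain ⟨A, hA⟩ := exists_int_eq_three_pow_mul_padeSum
    (γ := -(1 / 3)) (e := -1) (by norm_num) n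
  obtain ⟨B, hB⟩ := exists_int_eq_three_pow_mul_padeSum
    (γ := 1 / 3) (e := 1) (by norm_num) n
  have hq0 : (0 : ℝ) < q := by exact_mod_cast (by omega : 0 < q)
  have h3 := three_pow_half_le n
  have hΛ : 3 ^ (n / 2) * padeForm θ n ≤ 0.04 * 0.03082 ^ n :=
    calc (3 : ℝ) ^ (n / 2) * padeForm θ n ≤ 1.7321 ^ n * (0.04 * 0.01779 ^ n) :=
          mul_le_mul h3 (padeForm_le hθ hθ3 n) (padeForm_pos hθ hθ3 n).le (by positivity)
      _ = 0.04 * (1.7321 * 0.01779) ^ n := by rw [mul_pow]; ring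
      _ ≤ _ := by
        have : (1.7321 * 0.01779 : ℝ) ^ n ≤ 0.03082 ^ n :=
          pow_le_pow_left₀ (by norm_num) (by norm_num) n
        linarith
  have hApos : 0 < (A : ℝ) := by
    rw [hA]
    exact mul_pos (by positivity) (padeSum_pos (by norm_num) (by norm_num) n)
  have hAle : (A : ℝ) ≤ 876.5 ^ n :=
    calc (A : ℝ) ≤ 1.7321 ^ n * 506 ^ n := by
          rw [hA]
          exact mul_le_mul h3 (padeSum_le (by norm_num) (by norm_num) n)
            (padeSum_pos (by norm_num) (by norm_num) n).le (by positivity)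
      _ = (1.7321 * 506) ^ n := by rw [mul_pow]
      _ ≤ _ := pow_le_pow_left₀ (by norm_num) (by norm_num) n
  have hΛpos : 0 < 3 ^ (n / 2) * padeForm θ n := mul_pos (by positivity) (padeForm_pos hθ hθ3 n)
  have hform : 3 ^ (n / 2) * padeForm θ n = 4 * θ * A - 5 * B := by
    rw [hA, hB, padeForm]; ring
  have hint : (4 * p * A - 5 * q * B : ℤ) ≠ 0 := by
    intro h
    apply hne
    have h' : (4 * p * A - 5 * q * B : ℝ) = 0 := by exact_mod_cast h
    rw [hA, hB] at h'
    have h3' : (3 : ℝ) ^ (n / 2) * q ≠ 0 := by positivity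
    apply mul_left_cancel₀ h3'
    rw [mul_zero, ← h']
    field_simp
  have hone : (1 : ℝ) ≤ |(4 * p * A - 5 * q * B : ℝ)| := by
    exact_mod_cast Int.one_le_abs hint
  have hid : (4 * p * A - 5 * q * B : ℝ) =
      q * (3 ^ (n / 2) * padeForm θ n) - 4 * A * q * (θ - (p : ℝ) / q) := by
    rw [hform]
    field_simp
    ring
  have habs : |(4 * p * A - 5 * q * B : ℝ)| ≤
      q * (3 ^ (n / 2) * padeForm θ n) + 4 * A * q * |θ - (p : ℝ) / q| := by
    rw [hid]
    refine (abs_sub _ _).trans_eq ?_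
    rw [abs_of_pos (mul_pos hq0 hΛpos), abs_mul, abs_of_pos (a := 4 * (A : ℝ) * q) (by positivity)]
  have h5 := mul_le_mul_of_nonneg_left hΛ hq0.le
  have h6 : 4 * A * q * |θ - (p : ℝ) / q| ≤ 4 * 876.5 ^ n * q * |θ - (p : ℝ) / q| := by
    gcongr
  linarith

set_option exponentiation.threshold 400 in
theorem le_rpow_baker : (876.5 : ℝ) ≤ (1 / 0.03082) ^ (1.955 : ℝ) := by
  refine le_of_pow_le_pow_left₀ (n := 200) (by norm_num) (by positivity) ?_
  rw [← Real.rpow_natCast (_ ^ (1.955 : ℝ)), ← Real.rpow_mul (by norm_num),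
    show (1.955 : ℝ) * (200 : ℕ) = (391 : ℕ) by norm_num, Real.rpow_natCast]
  norm_num

/-- **Baker's effective irrationality measure for the cube root of 2 (1964).**
For every integer `p` and every integer `q ≥ 1`, `|2^(1/3) − p/q| > 10⁻⁶ / q^2.955`. -/
theorem baker_cbrt_two (p q : ℤ) (hq : 1 ≤ q) :
    |(2 : ℝ) ^ ((1 : ℝ) / 3) - (p : ℝ) / (q : ℝ)| > 10 ^ (-(6 : ℤ)) / (q : ℝ) ^ (2.955 : ℝ) := by
  have hθ3 : ((2 : ℝ) ^ ((1 : ℝ) / 3)) ^ 3 = 2 := by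
    rw [← Real.rpow_natCast, ← Real.rpow_mul (by norm_num)]
    norm_num
  have hθ : 5 / 4 < (2 : ℝ) ^ ((1 : ℝ) / 3) := by
    refine lt_of_pow_lt_pow_left₀ 3 (by positivity) ?_
    rw [hθ3]
    norm_num
  generalize (2 : ℝ) ^ ((1 : ℝ) / 3) = θ at *
  have hq1 : (1 : ℝ) ≤ q := by exact_mod_cast hq
  have hq0 : (0 : ℝ) < q := by linarith
  have hex : ∃ n : ℕ, 0.08 * q * 0.03082 ^ n ≤ (1 : ℝ) := by
    obtain ⟨n, hn⟩ := exists_pow_lt_of_lt_one (show 0 < 1 / (0.08 * (q : ℝ)) by positivity)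
      (show (0.03082 : ℝ) < 1 by norm_num)
    refine ⟨n, ?_⟩
    rw [lt_div_iff₀ (by positivity)] at hn
    linarith
  classical
  obtain ⟨n, hn, hmin⟩ : ∃ n : ℕ, 0.08 * q * 0.03082 ^ n ≤ (1 : ℝ) ∧
      ∀ m < n, (1 : ℝ) < 0.08 * q * 0.03082 ^ m :=
    ⟨Nat.find hex, Nat.find_spec hex, fun m hm => not_le.1 (Nat.find_min hex hm)⟩
  have hbound : 1 ≤ 8 * q * 876.5 ^ (n + 1) * |θ - (p : ℝ) / q| := by
    rcases padeSum_ne_or_succ_ne hθ hθ3 ((p : ℝ) / q) n with hne | hne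
    · refine (one_le_of_padeSum_ne hθ hθ3 hq hne hn).trans ?_
      gcongr
      · norm_num
      · omega
    · refine one_le_of_padeSum_ne hθ hθ3 hq hne (le_trans ?_ hn)
      rw [pow_succ]
      have : 0 ≤ 0.08 * (q : ℝ) * 0.03082 ^ n := by positivity
      linarith
  have hpow : 8 / 10 ^ 6 * 876.5 ^ (n + 1) < (q : ℝ) ^ (1.955 : ℝ) := by
    rcases n with _ | n
    · exact lt_of_lt_of_le (by norm_num) (Real.one_le_rpow hq1 (by norm_num))
    · have h1 := hmin n n.lt_succ_self
      have h2 : 12.5 * (1 / 0.03082) ^ n ≤ (q : ℝ) := by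
        rw [one_div, inv_pow, ← div_eq_mul_inv, div_le_iff₀ (by positivity)]
        linarith
      calc 8 / 10 ^ 6 * 876.5 ^ (n + 1 + 1) = 8 / 10 ^ 6 * 876.5 ^ 2 * (876.5 : ℝ) ^ n := by ring
        _ < 12.5 * 876.5 ^ n := by gcongr; norm_num
        _ ≤ 12.5 ^ (1.955 : ℝ) * ((1 / 0.03082) ^ (1.955 : ℝ)) ^ n := by
          gcongr
          · exact Real.self_le_rpow_of_one_le (by norm_num) (by norm_num)
          · exact le_rpow_baker
        _ = (12.5 * (1 / 0.03082) ^ n) ^ (1.955 : ℝ) := by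
          rw [Real.mul_rpow (by norm_num) (by positivity), ← Real.rpow_natCast,
            ← Real.rpow_natCast, ← Real.rpow_mul (by norm_num), ← Real.rpow_mul (by norm_num),
            mul_comm (n : ℝ)]
        _ ≤ _ := Real.rpow_le_rpow (by positivity) h2 (by norm_num)
  rw [gt_iff_lt, show (2.955 : ℝ) = 1 + 1.955 by norm_num, Real.rpow_add hq0, Real.rpow_one,
    div_lt_iff₀ (by positivity)]
  have hδ : 0 < |θ - (p : ℝ) / q| := by
    by_contra! h
    have : 8 * q * 876.5 ^ (n + 1) * |θ - (p : ℝ) / q| ≤ 0 :=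
      mul_nonpos_of_nonneg_of_nonpos (by positivity) h
    linarith
  have := mul_lt_mul_of_pos_left hpow (mul_pos hδ hq0)
  norm_num only [zpow_neg]
  linarith
end
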